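/- arXiv:2203.02256 — 2 statements merged into one kernel-verified Lean document; each statement's English description precedes it below -/
import Mathlib

section
/- Let d ≥ 3 and let 1 < q ≤ p ≤ 2q with p < d and 1/q < 1/p + 2/d. Then there exists a constant C > 0, independent of τ, such that for every τ ≥ 0 and all Schwartz functions A, B on ℝ^d, setting a := e^{−τΛ₁}A and b := e^{−τΛ₁}B, one has ‖e^{τΛ₁}(ab)‖_{Ḃ^{d/q−2}_{q,∞}} ≤ C·( ‖A‖_{Ḃ^{d/p−2}_{p,∞}}·‖B‖_{Ḃ^{d/p}_{p,∞}} + ‖B‖_{Ḃ^{d/p−2}_{p,∞}}·‖A‖_{Ḃ^{d/p}_{p,∞}} ). -/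
open MeasureTheory SchwartzMap Real
open scoped FourierTransform ENNReal NNReal

noncomputable section

abbrev Rd (d : ℕ) := EuclideanSpace ℝ (Fin d)

/-- Homogeneous Littlewood–Paley block Δ_j f = 𝓕⁻¹(φ(2^{-j}·)·𝓕 f). -/
def LPblock (d : ℕ) (φ : Rd d → ℝ) (j : ℤ) (f : Rd d → ℂ) : Rd d → ℂ :=
  𝓕⁻ fun ξ => (φ (((2:ℝ) ^ (-j)) • ξ) : ℂ) * 𝓕 f ξ

/-- ℓ^r norm (over ℤ) of a sequence of extended nonnegative reals. -/
def seqNorm (r : ℝ≥0∞) (u : ℤ → ℝ≥0∞) : ℝ≥0∞ :=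
  if r = ∞ then ⨆ j, u j else (∑' j, u j ^ r.toReal) ^ (1 / r.toReal)

/-- Homogeneous Besov norm ‖f‖_{Ḃ^s_{p,r}}. -/
def besovNorm (d : ℕ) (φ : Rd d → ℝ) (s : ℝ) (p r : ℝ≥0∞) (f : Rd d → ℂ) : ℝ≥0∞ :=
  seqNorm r fun j =>
    ENNReal.ofReal ((2:ℝ) ^ ((j : ℝ) * s)) * eLpNorm (LPblock d φ j f) p volume

/-- Low-frequency cut-off Ṡ_{j-1} f = ∑_{k ≤ j-2} Δ_k f. -/
def lowFreq (d : ℕ) (φ : Rd d → ℝ) (j : ℤ) (f : Rd d → ℂ) : Rd d → ℂ :=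
  fun x => ∑' k : ℤ, if k ≤ j - 2 then LPblock d φ k f x else 0

/-- Bony paraproduct T_a b = ∑_j Ṡ_{j-1}a · Δ_j b. -/
def para (d : ℕ) (φ : Rd d → ℝ) (a b : Rd d → ℂ) : Rd d → ℂ :=
  fun x => ∑' j : ℤ, lowFreq d φ j a x * LPblock d φ j b x

/-- Bony remainder R(a,b) = ∑_j (Δ_{j-1}a + Δ_j a + Δ_{j+1}a)·Δ_j b. -/
def remainder (d : ℕ) (φ : Rd d → ℝ) (a b : Rd d → ℂ) : Rd d → ℂ :=
  fun x => ∑' j : ℤ,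
    (LPblock d φ (j-1) a x + LPblock d φ j a x + LPblock d φ (j+1) a x) * LPblock d φ j b x

/-- Gevrey multiplier e^{τΛ₁} with symbol e^{τ|ξ|₁}, |ξ|₁ = ∑ᵢ|ξᵢ|. -/
def expL1 (d : ℕ) (τ : ℝ) (f : Rd d → ℂ) : Rd d → ℂ :=
  𝓕⁻ fun ξ => (Real.exp (τ * ∑ i, |ξ i|) : ℂ) * 𝓕 f ξ

/-- Jensen's inequality with an unnormalized weight. -/
theorem rpow_lintegral_mul_le {T : Type*} [MeasurableSpace T] {ν : Measure T} {f g : T → ℝ≥0∞}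
    (hf : Measurable f) (hg : Measurable g) {p : ℝ} (hp : 1 ≤ p) :
    (∫⁻ t, f t * g t ∂ν) ^ p ≤ (∫⁻ t, f t ∂ν) ^ (p - 1) * ∫⁻ t, f t * g t ^ p ∂ν := by
  have hp0 : 0 < p := by linarith
  rcases hp.eq_or_lt with rfl | hp1
  · simp
  have hc : p.conjExponent.HolderConjugate p := (Real.HolderConjugate.conjExponent hp1).symm
  have := ENNReal.lintegral_mul_le_Lp_mul_Lq ν hc
    (f := fun t => f t ^ (1 / p.conjExponent)) (g := fun t => f t ^ (1 / p) * g t)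
    (hf.pow_const _).aemeasurable ((hf.pow_const _).mul hg).aemeasurable
  have hq0 : 0 < p.conjExponent := hc.pos
  have e1 : ∀ t, (f t ^ (1 / p.conjExponent)) ^ p.conjExponent = f t := fun t => by
    rw [← ENNReal.rpow_mul, one_div_mul_cancel hq0.ne', ENNReal.rpow_one]
  have e2 : ∀ t, (f t ^ (1 / p) * g t) ^ p = f t * g t ^ p := fun t => by
    rw [ENNReal.mul_rpow_of_nonneg _ _ hp0.le, ← ENNReal.rpow_mul, one_div_mul_cancel hp0.ne',
      ENNReal.rpow_one]
  have e3 : ∀ t, f t ^ (1 / p.conjExponent) * (f t ^ (1 / p) * g t)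
      = f t * g t := fun t => by
    rw [← mul_assoc, ← ENNReal.rpow_add_of_nonneg _ _ (by positivity) (by positivity)]
    have := hc.inv_add_inv_eq_one
    rw [one_div, one_div, this, ENNReal.rpow_one]
  simp only [Pi.mul_apply, e1, e2, e3] at this
  calc _ ≤ ((∫⁻ t, f t ∂ν) ^ (1 / p.conjExponent) *
        (∫⁻ t, f t * g t ^ p ∂ν) ^ (1 / p)) ^ p := by
        gcongr
    _ = _ := by
        rw [ENNReal.mul_rpow_of_nonneg _ _ hp0.le, ← ENNReal.rpow_mul, ← ENNReal.rpow_mul,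
          one_div_mul_cancel hp0.ne', ENNReal.rpow_one]
        congr 2
        rw [Real.conjExponent]
        field_simp

/-- Minkowski's inequality for a superposition of translates. -/
theorem eLpNorm_integral_translate_le {T E : Type*} [MeasurableSpace T] {ν : Measure T} [SFinite ν]
    [MeasurableSpace E] [AddCommGroup E] [MeasurableAdd₂ E] [MeasurableNeg E] {μ : Measure E} [SFinite μ]
    [μ.IsAddRightInvariant] {γ : T → E} (hγ : Measurable γ) {κ : T → ℂ} (hκ : Measurable κ)
    {h : E → ℂ} (hh : Measurable h) {p : ℝ} (hp : 1 ≤ p) :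
    eLpNorm (fun x => ∫ t, κ t * h (x - γ t) ∂ν) (ENNReal.ofReal p) μ
      ≤ (∫⁻ t, ‖κ t‖ₑ ∂ν) * eLpNorm h (ENNReal.ofReal p) μ := by
  have hp0 : 0 < p := by linarith
  have hpne : ENNReal.ofReal p ≠ 0 := by simpa using hp0
  set K := ∫⁻ t, ‖κ t‖ₑ ∂ν with hK
  have hsub : Measurable fun z : E × T => h (z.1 - γ z.2) :=
    hh.comp (by
      simp only [sub_eq_add_neg]
      exact measurable_fst.add (hγ.comp measurable_snd).neg)
  have hJ : ∀ x, (∫⁻ t, ‖κ t‖ₑ * ‖h (x - γ t)‖ₑ ∂ν) ^ p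
      ≤ K ^ (p - 1) * ∫⁻ t, ‖κ t‖ₑ * ‖h (x - γ t)‖ₑ ^ p ∂ν := by
    intro x
    have hm : Measurable fun t => ‖h (x - γ t)‖ₑ :=
      (hsub.comp (measurable_const.prodMk measurable_id)).enorm
    exact rpow_lintegral_mul_le hκ.enorm hm hp
  rw [eLpNorm_eq_lintegral_rpow_enorm_toReal hpne ENNReal.ofReal_ne_top,
    eLpNorm_eq_lintegral_rpow_enorm_toReal hpne ENNReal.ofReal_ne_top, ENNReal.toReal_ofReal hp0.le]
  have hT : ∫⁻ x, ‖∫ t, κ t * h (x - γ t) ∂ν‖ₑ ^ p ∂μ ≤ K ^ p * ∫⁻ x, ‖h x‖ₑ ^ p ∂μ := by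
    calc ∫⁻ x, ‖∫ t, κ t * h (x - γ t) ∂ν‖ₑ ^ p ∂μ
        ≤ ∫⁻ x, K ^ (p - 1) * ∫⁻ t, ‖κ t‖ₑ * ‖h (x - γ t)‖ₑ ^ p ∂ν ∂μ := by
          refine lintegral_mono fun x => le_trans ?_ (hJ x)
          gcongr
          refine (enorm_integral_le_lintegral_enorm _).trans_eq ?_
          simp only [enorm_mul]
      _ = K ^ (p - 1) * ∫⁻ t, ∫⁻ x, ‖κ t‖ₑ * ‖h (x - γ t)‖ₑ ^ p ∂μ ∂ν := by
          have hmm : Measurable fun z : E × T => ‖κ z.2‖ₑ * ‖h (z.1 - γ z.2)‖ₑ ^ p :=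
            (hκ.comp measurable_snd).enorm.mul (hsub.enorm.pow_const _)
          rw [lintegral_const_mul _ hmm.lintegral_prod_right', lintegral_lintegral_swap hmm.aemeasurable]
      _ = K ^ (p - 1) * ∫⁻ t, ‖κ t‖ₑ * ∫⁻ x, ‖h x‖ₑ ^ p ∂μ ∂ν := by
          congr 1
          refine lintegral_congr fun t => ?_
          rw [lintegral_const_mul]
          · congr 1
            exact lintegral_sub_right_eq_self (fun x => ‖h x‖ₑ ^ p) (γ t)
          · exact (hsub.comp (measurable_id.prodMk measurable_const)).enorm.pow_const _
      _ = K ^ p * ∫⁻ x, ‖h x‖ₑ ^ p ∂μ := by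
          rw [lintegral_mul_const _ hκ.enorm, ← mul_assoc]
          congr 1
          conv_rhs => rw [show p = (p - 1) + 1 by ring,
            ENNReal.rpow_add_of_nonneg _ _ (by linarith) zero_le_one, ENNReal.rpow_one]
  calc _ ≤ (K ^ p * ∫⁻ x, ‖h x‖ₑ ^ p ∂μ) ^ (1 / p) := by gcongr
    _ = _ := by
      rw [ENNReal.mul_rpow_of_nonneg _ _ (by positivity), ← ENNReal.rpow_mul,
        mul_one_div_cancel hp0.ne', ENNReal.rpow_one]

/-- The trigonometric inequality behind M. Riesz's theorem. -/
theorem exists_norm_rpow_le_re_rpow {p : ℝ} (hp1 : 1 < p) (hp2 : p ≤ 2) :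
    ∃ A B : ℝ, 0 ≤ A ∧ ∀ w : ℂ, 0 < w.re → ‖w‖ ^ p ≤ A * w.re ^ p - B * (w ^ (p : ℂ)).re := by
  have hpi := Real.pi_pos
  have hp0 : 0 < p := by linarith
  set θ := (p + 1) * π / (4 * p) with hθ
  have hθp : θ * p = (p + 1) * π / 4 := by rw [hθ]; field_simp
  have hθ0 : 0 < θ := by positivity
  have hθ2 : θ < π / 2 := by
    rw [hθ, div_lt_div_iff₀ (by positivity) (by norm_num)]; nlinarith
  have hc : Real.cos (θ * p) < 0 := by
    apply Real.cos_neg_of_pi_div_two_lt_of_lt <;> rw [hθp] <;> nlinarith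
  have hcθ : 0 < Real.cos θ := Real.cos_pos_of_mem_Ioo ⟨by linarith, hθ2⟩
  set B := -1 / Real.cos (θ * p) with hB
  have hB0 : 0 < B := div_pos_of_neg_of_neg (by norm_num) hc
  refine ⟨(1 + B) / Real.cos θ ^ p, B, by positivity, fun w hw => ?_⟩
  have hw0 : 0 < ‖w‖ := by
    rw [norm_pos_iff]; rintro rfl; simp at hw
  rw [Complex.cpow_ofReal_re]
  have hre : w.re = ‖w‖ * Real.cos |Complex.arg w| := by
    rw [Real.cos_abs, Complex.norm_mul_cos_arg]
  have hcp : Real.cos (Complex.arg w * p) = Real.cos (|Complex.arg w| * p) := by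
    rw [← Real.cos_abs (Complex.arg w * p), abs_mul, abs_of_pos hp0]
  have harg : |Complex.arg w| < π / 2 := by
    rw [Complex.abs_arg_lt_pi_div_two_iff]; exact Or.inl hw
  set α := |Complex.arg w| with hα
  have hα0 : 0 ≤ α := abs_nonneg _
  have hcα : 0 ≤ Real.cos α := (Real.cos_pos_of_mem_Ioo ⟨by linarith, harg⟩).le
  rw [hre, hcp, Real.mul_rpow hw0.le hcα]
  have key : 1 ≤ (1 + B) / Real.cos θ ^ p * Real.cos α ^ p - B * Real.cos (α * p) := by
    rcases le_total α θ with h | h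
    · have h1 : Real.cos θ ≤ Real.cos α := Real.cos_le_cos_of_nonneg_of_le_pi hα0 (by linarith) h
      have h2 : Real.cos θ ^ p ≤ Real.cos α ^ p := Real.rpow_le_rpow hcθ.le h1 hp0.le
      have h3 : 0 < Real.cos θ ^ p := by positivity
      have h4 : 1 + B ≤ (1 + B) / Real.cos θ ^ p * Real.cos α ^ p := by
        rw [div_mul_eq_mul_div, le_div_iff₀ h3]; nlinarith
      nlinarith [Real.cos_le_one (α * p)]
    · have h1 : Real.cos (α * p) ≤ Real.cos (θ * p) :=
        Real.cos_le_cos_of_nonneg_of_le_pi (by positivity) (by nlinarith) (by nlinarith)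
      have h2 : B * Real.cos (θ * p) = -1 := by rw [hB]; field_simp [hc.ne]
      have h3 : 0 ≤ (1 + B) / Real.cos θ ^ p * Real.cos α ^ p := by positivity
      nlinarith
  have hpp : 0 ≤ ‖w‖ ^ p := by positivity
  nlinarith [mul_le_mul_of_nonneg_left key hpp]

/-- The Cauchy integral of `f`; its real part is the Poisson extension of `f`. -/
def cauchyIntegral (f : ℝ → ℝ) (z : ℂ) : ℂ := ∫ t, (f t : ℂ) * (Complex.I / (π * (z - t)))

theorem im_le_norm_sub_ofReal (z : ℂ) (t : ℝ) : z.im ≤ ‖z - t‖ := by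
  have := Complex.abs_im_le_norm (z - t)
  simp only [Complex.sub_im, Complex.ofReal_im, sub_zero] at this
  exact (le_abs_self _).trans this

theorem norm_cauchyKernel (z : ℂ) (t : ℝ) :
    ‖Complex.I / (π * (z - t))‖ = 1 / (π * ‖z - t‖) := by
  simp [abs_of_pos Real.pi_pos]

theorem integrable_cauchyIntegrand {f : ℝ → ℝ} (hf : Integrable f) {z : ℂ} (hz : 0 < z.im) :
    Integrable fun t : ℝ => (f t : ℂ) * (Complex.I / (π * (z - t))) := by
  refine hf.ofReal.mul_bdd (c := 1 / (π * z.im))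
    (by fun_prop : Measurable fun t : ℝ => Complex.I / (π * (z - t))).aestronglyMeasurable (.of_forall fun t => ?_)
  rw [norm_cauchyKernel]
  have := im_le_norm_sub_ofReal z t
  gcongr

theorem differentiableAt_cauchyIntegral {f : ℝ → ℝ} (hf : Integrable f) {z : ℂ} (hz : 0 < z.im) :
    DifferentiableAt ℂ (cauchyIntegral f) z := by
  have him : ∀ w ∈ Metric.ball z (z.im / 2), z.im / 2 < w.im := fun w hw => by
    have h1 := Complex.abs_im_le_norm (w - z)
    have h2 : ‖w - z‖ < z.im / 2 := by simpa [dist_eq_norm] using hw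
    have h3 := abs_lt.1 (h1.trans_lt h2)
    simp only [Complex.sub_im] at h3
    linarith [h3.1]
  refine (hasDerivAt_integral_of_dominated_loc_of_deriv_le
    (F := fun w (t : ℝ) => (f t : ℂ) * (Complex.I / (π * (w - t))))
    (F' := fun w (t : ℝ) => (f t : ℂ) * (-Complex.I / (π * (w - t) ^ 2)))
    (bound := fun t => ‖f t‖ * (1 / (π * (z.im / 2) ^ 2)))
    (Metric.ball_mem_nhds z (half_pos hz)) ?_ (integrable_cauchyIntegrand hf hz) ?_ ?_ ?_ ?_).2.differentiableAt
  · filter_upwards [Metric.ball_mem_nhds z (half_pos hz)] with w hw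
    exact (integrable_cauchyIntegrand hf (by linarith [him w hw])).aestronglyMeasurable
  · exact hf.ofReal.aestronglyMeasurable.mul
      (by fun_prop : Measurable fun t : ℝ => -Complex.I / (π * (z - t) ^ 2)).aestronglyMeasurable
  · refine .of_forall fun t w hw => ?_
    have h1 := him w hw
    have h2 := im_le_norm_sub_ofReal w t
    rw [norm_mul, norm_div, norm_neg, Complex.norm_I, norm_mul, norm_pow, Complex.norm_real,
      Complex.norm_real, Real.norm_of_nonneg Real.pi_pos.le]
    gcongr
    linarith
  · exact hf.norm.mul_const _
  · refine .of_forall fun t w hw => ?_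
    have h1 := him w hw
    have h2 := im_le_norm_sub_ofReal w t
    have h3 : w - t ≠ 0 := by
      rw [← norm_pos_iff]; linarith
    have hpi : (π : ℂ) ≠ 0 := by exact_mod_cast Real.pi_ne_zero
    have h4 : HasDerivAt (fun w : ℂ => (π : ℂ) * (w - t)) (π * 1) w :=
      ((hasDerivAt_id w).sub_const _).const_mul _
    have h5 := ((hasDerivAt_const w Complex.I).div h4 (mul_ne_zero hpi h3)).const_mul (f t : ℂ)
    refine h5.congr_deriv ?_
    simp only [zero_mul, mul_one, zero_sub]
    field_simp

theorem cauchyIntegral_re {f : ℝ → ℝ} (hf : Integrable f) {z : ℂ} (hz : 0 < z.im) :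
    (cauchyIntegral f z).re = ∫ t, f t * (z.im / (π * ‖z - t‖ ^ 2)) := by
  rw [cauchyIntegral, ← RCLike.re_eq_complex_re, ← integral_re (integrable_cauchyIntegrand hf hz)]
  refine integral_congr_ae (.of_forall fun t => ?_)
  simp only [RCLike.re_eq_complex_re, Complex.re_ofReal_mul]
  congr 1
  rw [Complex.div_re, Complex.normSq_mul, ← Complex.normSq_eq_norm_sq]
  have hpi := Real.pi_ne_zero
  simp [Complex.normSq_ofReal]
  field_simp

theorem norm_cauchyIntegral_le {f : ℝ → ℝ} (hf : Integrable f) {N : ℝ} (hN0 : 0 ≤ N)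
    (hN : ∀ t, f t ≠ 0 → |t| ≤ N) {y : ℝ} (hy : 0 < y) {z : ℂ} (hz : y ≤ z.im) :
    ‖cauchyIntegral f z‖ ≤ ((∫ t, |f t|) * ((1 + N) / y + 1)) / (1 + ‖z‖) := by
  calc ‖cauchyIntegral f z‖ ≤ ∫ t, |f t| * (((1 + N) / y + 1) / (1 + ‖z‖)) := by
        refine norm_integral_le_of_norm_le (hf.abs.mul_const _) (.of_forall fun t => ?_)
        rw [norm_mul, norm_cauchyKernel, Complex.norm_real, Real.norm_eq_abs]
        by_cases h0 : f t = 0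
        · simp [h0]
        · have h1 := hN t h0
          have h2 : ‖z‖ - |t| ≤ ‖z - t‖ := by
            have := norm_sub_norm_le z (t : ℂ)
            simpa using this
          have h3 := Real.pi_gt_three
          have h4 := hz.trans (im_le_norm_sub_ofReal z t)
          have h5 : 1 + N ≤ (1 + N) / y * ‖z - t‖ := by
            rw [div_mul_eq_mul_div, le_div_iff₀ hy]; gcongr
          gcongr ?_ * ?_
          have h8 : 0 < ‖z - t‖ := hy.trans_le h4
          rw [div_le_div_iff₀ (by positivity) (by positivity)]
          have h6 : 0 ≤ (1 + N) / y := by positivity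
          have h7 : ((1 + N) / y + 1) * ‖z - t‖ * 1 ≤ ((1 + N) / y + 1) * ‖z - t‖ * π := by
            gcongr; linarith
          nlinarith
    _ = _ := by rw [integral_mul_const]; ring

theorem integral_cauchyIntegral_cpow_eq_zero {f : ℝ → ℝ} (hf : Integrable f) {N : ℝ} (hN0 : 0 ≤ N)
    (hN : ∀ t, f t ≠ 0 → |t| ≤ N) {y : ℝ} (hy : 0 < y) {p : ℝ} (hp : 1 < p)
    (hpos : ∀ z : ℂ, 0 < z.im → 0 < (cauchyIntegral f z).re)
    (hint : Integrable fun x : ℝ => cauchyIntegral f (x + y * Complex.I) ^ (p : ℂ)) :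
    ∫ x : ℝ, cauchyIntegral f (x + y * Complex.I) ^ (p : ℂ) = 0 := by
  set C := (∫ t, |f t|) * ((1 + N) / y + 1) with hC
  have hC0 : 0 ≤ C := mul_nonneg (integral_nonneg fun _ => abs_nonneg _) (by positivity)
  set G : ℂ → ℂ := fun z => cauchyIntegral f z ^ (p : ℂ) with hG
  have hbd : ∀ R : ℝ, 0 < R → ∀ z : ℂ, y ≤ z.im → R ≤ ‖z‖ → ‖G z‖ ≤ (C / R) ^ p := by
    intro R hR z hz hRz
    rw [hG, Complex.norm_cpow_real]
    refine Real.rpow_le_rpow (norm_nonneg _) ?_ (by linarith)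
    refine (norm_cauchyIntegral_le hf hN0 hN hy hz).trans ?_
    rw [← hC]
    gcongr
    linarith
  have hdiff : ∀ z : ℂ, 0 < z.im → DifferentiableAt ℂ G z := fun z hz =>
    (differentiableAt_cauchyIntegral hf hz).cpow_const (Or.inl (hpos z hz))
  have hest : ∀ R : ℝ, 0 < R → ‖∫ x in (-R)..R, G (x + y * Complex.I)‖ ≤ 4 * C ^ p * R ^ (-(p - 1)) := by
    intro R hR
    have hrect := Complex.integral_boundary_rect_eq_zero_of_differentiableOn G
      (⟨-R, y⟩ : ℂ) (⟨R, y + R⟩ : ℂ) (fun z hz => by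
        have h2 : z.im ∈ Set.uIcc y (y + R) := hz.2
        rw [Set.uIcc_of_le (by linarith)] at h2
        exact (hdiff z (by linarith [h2.1])).differentiableWithinAt)
    simp only at hrect
    have t1 : ‖∫ x in (-R)..R, G (x + (y + R : ℝ) * Complex.I)‖ ≤ (C / R) ^ p * |R - -R| := by
      refine intervalIntegral.norm_integral_le_of_norm_le_const fun x _ => hbd R hR _ ?_ ?_
      · simp; linarith
      · refine le_trans ?_ (Complex.abs_im_le_norm _)
        simp
        rw [abs_of_pos (by linarith)]; linarith
    have t2 : ‖∫ s in y..(y + R), G ((R : ℝ) + s * Complex.I)‖ ≤ (C / R) ^ p * |y + R - y| := by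
      refine intervalIntegral.norm_integral_le_of_norm_le_const fun x hx => hbd R hR _ ?_ ?_
      · rw [Set.uIoc_of_le (by linarith)] at hx
        simp; linarith [hx.1]
      · refine le_trans ?_ (Complex.abs_re_le_norm _)
        simp
        exact le_abs_self R
    have t3 : ‖∫ s in y..(y + R), G ((-R : ℝ) + s * Complex.I)‖ ≤ (C / R) ^ p * |y + R - y| := by
      refine intervalIntegral.norm_integral_le_of_norm_le_const fun x hx => hbd R hR _ ?_ ?_
      · rw [Set.uIoc_of_le (by linarith)] at hx
        simp; linarith [hx.1]
      · refine le_trans ?_ (Complex.abs_re_le_norm _)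
        simp
        exact le_abs_self R
    rw [show |R - -R| = 2 * R by rw [abs_of_pos] <;> linarith] at t1
    rw [show |y + R - y| = R by rw [abs_of_pos] <;> linarith] at t2 t3
    set I0 := ∫ x in (-R)..R, G (x + y * Complex.I)
    set I1 := ∫ x in (-R)..R, G (x + (y + R : ℝ) * Complex.I)
    set I2 := ∫ s in y..(y + R), G ((R : ℝ) + s * Complex.I)
    set I3 := ∫ s in y..(y + R), G ((-R : ℝ) + s * Complex.I)
    have e : I0 = I1 - Complex.I • I2 + Complex.I • I3 := by
      linear_combination hrect
    have e2 : (C / R) ^ p * (4 * R) = 4 * C ^ p * R ^ (-(p - 1)) := by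
      rw [Real.div_rpow hC0 hR.le, neg_sub, Real.rpow_sub hR, Real.rpow_one]
      ring
    rw [← e2, e]
    calc _ ≤ ‖I1‖ + ‖I2‖ + ‖I3‖ := by
          refine (norm_add_le _ _).trans ?_
          gcongr
          · refine (norm_sub_le _ _).trans ?_
            simp
          · simp
      _ ≤ _ := by linarith
  have hl1 : Filter.Tendsto (fun R : ℝ => ∫ x in (-R)..R, G (x + y * Complex.I)) Filter.atTop
      (nhds (∫ x : ℝ, G (x + y * Complex.I))) :=
    intervalIntegral_tendsto_integral hint Filter.tendsto_neg_atTop_atBot Filter.tendsto_id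
  have hl2 : Filter.Tendsto (fun R : ℝ => ∫ x in (-R)..R, G (x + y * Complex.I)) Filter.atTop (nhds 0) := by
    refine squeeze_zero_norm' (a := fun R : ℝ => 4 * C ^ p * R ^ (-(p - 1))) ?_ ?_
    · filter_upwards [Filter.eventually_gt_atTop 0] with R hR using hest R hR
    · have := (tendsto_rpow_neg_atTop (show 0 < p - 1 by linarith)).const_mul (4 * C ^ p)
      simpa using this
  exact tendsto_nhds_unique hl1 hl2

theorem cauchyIntegral_re_pos {f : ℝ → ℝ} (hf : Integrable f) (hf0 : ∀ t, 0 ≤ f t)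
    (hne : ¬ f =ᵐ[volume] 0) {z : ℂ} (hz : 0 < z.im) : 0 < (cauchyIntegral f z).re := by
  have hk : ∀ t : ℝ, 0 < z.im / (π * ‖z - t‖ ^ 2) := fun t => by
    have := hz.trans_le (im_le_norm_sub_ofReal z t)
    positivity
  have hi : Integrable fun t => f t * (z.im / (π * ‖z - t‖ ^ 2)) := by
    have h := (integrable_cauchyIntegrand hf hz).re
    refine h.congr (.of_forall fun t => ?_)
    simp only [RCLike.re_eq_complex_re, Complex.re_ofReal_mul]
    congr 1
    rw [Complex.div_re, Complex.normSq_mul, ← Complex.normSq_eq_norm_sq]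
    have hpi := Real.pi_ne_zero
    simp [Complex.normSq_ofReal]
    field_simp
  rw [cauchyIntegral_re hf hz]
  refine lt_of_le_of_ne (integral_nonneg fun t => mul_nonneg (hf0 t) (hk t).le) fun h => hne ?_
  have := (integral_eq_zero_iff_of_nonneg (fun t => mul_nonneg (hf0 t) (hk t).le) hi).1 h.symm
  filter_upwards [this] with t ht
  simpa [(hk t).ne'] using ht

theorem lintegral_cauchyIntegral_rpow_le {f : ℝ → ℝ} (hf : Integrable f) (hf0 : ∀ t, 0 ≤ f t)
    {N : ℝ} (hN0 : 0 ≤ N) (hN : ∀ t, f t ≠ 0 → |t| ≤ N) {y : ℝ} (hy : 0 < y)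
    {p A B : ℝ} (hp : 1 < p) (hA : 0 ≤ A)
    (hAB : ∀ w : ℂ, 0 < w.re → ‖w‖ ^ p ≤ A * w.re ^ p - B * (w ^ (p : ℂ)).re) :
    ∫⁻ x : ℝ, ‖cauchyIntegral f (x + y * Complex.I)‖ₑ ^ p
      ≤ ENNReal.ofReal A * ∫⁻ x : ℝ, ‖(cauchyIntegral f (x + y * Complex.I)).re‖ₑ ^ p := by
  have hp0 : 0 < p := by linarith
  by_cases hne : f =ᵐ[volume] 0
  · have h0 : ∀ z, cauchyIntegral f z = 0 := fun z => by
      refine integral_eq_zero_of_ae ?_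
      filter_upwards [hne] with t ht
      simp [ht]
    simp [h0, hp0]
  set G : ℝ → ℂ := fun x => cauchyIntegral f (x + y * Complex.I) with hG
  have him : ∀ x : ℝ, ((x : ℂ) + y * Complex.I).im = y := fun x => by simp
  have hpos : ∀ x, 0 < (G x).re := fun x => cauchyIntegral_re_pos hf hf0 hne (by rw [him]; exact hy)
  have hcont : Continuous G := by
    rw [continuous_iff_continuousAt]
    intro x
    refine ContinuousAt.comp (g := cauchyIntegral f) ?_ (by fun_prop)
    exact (differentiableAt_cauchyIntegral hf (by rw [him]; exact hy)).continuousAt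
  have hcpow : Continuous fun x => G x ^ (p : ℂ) :=
    hcont.cpow continuous_const fun x => Or.inl (hpos x)
  have hnorm : Integrable fun x => ‖G x‖ ^ p := by
    set C := (∫ t, |f t|) * ((1 + N) / y + 1) with hC
    have hC0 : 0 ≤ C := mul_nonneg (integral_nonneg fun _ => abs_nonneg _) (by positivity)
    have h1 : Integrable fun x : ℝ => C ^ p * (1 + ‖x‖) ^ (-p) :=
      (integrable_one_add_norm (by simpa using hp)).const_mul _
    refine h1.mono' (hcont.norm.rpow_const fun _ => Or.inr hp0.le).aestronglyMeasurable
      (.of_forall fun x => ?_)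
    rw [Real.norm_of_nonneg (by positivity), Real.rpow_neg (by positivity), ← div_eq_mul_inv,
      ← Real.div_rpow hC0 (by positivity)]
    refine Real.rpow_le_rpow (norm_nonneg _) ?_ hp0.le
    refine (norm_cauchyIntegral_le hf hN0 hN hy (him x).ge).trans ?_
    rw [← hC]
    gcongr
    have := Complex.abs_re_le_norm ((x : ℂ) + y * Complex.I)
    simpa using this
  have hint : Integrable fun x => G x ^ (p : ℂ) := by
    refine hnorm.mono' hcpow.aestronglyMeasurable (.of_forall fun x => ?_)
    rw [Complex.norm_cpow_real]
  have hzero := integral_cauchyIntegral_cpow_eq_zero hf hN0 hN hy hp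
    (fun z hz => cauchyIntegral_re_pos hf hf0 hne hz) hint
  have hrei : Integrable fun x => (G x).re ^ p := by
    refine hnorm.mono' ((Complex.continuous_re.comp hcont).rpow_const
      fun _ => Or.inr hp0.le).aestronglyMeasurable (.of_forall fun x => ?_)
    rw [Real.norm_of_nonneg (by have := hpos x; positivity)]
    exact Real.rpow_le_rpow (hpos x).le (Complex.re_le_norm _) hp0.le
  have hmain : ∫ x, ‖G x‖ ^ p ≤ A * ∫ x, (G x).re ^ p := by
    have h1 : ∫ x, (G x ^ (p : ℂ)).re = 0 := by
      have := integral_re hint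
      simp only [RCLike.re_eq_complex_re] at this
      rw [this, hzero, Complex.zero_re]
    have h2 : Integrable fun x => (G x ^ (p : ℂ)).re := hint.re
    calc ∫ x, ‖G x‖ ^ p ≤ ∫ x, (A * (G x).re ^ p - B * (G x ^ (p : ℂ)).re) :=
          integral_mono hnorm ((hrei.const_mul _).sub (h2.const_mul _)) fun x => hAB _ (hpos x)
      _ = _ := by
          rw [integral_sub (hrei.const_mul _) (h2.const_mul _), integral_const_mul,
            integral_const_mul, h1]
          ring
  have e1 : ∫⁻ x, ‖G x‖ₑ ^ p = ENNReal.ofReal (∫ x, ‖G x‖ ^ p) := by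
    rw [ofReal_integral_eq_lintegral_ofReal hnorm (.of_forall fun x => by positivity)]
    refine lintegral_congr fun x => ?_
    rw [← ENNReal.ofReal_rpow_of_nonneg (norm_nonneg _) hp0.le, ofReal_norm]
  have e2 : ∫⁻ x, ‖(G x).re‖ₑ ^ p = ENNReal.ofReal (∫ x, (G x).re ^ p) := by
    rw [ofReal_integral_eq_lintegral_ofReal hrei
      (.of_forall fun x => by have := hpos x; positivity)]
    refine lintegral_congr fun x => ?_
    rw [← ENNReal.ofReal_rpow_of_nonneg (hpos x).le hp0.le, Real.enorm_of_nonneg (hpos x).le]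
  rw [e1, e2, ← ENNReal.ofReal_mul hA]
  exact ENNReal.ofReal_le_ofReal hmain

/-- The Cauchy kernel at height `y`, whose Fourier transform is `e^{-2πyξ}` on `ξ > 0`. -/
def cauchyKernel (y t : ℝ) : ℂ := 1 / (2 * π * (y - t * Complex.I))

theorem measurable_cauchyKernel (y : ℝ) : Measurable (cauchyKernel y) := by
  unfold cauchyKernel
  fun_prop

theorem norm_sub_mul_I (y t : ℝ) : ‖(y : ℂ) - t * Complex.I‖ = √(y ^ 2 + t ^ 2) := by
  have := Complex.norm_add_mul_I y (-t)
  simpa [sub_eq_add_neg] using this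

theorem sub_mul_I_ne_zero {y : ℝ} (hy : 0 < y) (t : ℝ) : (y : ℂ) - t * Complex.I ≠ 0 := by
  rw [← norm_pos_iff, norm_sub_mul_I]
  positivity

theorem norm_cauchyKernel_le {y : ℝ} (hy : 0 < y) (t : ℝ) : ‖cauchyKernel y t‖ ≤ 1 / (2 * π * y) := by
  rw [cauchyKernel, norm_div, norm_mul, norm_sub_mul_I]
  simp only [norm_one, norm_mul, Complex.norm_ofNat, Complex.norm_real, Real.norm_of_nonneg Real.pi_pos.le]
  have : y ≤ √(y ^ 2 + t ^ 2) := Real.le_sqrt_of_sq_le (by nlinarith [sq_nonneg t])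
  gcongr

theorem measurable_integral_translate {T E : Type*} [MeasurableSpace T] {ν : Measure T} [SFinite ν]
    [MeasurableSpace E] [AddCommGroup E] [MeasurableAdd₂ E] [MeasurableNeg E]
    {γ : T → E} (hγ : Measurable γ) {κ : T → ℂ} (hκ : Measurable κ)
    {h : E → ℂ} (hh : Measurable h) : Measurable fun x => ∫ t, κ t * h (x - γ t) ∂ν := by
  have hsub : Measurable fun z : E × T => h (z.1 - γ z.2) :=
    hh.comp (by
      simp only [sub_eq_add_neg]
      exact measurable_fst.add (hγ.comp measurable_snd).neg)
  exact (((hκ.comp measurable_snd).mul hsub).stronglyMeasurable.integral_prod_right').measurable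

theorem cauchyIntegral_eq_two_mul (f : ℝ → ℝ) {y : ℝ} (hy : 0 < y) (x : ℝ) :
    cauchyIntegral f (x + y * Complex.I) = 2 * ∫ t, cauchyKernel y t * (f (x - t) : ℂ) := by
  rw [cauchyIntegral, ← integral_sub_left_eq_self _ volume x, ← integral_const_mul]
  refine integral_congr_ae (.of_forall fun t => ?_)
  have h1 := sub_mul_I_ne_zero hy t
  have h2 : (x : ℂ) + y * Complex.I - (x - t : ℝ) = Complex.I * (y - t * Complex.I) := by
    push_cast; ring_nf; simp
  simp only [cauchyKernel]
  rw [h2]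
  have hpi : (π : ℂ) ≠ 0 := by exact_mod_cast Real.pi_ne_zero
  field_simp

theorem integrable_poissonKernel {y : ℝ} (hy : 0 < y) :
    Integrable (fun t : ℝ => y / (π * (y ^ 2 + t ^ 2))) ∧ ∫ t : ℝ, y / (π * (y ^ 2 + t ^ 2)) = 1 := by
  have h : ∀ t : ℝ, y / (π * (y ^ 2 + t ^ 2)) = (π * y)⁻¹ * (fun s : ℝ => (1 + s ^ 2)⁻¹) (y⁻¹ * t) := by
    intro t; have := Real.pi_pos; field_simp
  simp only [h]
  refine ⟨((integrable_inv_one_add_sq).comp_mul_left' (inv_ne_zero hy.ne')).const_mul _, ?_⟩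
  rw [integral_const_mul, Measure.integral_comp_mul_left (fun s : ℝ => (1 + s ^ 2)⁻¹), integral_univ_inv_one_add_sq]
  have := Real.pi_pos
  simp [abs_of_pos hy]
  field_simp

theorem cauchyIntegral_re_eq {f : ℝ → ℝ} (hf : Integrable f) {y : ℝ} (hy : 0 < y) (x : ℝ) :
    (((cauchyIntegral f (x + y * Complex.I)).re : ℝ) : ℂ)
      = ∫ t, ((y / (π * (y ^ 2 + t ^ 2)) : ℝ) : ℂ) * (f (x - t) : ℂ) := by
  have him : ((x : ℂ) + y * Complex.I).im = y := by simp
  rw [cauchyIntegral_re hf (by rw [him]; exact hy), ← integral_sub_left_eq_self _ volume x,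
    ← integral_complex_ofReal]
  refine integral_congr_ae (.of_forall fun t => ?_)
  have h2 : (x : ℂ) + y * Complex.I - (x - t : ℝ) = t + y * Complex.I := by
    push_cast; ring
  simp only
  rw [h2, him, Complex.norm_add_mul_I, Real.sq_sqrt (by positivity)]
  push_cast
  ring

theorem exists_eLpNorm_cauchyKernel_nonneg_le {p : ℝ} (hp1 : 1 < p) (hp2 : p ≤ 2) :
    ∃ C : ℝ≥0, ∀ y : ℝ, 0 < y → ∀ f : ℝ → ℝ, Measurable f → Integrable f → (∀ t, 0 ≤ f t) →
      ∀ N : ℝ, 0 ≤ N → (∀ t, f t ≠ 0 → |t| ≤ N) →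
      eLpNorm (fun x => ∫ t, cauchyKernel y t * (f (x - t) : ℂ)) (ENNReal.ofReal p)
        ≤ C * eLpNorm f (ENNReal.ofReal p) := by
  obtain ⟨A, B, hA, hAB⟩ := exists_norm_rpow_le_re_rpow hp1 hp2
  have hp0 : 0 < p := by linarith
  have hpne : ENNReal.ofReal p ≠ 0 := by simpa using hp0
  refine ⟨A.toNNReal ^ (1 / p), fun y hy f hfm hf hf0 N hN0 hN => ?_⟩
  have h1 := lintegral_cauchyIntegral_rpow_le hf hf0 hN0 hN hy hp1 hA hAB
  have h2 : eLpNorm (fun x : ℝ => cauchyIntegral f (x + y * Complex.I)) (ENNReal.ofReal p)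
      ≤ (A.toNNReal ^ (1 / p) : ℝ≥0) * eLpNorm (fun x : ℝ => (cauchyIntegral f (x + y * Complex.I)).re)
        (ENNReal.ofReal p) := by
    rw [eLpNorm_eq_lintegral_rpow_enorm_toReal hpne ENNReal.ofReal_ne_top,
      eLpNorm_eq_lintegral_rpow_enorm_toReal hpne ENNReal.ofReal_ne_top, ENNReal.toReal_ofReal hp0.le]
    calc _ ≤ _ := ENNReal.rpow_le_rpow h1 (by positivity)
      _ = _ := by
        rw [ENNReal.mul_rpow_of_nonneg _ _ (by positivity), ENNReal.coe_rpow_of_nonneg _ (by positivity)]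
        rfl
  have h3 : eLpNorm (fun x : ℝ => (cauchyIntegral f (x + y * Complex.I)).re) (ENNReal.ofReal p)
      ≤ eLpNorm f (ENNReal.ofReal p) := by
    have h4 := eLpNorm_integral_translate_le (μ := (volume : Measure ℝ)) (ν := (volume : Measure ℝ))
      (γ := id) measurable_id (κ := fun t => ((y / (π * (y ^ 2 + t ^ 2)) : ℝ) : ℂ)) (by fun_prop)
      (h := fun t => (f t : ℂ)) (by fun_prop) hp1.le
    have h5 : ∫⁻ t : ℝ, ‖((y / (π * (y ^ 2 + t ^ 2)) : ℝ) : ℂ)‖ₑ = 1 := by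
      obtain ⟨ha, hb⟩ := integrable_poissonKernel hy
      have := ofReal_integral_eq_lintegral_ofReal ha (.of_forall fun t => by
        have := Real.pi_pos
        change 0 ≤ y / (π * (y ^ 2 + t ^ 2))
        positivity)
      rw [hb, ENNReal.ofReal_one] at this
      rw [this]
      refine lintegral_congr fun t => ?_
      have := Real.pi_pos
      rw [← ofReal_norm, Complex.norm_real, Real.norm_of_nonneg (by positivity)]
    rw [h5, one_mul] at h4
    simp only [id, ← cauchyIntegral_re_eq hf hy] at h4
    calc _ = _ := ?_
      _ ≤ _ := h4
      _ = _ := ?_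
    · exact eLpNorm_congr_norm_ae (.of_forall fun x => by simp)
    · exact eLpNorm_congr_norm_ae (.of_forall fun x => by simp)
  refine le_trans ?_ (h2.trans (by gcongr))
  refine eLpNorm_mono fun x => ?_
  rw [cauchyIntegral_eq_two_mul f hy, norm_mul]
  have := norm_nonneg (∫ t, cauchyKernel y t * (f (x - t) : ℂ))
  simp only [Complex.norm_ofNat]
  linarith

theorem integrable_cauchyKernel_mul {y : ℝ} (hy : 0 < y) {f : ℝ → ℂ} (hf : Integrable f) (x : ℝ) :
    Integrable fun t => cauchyKernel y t * f (x - t) :=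
  (hf.comp_sub_left x).bdd_mul (measurable_cauchyKernel y).aestronglyMeasurable
    (.of_forall (norm_cauchyKernel_le hy))

theorem exists_eLpNorm_cauchyKernel_le {p : ℝ} (hp1 : 1 < p) (hp2 : p ≤ 2) :
    ∃ C : ℝ≥0, ∀ y : ℝ, 0 < y → ∀ f : ℝ → ℂ, Measurable f → Integrable f →
      ∀ N : ℝ, 0 ≤ N → (∀ t, f t ≠ 0 → |t| ≤ N) →
      eLpNorm (fun x => ∫ t, cauchyKernel y t * f (x - t)) (ENNReal.ofReal p)
        ≤ C * eLpNorm f (ENNReal.ofReal p) := by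
  obtain ⟨C, hC⟩ := exists_eLpNorm_cauchyKernel_nonneg_le hp1 hp2
  have hp1' : 1 ≤ ENNReal.ofReal p := by simpa using hp1.le
  have hmeas : ∀ y (g : ℝ → ℂ), Measurable g →
      Measurable (fun x => ∫ t, cauchyKernel y t * g (x - t)) := fun y g hg =>
    measurable_integral_translate measurable_id (measurable_cauchyKernel y) hg
  have hreal : ∀ y : ℝ, 0 < y → ∀ g : ℝ → ℝ, Measurable g → Integrable g →
      ∀ N : ℝ, 0 ≤ N → (∀ t, g t ≠ 0 → |t| ≤ N) →
      eLpNorm (fun x => ∫ t, cauchyKernel y t * (g (x - t) : ℂ)) (ENNReal.ofReal p)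
        ≤ (2 * C) * eLpNorm g (ENNReal.ofReal p) := by
    intro y hy g hg hgi N hN0 hN
    have hpos := hC y hy (fun t => max (g t) 0) (hg.max measurable_const) hgi.pos_part
      (fun t => le_max_right _ _) N hN0 (fun t ht => hN t fun h => ht (by simp [h]))
    have hneg := hC y hy (fun t => max (-g t) 0) (hg.neg.max measurable_const) hgi.neg_part
      (fun t => le_max_right _ _) N hN0 (fun t ht => hN t fun h => ht (by simp [h]))
    have e : (fun x => ∫ t, cauchyKernel y t * (g (x - t) : ℂ))
        = (fun x => ∫ t, cauchyKernel y t * ((max (g (x - t)) 0 : ℝ) : ℂ))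
          - fun x => ∫ t, cauchyKernel y t * ((max (-g (x - t)) 0 : ℝ) : ℂ) := by
      ext x
      rw [Pi.sub_apply, ← integral_sub
        (integrable_cauchyKernel_mul hy (f := fun t => ((max (g t) 0 : ℝ) : ℂ)) hgi.pos_part.ofReal x)
        (integrable_cauchyKernel_mul hy (f := fun t => ((max (-g t) 0 : ℝ) : ℂ)) hgi.neg_part.ofReal x)]
      refine integral_congr_ae (.of_forall fun t => ?_)
      simp only
      rw [← mul_sub, ← Complex.ofReal_sub,
        max_zero_sub_max_neg_zero_eq_self]
    rw [e]
    refine (eLpNorm_sub_le (hmeas y (fun t => ((max (g t) 0 : ℝ) : ℂ)) (by fun_prop)).aestronglyMeasurable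
      (hmeas y (fun t => ((max (-g t) 0 : ℝ) : ℂ)) (by fun_prop)).aestronglyMeasurable hp1').trans ?_
    rw [two_mul, add_mul]
    refine add_le_add (hpos.trans ?_) (hneg.trans ?_)
    · gcongr
      refine eLpNorm_mono fun t => ?_
      simp only [Real.norm_eq_abs, abs_of_nonneg (le_max_right (g t) 0)]
      exact max_le (le_abs_self _) (abs_nonneg _)
    · gcongr
      refine eLpNorm_mono fun t => ?_
      simp only [Real.norm_eq_abs, abs_of_nonneg (le_max_right (-g t) 0)]
      exact max_le (neg_le_abs _) (abs_nonneg _)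
  refine ⟨4 * C, fun y hy f hf hfi N hN0 hN => ?_⟩
  have hre := hreal y hy (fun t => (f t).re) (by fun_prop) hfi.re N hN0
    (fun t ht => hN t fun h => ht (by simp [h]))
  have him := hreal y hy (fun t => (f t).im) (by fun_prop) hfi.im N hN0
    (fun t ht => hN t fun h => ht (by simp [h]))
  have e : (fun x => ∫ t, cauchyKernel y t * f (x - t))
      = (fun x => ∫ t, cauchyKernel y t * ((f (x - t)).re : ℂ))
        + Complex.I • fun x => ∫ t, cauchyKernel y t * ((f (x - t)).im : ℂ) := by
    ext x
    rw [Pi.add_apply, Pi.smul_apply, smul_eq_mul, ← integral_const_mul, ← integral_add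
      (integrable_cauchyKernel_mul hy (f := fun t => ((f t).re : ℂ)) hfi.re.ofReal x)
      ((integrable_cauchyKernel_mul hy (f := fun t => ((f t).im : ℂ)) hfi.im.ofReal x).const_mul _)]
    refine integral_congr_ae (.of_forall fun t => ?_)
    simp only
    conv_lhs => rw [← Complex.re_add_im (f (x - t))]
    ring
  rw [e]
  refine (eLpNorm_add_le (hmeas y (fun t => ((f t).re : ℂ)) (by fun_prop)).aestronglyMeasurable
      ((hmeas y (fun t => ((f t).im : ℂ)) (by fun_prop)).aestronglyMeasurable.const_smul _) hp1').trans ?_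
  rw [eLpNorm_const_smul]
  have h4 : ((4 * C : ℝ≥0) : ℝ≥0∞) = 2 * C + 2 * C := by push_cast; ring
  rw [h4, add_mul]
  refine add_le_add (hre.trans ?_) ?_
  · gcongr
    exact eLpNorm_mono fun t => Complex.abs_re_le_norm _
  · simp only [enorm_eq_nnnorm, Complex.nnnorm_I, ENNReal.coe_one, one_mul]
    refine him.trans ?_
    gcongr
    exact eLpNorm_mono fun t => Complex.abs_im_le_norm _

/-- Difference of two Cauchy kernels: an integrable approximation of the Cauchy kernel. -/
def cauchyDiff (y Y t : ℝ) : ℂ := cauchyKernel y t - cauchyKernel Y t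

theorem measurable_cauchyDiff (y Y : ℝ) : Measurable (cauchyDiff y Y) :=
  (measurable_cauchyKernel y).sub (measurable_cauchyKernel Y)

theorem integrable_cauchyDiff {y Y : ℝ} (hy : 0 < y) (hY : y ≤ Y) : Integrable (cauchyDiff y Y) := by
  have hY0 : 0 < Y := hy.trans_le hY
  refine ((integrable_poissonKernel hy).1.const_mul ((Y - y) / (2 * y))).mono'
    (measurable_cauchyDiff y Y).aestronglyMeasurable (.of_forall fun t => ?_)
  have hpi := Real.pi_pos
  have e : cauchyDiff y Y t
      = ((Y - y : ℝ) : ℂ) / (2 * π * ((y - t * Complex.I) * (Y - t * Complex.I))) := by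
    have h1 := sub_mul_I_ne_zero hy t
    have h2 := sub_mul_I_ne_zero hY0 t
    have h3 : (π : ℂ) ≠ 0 := by exact_mod_cast hpi.ne'
    rw [cauchyDiff, cauchyKernel, cauchyKernel]
    push_cast
    field_simp
    ring
  rw [e, norm_div, norm_mul, norm_mul, norm_mul, norm_sub_mul_I, norm_sub_mul_I, Complex.norm_real,
    Complex.norm_real, Real.norm_of_nonneg hpi.le, Real.norm_of_nonneg (sub_nonneg.2 hY),
    Complex.norm_ofNat]
  have h4 : y ^ 2 + t ^ 2 ≤ √(y ^ 2 + t ^ 2) * √(Y ^ 2 + t ^ 2) := by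
    calc y ^ 2 + t ^ 2 = √(y ^ 2 + t ^ 2) * √(y ^ 2 + t ^ 2) :=
          (Real.mul_self_sqrt (by positivity)).symm
      _ ≤ _ := by gcongr
  calc (Y - y) / (2 * π * (√(y ^ 2 + t ^ 2) * √(Y ^ 2 + t ^ 2)))
      ≤ (Y - y) / (2 * π * (y ^ 2 + t ^ 2)) := by
        have := sub_nonneg.2 hY
        gcongr
    _ = _ := by field_simp

theorem conj_cauchyDiff (y Y t : ℝ) : (starRingEnd ℂ) (cauchyDiff y Y t) = cauchyDiff y Y (-t) := by
  have h : (starRingEnd ℂ) 2 = 2 := map_ofNat _ 2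
  simp [cauchyDiff, cauchyKernel, h]

/-- The Fourier symbol of `cauchyDiff`. -/
def cauchyDiffSymbol (y Y ξ : ℝ) : ℂ :=
  if 0 < ξ then (Real.exp (-(2 * π * y) * ξ) - Real.exp (-(2 * π * Y) * ξ) : ℝ) else 0

theorem cauchyKernel_eq_integral {y : ℝ} (hy : 0 < y) (t : ℝ) :
    cauchyKernel y t
      = ∫ ξ in Set.Ioi (0 : ℝ), Complex.exp ((2 * π * t * Complex.I - 2 * π * y) * ξ) := by
  have hpi := Real.pi_pos
  rw [integral_exp_mul_complex_Ioi (by simp; positivity), cauchyKernel]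
  have h1 := sub_mul_I_ne_zero hy t
  have h2 : (2 * π * t * Complex.I - 2 * π * y : ℂ) ≠ 0 := by
    rw [show (2 * π * t * Complex.I - 2 * π * y : ℂ) = -(2 * π) * (y - t * Complex.I) by ring]
    exact mul_ne_zero (by simp [hpi.ne']) h1
  have h3 : (π : ℂ) ≠ 0 := by exact_mod_cast hpi.ne'
  simp only [Complex.ofReal_zero, mul_zero, Complex.exp_zero]
  rw [div_eq_div_iff (by simp [h1, h3]) h2]
  ring

theorem integrable_cauchyDiffSymbol {y Y : ℝ} (hy : 0 < y) (hY : 0 < Y) :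
    Integrable (cauchyDiffSymbol y Y) := by
  have hpi := Real.pi_pos
  have : cauchyDiffSymbol y Y = (Set.Ioi (0 : ℝ)).indicator
      fun ξ : ℝ => ((Real.exp (-(2 * π * y) * ξ) - Real.exp (-(2 * π * Y) * ξ) : ℝ) : ℂ) := by
    ext ξ; simp [cauchyDiffSymbol, Set.indicator_apply]
  rw [this, integrable_indicator_iff measurableSet_Ioi]
  refine Integrable.ofReal ?_
  exact (integrableOn_exp_mul_Ioi (by simp; positivity) 0).sub
    (integrableOn_exp_mul_Ioi (by simp; positivity) 0)

theorem continuous_cauchyDiffSymbol (y Y : ℝ) : Continuous (cauchyDiffSymbol y Y) := by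
  have : cauchyDiffSymbol y Y = fun ξ : ℝ =>
      ((Real.exp (-(2 * π * y) * max ξ 0) - Real.exp (-(2 * π * Y) * max ξ 0) : ℝ) : ℂ) := by
    ext ξ
    rw [cauchyDiffSymbol]
    split_ifs with h
    · rw [max_eq_left h.le]
    · rw [max_eq_right (not_lt.1 h)]; simp
  rw [this]
  fun_prop

theorem fourierInv_cauchyDiffSymbol {y Y : ℝ} (hy : 0 < y) (hY : 0 < Y) :
    𝓕⁻ (cauchyDiffSymbol y Y) = cauchyDiff y Y := by
  have hpi := Real.pi_pos
  ext t
  rw [Real.fourierInv_eq', cauchyDiff, cauchyKernel_eq_integral hy, cauchyKernel_eq_integral hY,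
    ← integral_sub (integrableOn_exp_mul_complex_Ioi (by simp; positivity) 0)
      (integrableOn_exp_mul_complex_Ioi (by simp; positivity) 0), ← integral_indicator measurableSet_Ioi]
  refine integral_congr_ae (.of_forall fun ξ => ?_)
  simp only [cauchyDiffSymbol, Set.indicator_apply, Set.mem_Ioi]
  split_ifs
  · push_cast
    rw [smul_eq_mul, mul_sub, ← Complex.exp_add, ← Complex.exp_add]
    simp only [RCLike.inner_apply, conj_trivial]
    push_cast
    congr 2 <;> ring
  · simp

theorem integral_cauchyDiff_mul_exp {y Y : ℝ} (hy : 0 < y) (hY : y ≤ Y) (ξ : ℝ) :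
    ∫ t : ℝ, Complex.exp (↑(-2 * π * t * ξ) * Complex.I) * cauchyDiff y Y t = cauchyDiffSymbol y Y ξ := by
  have hY0 := hy.trans_le hY
  have h1 : 𝓕 (𝓕⁻ (cauchyDiffSymbol y Y)) = cauchyDiffSymbol y Y := by
    refine (continuous_cauchyDiffSymbol y Y).fourier_fourierInv_eq (integrable_cauchyDiffSymbol hy hY0) ?_
    have h2 : 𝓕 (cauchyDiffSymbol y Y) = fun t => cauchyDiff y Y (-t) := by
      ext t
      rw [← fourierInv_cauchyDiffSymbol hy hY0, Real.fourierInv_eq_fourier_neg, neg_neg]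
    rw [h2]
    exact (integrable_cauchyDiff hy hY).comp_neg
  rw [fourierInv_cauchyDiffSymbol hy hY0] at h1
  have h3 := congrFun h1 ξ
  rw [Real.fourier_real_eq_integral_exp_smul] at h3
  simpa using h3

theorem eLpNorm_le_of_tendsto {α E : Type*} [MeasurableSpace α] {μ : Measure α} [NormedAddCommGroup E]
    {p c : ℝ≥0∞} {F : ℕ → α → E} {f : α → E} (hF : ∀ n, AEStronglyMeasurable (F n) μ)
    (hlim : ∀ x, Filter.Tendsto (fun n => F n x) Filter.atTop (nhds (f x)))
    (hc : ∀ n, eLpNorm (F n) p μ ≤ c) : eLpNorm f p μ ≤ c := by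
  refine (Lp.eLpNorm_lim_le_liminf_eLpNorm hF f (.of_forall hlim)).trans ?_
  refine (Filter.liminf_le_liminf (.of_forall hc)).trans ?_
  simp

/-- A bound on compactly supported functions extends to all bounded functions. -/
theorem eLpNorm_cauchyDiff_le_of_compactSupport {p : ℝ≥0∞} {C : ℝ≥0} {y Y : ℝ} (hy : 0 < y) (hY : y ≤ Y)
    (hC : ∀ f : ℝ → ℂ, Measurable f → (∃ M, ∀ t, ‖f t‖ ≤ M) → Integrable f →
      ∀ N : ℝ, 0 ≤ N → (∀ t, f t ≠ 0 → |t| ≤ N) →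
      eLpNorm (fun x => ∫ t, cauchyDiff y Y t * f (x - t)) p ≤ C * eLpNorm f p)
    {f : ℝ → ℂ} (hf : Measurable f) {M : ℝ} (hM : ∀ t, ‖f t‖ ≤ M) :
    eLpNorm (fun x => ∫ t, cauchyDiff y Y t * f (x - t)) p ≤ C * eLpNorm f p := by
  have hle : ∀ (n : ℕ) t, ‖(Set.Icc (-(n : ℝ)) n).indicator f t‖ ≤ ‖f t‖ := fun n t =>
    norm_indicator_le_norm_self _ _
  have hm : ∀ n : ℕ, Measurable ((Set.Icc (-(n : ℝ)) n).indicator f) := fun n =>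
    hf.indicator measurableSet_Icc
  refine eLpNorm_le_of_tendsto
    (F := fun (n : ℕ) x => ∫ t, cauchyDiff y Y t * (Set.Icc (-(n : ℝ)) n).indicator f (x - t))
    (fun n => (measurable_integral_translate measurable_id (measurable_cauchyDiff y Y)
      (hm n)).aestronglyMeasurable) (fun x => ?_) (fun n => ?_)
  · refine tendsto_integral_of_dominated_convergence (fun t => ‖cauchyDiff y Y t‖ * M) (fun n => ?_)
      ((integrable_cauchyDiff hy hY).norm.mul_const M) (fun n => ?_) ?_
    · exact ((measurable_cauchyDiff y Y).mul
        ((hm n).comp (measurable_const.sub measurable_id))).aestronglyMeasurable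
    · refine .of_forall fun t => ?_
      rw [norm_mul]
      gcongr
      exact (hle n _).trans (hM _)
    · refine .of_forall fun t => tendsto_const_nhds.congr' ?_
      obtain ⟨n₀, hn₀⟩ := exists_nat_ge |x - t|
      filter_upwards [Filter.eventually_ge_atTop n₀] with n hn
      have h1 : |x - t| ≤ (n : ℝ) := hn₀.trans (by exact_mod_cast hn)
      rw [Set.indicator_of_mem (Set.mem_Icc.2 (abs_le.1 h1))]
  · refine (hC _ (hm n) ⟨M, fun t => (hle n t).trans (hM t)⟩ ?_ n (by positivity) ?_).trans ?_
    · rw [integrable_indicator_iff measurableSet_Icc]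
      exact Measure.integrableOn_of_bounded (M := M) (by simp) hf.aestronglyMeasurable
        (.of_forall hM)
    · intro t ht
      exact abs_le.2 (Set.mem_Icc.1 (Set.mem_of_indicator_ne_zero ht))
    · gcongr
      exact eLpNorm_mono (hle n)

theorem exists_eLpNorm_cauchyDiff_le_of_le_two {p : ℝ} (hp1 : 1 < p) (hp2 : p ≤ 2) :
    ∃ C : ℝ≥0, ∀ y Y : ℝ, 0 < y → y ≤ Y → ∀ f : ℝ → ℂ, Measurable f → (∃ M, ∀ t, ‖f t‖ ≤ M) →
      eLpNorm (fun x => ∫ t, cauchyDiff y Y t * f (x - t)) (ENNReal.ofReal p)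
        ≤ C * eLpNorm f (ENNReal.ofReal p) := by
  obtain ⟨C, hC⟩ := exists_eLpNorm_cauchyKernel_le hp1 hp2
  refine ⟨2 * C, fun y Y hy hY f hf ⟨M, hM⟩ => ?_⟩
  refine eLpNorm_cauchyDiff_le_of_compactSupport hy hY ?_ hf hM
  intro g hg _ hgi N hN0 hN
  have hY0 := hy.trans_le hY
  have e : (fun x => ∫ t, cauchyDiff y Y t * g (x - t)) =
      (fun x => ∫ t, cauchyKernel y t * g (x - t)) - fun x => ∫ t, cauchyKernel Y t * g (x - t) := by
    ext x
    rw [Pi.sub_apply, ← integral_sub (integrable_cauchyKernel_mul hy hgi x)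
      (integrable_cauchyKernel_mul hY0 hgi x)]
    simp only [cauchyDiff, sub_mul]
  rw [e]
  refine (eLpNorm_sub_le
    (measurable_integral_translate measurable_id (measurable_cauchyKernel y) hg).aestronglyMeasurable
    (measurable_integral_translate measurable_id (measurable_cauchyKernel Y) hg).aestronglyMeasurable
    (by simpa using hp1.le)).trans ?_
  rw [ENNReal.coe_mul, ENNReal.coe_ofNat, two_mul, add_mul]
  exact add_le_add (hC y hy g hg hgi N hN0 hN) (hC Y hY0 g hg hgi N hN0 hN)

theorem lintegral_enorm_rpow_rpow_inv {α E : Type*} [MeasurableSpace α] {μ : Measure α}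
    [NormedAddCommGroup E] {p : ℝ} (hp : 0 < p) (f : α → E) :
    (∫⁻ x, ‖f x‖ₑ ^ p ∂μ) ^ (1 / p) = eLpNorm f (ENNReal.ofReal p) μ := by
  rw [eLpNorm_eq_lintegral_rpow_enorm_toReal (by simpa using hp) (by simp),
    ENNReal.toReal_ofReal hp.le]

theorem integral_mul_cauchyDiff_translate {y Y : ℝ} (hy : 0 < y) (hY : y ≤ Y) {f g : ℝ → ℂ}
    (hf : Integrable f) (hg : Measurable g) {K : ℝ} (hK : ∀ t, ‖g t‖ ≤ K) :
    ∫ x, (∫ t, cauchyDiff y Y t * f (x - t)) * g x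
      = ∫ t, f t * ∫ x, cauchyDiff y Y (x - t) * g x := by
  have h1 : Integrable (Function.uncurry fun x t => cauchyDiff y Y (x - t) * f t * g x)
      (volume.prod volume) := by
    have h := Integrable.convolution_integrand (ContinuousLinearMap.mul ℝ ℂ) hf
      (integrable_cauchyDiff hy hY) (μ := (volume : Measure ℝ)) (ν := volume)
    refine (h.mul_bdd (c := K) (g := fun z : ℝ × ℝ => g z.1)
      (hg.comp measurable_fst).aestronglyMeasurable (.of_forall fun z => hK _)).congr
      (.of_forall fun z => ?_)
    simp only [ContinuousLinearMap.mul_apply', Function.uncurry]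
    ring
  have h2 := integral_integral_swap h1
  calc _ = ∫ x, ∫ t, cauchyDiff y Y (x - t) * f t * g x := by
        refine integral_congr_ae (.of_forall fun x => ?_)
        simp only
        rw [integral_mul_const, ← integral_sub_left_eq_self _ volume x]
        simp
    _ = _ := by
        rw [h2]
        refine integral_congr_ae (.of_forall fun t => ?_)
        simp only
        rw [← integral_const_mul]
        refine integral_congr_ae (.of_forall fun x => ?_)
        simp only
        ring

theorem integral_cauchyDiff_sub_mul (y Y : ℝ) (g : ℝ → ℂ) (t : ℝ) :
    ∫ x, cauchyDiff y Y (x - t) * g x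
      = (starRingEnd ℂ) (∫ s, cauchyDiff y Y s * (starRingEnd ℂ) (g (t - s))) := by
  rw [← integral_conj, ← integral_sub_left_eq_self _ volume t]
  refine integral_congr_ae (.of_forall fun s => ?_)
  simp [conj_cauchyDiff]

theorem enorm_integral_mul_conj_le {p q : ℝ} (hpq : p.HolderConjugate q) {f S : ℝ → ℂ}
    (hf : Measurable f) (hS : Measurable S) :
    ‖∫ t, f t * (starRingEnd ℂ) (S t)‖ₑ
      ≤ eLpNorm f (ENNReal.ofReal p) * eLpNorm S (ENNReal.ofReal q) := by
  calc _ ≤ ∫⁻ t, ‖f t * (starRingEnd ℂ) (S t)‖ₑ := enorm_integral_le_lintegral_enorm _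
    _ = ∫⁻ t, ‖f t‖ₑ * ‖S t‖ₑ := by
        refine lintegral_congr fun t => ?_
        rw [enorm_mul, ← ofReal_norm ((starRingEnd ℂ) (S t)), RCLike.norm_conj, ofReal_norm]
    _ ≤ (∫⁻ t, ‖f t‖ₑ ^ p) ^ (1 / p) * (∫⁻ t, ‖S t‖ₑ ^ q) ^ (1 / q) :=
        ENNReal.lintegral_mul_le_Lp_mul_Lq volume hpq hf.enorm.aemeasurable hS.enorm.aemeasurable
    _ = _ := by
        rw [lintegral_enorm_rpow_rpow_inv hpq.pos, lintegral_enorm_rpow_rpow_inv hpq.symm.pos]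

/-- The truncated Cauchy transform is bounded on `L^p`, uniformly in the truncation. -/
theorem exists_eLpNorm_cauchyDiff_le {p : ℝ} (hp1 : 1 < p) :
    ∃ C : ℝ≥0, ∀ y Y : ℝ, 0 < y → y ≤ Y → ∀ f : ℝ → ℂ, Measurable f → (∃ M, ∀ t, ‖f t‖ ≤ M) →
      eLpNorm (fun x => ∫ t, cauchyDiff y Y t * f (x - t)) (ENNReal.ofReal p)
        ≤ C * eLpNorm f (ENNReal.ofReal p) := by
  rcases le_total p 2 with hp2 | hp2
  · exact exists_eLpNorm_cauchyDiff_le_of_le_two hp1 hp2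
  have hpq : p.HolderConjugate p.conjExponent := Real.HolderConjugate.conjExponent hp1
  set q := p.conjExponent
  have hp0 : 0 < p := by linarith
  have hq1 : 1 < q := hpq.symm.lt
  have hq0 : 0 < q := by linarith
  have hq2 : q ≤ 2 := by
    have h1 := hpq.inv_add_inv_eq_one
    have h2 : p⁻¹ ≤ 2⁻¹ := by gcongr
    have h3 : (2 : ℝ)⁻¹ ≤ q⁻¹ := by linarith
    exact (inv_le_inv₀ (by norm_num) hq0).1 h3
  obtain ⟨C, hC⟩ := exists_eLpNorm_cauchyDiff_le_of_le_two hq1 hq2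
  refine ⟨C, fun y Y hy hY f hf ⟨M, hM⟩ => ?_⟩
  refine eLpNorm_cauchyDiff_le_of_compactSupport hy hY ?_ hf hM
  clear! f
  rintro f hf ⟨M, hM⟩ hfi N hN0 hN
  set H : ℝ → ℂ := fun x => ∫ t, cauchyDiff y Y t * f (x - t) with hH
  have hHm : Measurable H := measurable_integral_translate measurable_id (measurable_cauchyDiff y Y) hf
  set K : ℝ := ∫ t, ‖cauchyDiff y Y t‖ * M
  have hHK : ∀ x, ‖H x‖ ≤ K := fun x => by
    refine norm_integral_le_of_norm_le ((integrable_cauchyDiff hy hY).norm.mul_const M)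
      (.of_forall fun t => ?_)
    rw [norm_mul]
    gcongr
    exact hM _
  have hK0 : 0 ≤ K := (norm_nonneg _).trans (hHK 0)
  set g : ℝ → ℂ := fun x => (starRingEnd ℂ) (H x) * ((‖H x‖ ^ (p - 2) : ℝ) : ℂ) with hg
  have hgm : Measurable g := by
    refine (Complex.continuous_conj.measurable.comp hHm).mul ?_
    exact Complex.measurable_ofReal.comp (hHm.norm.pow_const _)
  have hgn : ∀ x, ‖g x‖ = ‖H x‖ ^ (p - 1) := fun x => by
    simp only [hg, norm_mul, RCLike.norm_conj, Complex.norm_real]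
    rw [Real.norm_of_nonneg (by positivity)]
    nth_rewrite 1 [← Real.rpow_one ‖H x‖]
    rw [← Real.rpow_add_of_nonneg (norm_nonneg _) zero_le_one (by linarith)]
    ring_nf
  have hgK : ∀ x, ‖g x‖ ≤ K ^ (p - 1) := fun x => by
    rw [hgn]
    exact Real.rpow_le_rpow (norm_nonneg _) (hHK x) (by linarith)
  have hHg : ∀ x, H x * g x = ((‖H x‖ ^ p : ℝ) : ℂ) := fun x => by
    simp only [hg]
    rw [← mul_assoc, Complex.mul_conj, Complex.normSq_eq_norm_sq, ← Complex.ofReal_mul,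
      ← Real.rpow_natCast, ← Real.rpow_add_of_nonneg (norm_nonneg _) (by norm_num) (by linarith)]
    congr 2
    push_cast; ring
  set X : ℝ≥0∞ := ∫⁻ x, ‖H x‖ₑ ^ p
  have hfp : eLpNorm f (ENNReal.ofReal p) ≠ ∞ := by
    have hset : eLpNorm f (ENNReal.ofReal p)
        = eLpNorm f (ENNReal.ofReal p) (volume.restrict (Set.Icc (-N) N)) := by
      rw [← eLpNorm_indicator_eq_eLpNorm_restrict measurableSet_Icc]
      congr 1
      ext t
      rw [Set.indicator_apply]
      split_ifs with h
      · rfl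
      · by_contra h0
        exact h (Set.mem_Icc.2 (abs_le.1 (hN t h0)))
    rw [hset]
    exact (MemLp.of_bound hf.aestronglyMeasurable M (.of_forall hM)).2.ne
  have hHp : eLpNorm H (ENNReal.ofReal p) ≠ ∞ := by
    refine ne_top_of_le_ne_top ?_ (eLpNorm_integral_translate_le measurable_id
      (measurable_cauchyDiff y Y) hf hp1.le)
    exact ENNReal.mul_ne_top (integrable_cauchyDiff hy hY).2.ne hfp
  have hXp : X ^ (1 / p) = eLpNorm H (ENNReal.ofReal p) := lintegral_enorm_rpow_rpow_inv hp0 H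
  have hX : X ≠ ∞ := by
    intro h
    rw [h, ENNReal.top_rpow_of_pos (by positivity)] at hXp
    exact hHp hXp.symm
  have hXg : eLpNorm g (ENNReal.ofReal q) = X ^ (1 / q) := by
    rw [← lintegral_enorm_rpow_rpow_inv hq0]
    congr 1
    refine lintegral_congr fun x => ?_
    rw [← ofReal_norm, ← ofReal_norm, hgn,
      ENNReal.ofReal_rpow_of_nonneg (by positivity) hq0.le,
      ENNReal.ofReal_rpow_of_nonneg (by positivity) hp0.le, ← Real.rpow_mul (norm_nonneg _)]
    congr 2
    rw [hpq.sub_one_mul_conj]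
  have key : X ≤ eLpNorm f (ENNReal.ofReal p) * (C * X ^ (1 / q)) := by
    have hXint : X = ‖∫ x, H x * g x‖ₑ := by
      simp only [hHg]
      rw [integral_complex_ofReal, ← ofReal_norm]
      rw [Complex.norm_real]
      rw [Real.norm_of_nonneg (integral_nonneg fun x => by positivity),
        ofReal_integral_eq_lintegral_ofReal]
      · refine lintegral_congr fun x => ?_
        rw [← ofReal_norm, ENNReal.ofReal_rpow_of_nonneg (by positivity) hp0.le]
      · refine ⟨(hHm.norm.pow_const p).aestronglyMeasurable, ?_⟩
        rw [hasFiniteIntegral_iff_enorm]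
        refine lt_of_le_of_lt (lintegral_mono fun x => ?_) (lt_top_iff_ne_top.2 hX)
        rw [← ofReal_norm, ← ofReal_norm, Real.norm_of_nonneg (by positivity),
          ENNReal.ofReal_rpow_of_nonneg (by positivity) hp0.le]
      · exact .of_forall fun x => by positivity
    set S : ℝ → ℂ := fun t => ∫ s, cauchyDiff y Y s * (starRingEnd ℂ) (g (t - s)) with hS
    have hgc : Measurable fun x => (starRingEnd ℂ) (g x) :=
      Complex.continuous_conj.measurable.comp hgm
    have hSm : Measurable S :=
      measurable_integral_translate measurable_id (measurable_cauchyDiff y Y) hgc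
    have e : ∫ x, H x * g x = ∫ t, f t * (starRingEnd ℂ) (S t) := by
      rw [integral_mul_cauchyDiff_translate hy hY hfi hgm hgK]
      simp only [integral_cauchyDiff_sub_mul, hS]
    have hSg : eLpNorm S (ENNReal.ofReal q) ≤ C * X ^ (1 / q) := by
      refine (hC y Y hy hY _ hgc ⟨_, fun t => (RCLike.norm_conj _).trans_le (hgK t)⟩).trans ?_
      rw [← hXg]
      gcongr
      exact eLpNorm_mono fun t => (RCLike.norm_conj _).le
    rw [e] at hXint
    exact hXint.trans_le ((enorm_integral_mul_conj_le hpq hf hSm).trans (by gcongr))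
  rw [← hXp]
  rcases eq_or_ne X 0 with h0 | h0
  · rw [h0, ENNReal.zero_rpow_of_pos (by positivity)]
    exact zero_le
  have hsum : 1 / p + 1 / q = 1 := by simpa using hpq.inv_add_inv_eq_one
  have h1 : X = X ^ (1 / p) * X ^ (1 / q) := by
    rw [← ENNReal.rpow_add _ _ h0 hX, hsum, ENNReal.rpow_one]
  have h2 : X ^ (1 / q) ≠ 0 := by simp [h0, hX]
  have h3 : X ^ (1 / q) ≠ ∞ := ENNReal.rpow_ne_top_of_nonneg (by positivity) hX
  rw [← ENNReal.mul_le_mul_iff_left h2 h3, ← h1]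
  refine key.trans (le_of_eq ?_)
  ring

theorem lintegral_insertNth {n : ℕ} (i : Fin (n + 1)) {G : Rd (n + 1) → ℝ≥0∞} (hG : Measurable G) :
    ∫⁻ x, G x = ∫⁻ z : Fin n → ℝ, ∫⁻ s : ℝ, G (WithLp.toLp 2 (i.insertNth s z)) := by
  have h1 := (EuclideanSpace.volume_preserving_symm_measurableEquiv_toLp (Fin (n + 1))).symm
  have h2 := (volume_preserving_piFinSuccAbove (fun _ : Fin (n + 1) => ℝ) i).symm
  have h3 := h1.comp h2
  rw [← h3.lintegral_comp hG]
  have hm : Measurable fun a => G (((MeasurableEquiv.toLp 2 (Fin (n + 1) → ℝ)).symm.symm ∘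
      (MeasurableEquiv.piFinSuccAbove (fun _ : Fin (n + 1) => ℝ) i).symm) a) := hG.comp h3.measurable
  exact lintegral_prod_symm _ hm.aemeasurable

theorem toLp_insertNth_sub {n : ℕ} (i : Fin (n + 1)) (s t : ℝ) (z : Fin n → ℝ) :
    (WithLp.toLp 2 (i.insertNth s z : Fin (n + 1) → ℝ) : Rd (n + 1)) - t • EuclideanSpace.single i 1
      = WithLp.toLp 2 (i.insertNth (s - t) z : Fin (n + 1) → ℝ) := by
  ext k
  refine Fin.succAboveCases i ?_ (fun j => ?_) k
  · simp
  · simp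

theorem exists_eLpNorm_cauchyDiff_single_le {p : ℝ} (hp1 : 1 < p) :
    ∃ C : ℝ≥0, ∀ (d : ℕ) (i : Fin d) (y Y : ℝ), 0 < y → y ≤ Y → ∀ f : Rd d → ℂ, Measurable f →
      (∃ M, ∀ t, ‖f t‖ ≤ M) →
      eLpNorm (fun x => ∫ t : ℝ, cauchyDiff y Y t * f (x - t • (EuclideanSpace.single i 1 : Rd d)))
        (ENNReal.ofReal p) ≤ C * eLpNorm f (ENNReal.ofReal p) := by
  obtain ⟨C, hC⟩ := exists_eLpNorm_cauchyDiff_le hp1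
  refine ⟨C, fun d i y Y hy hY f hf ⟨M, hM⟩ => ?_⟩
  have hp0 : 0 < p := by linarith
  rcases d with _ | n
  · exact i.elim0
  have hTm : Measurable fun x =>
      ∫ t : ℝ, cauchyDiff y Y t * f (x - t • (EuclideanSpace.single i 1 : Rd (n + 1))) :=
    measurable_integral_translate (by fun_prop) (measurable_cauchyDiff y Y) hf
  have key : ∫⁻ x, ‖∫ t : ℝ, cauchyDiff y Y t * f (x - t • (EuclideanSpace.single i 1 : Rd (n + 1)))‖ₑ ^ p
      ≤ C ^ p * ∫⁻ x, ‖f x‖ₑ ^ p := by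
    rw [lintegral_insertNth i (hTm.enorm.pow_const p), lintegral_insertNth i (hf.enorm.pow_const p),
      ← lintegral_const_mul' _ _ (by simp [hp0.le])]
    refine lintegral_mono fun z => ?_
    simp only [toLp_insertNth_sub]
    have hg : Measurable fun s : ℝ => f (WithLp.toLp 2 (i.insertNth s z : Fin (n + 1) → ℝ)) := by
      refine hf.comp ?_
      have : Continuous fun s : ℝ => (WithLp.toLp 2 (i.insertNth s z : Fin (n + 1) → ℝ)
        : Rd (n + 1)) := by fun_prop
      exact this.measurable
    have h := hC y Y hy hY _ hg ⟨M, fun t => hM _⟩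
    rw [← lintegral_enorm_rpow_rpow_inv hp0, ← lintegral_enorm_rpow_rpow_inv hp0] at h
    have h' := ENNReal.rpow_le_rpow h hp0.le
    rw [ENNReal.mul_rpow_of_nonneg _ _ hp0.le, ← ENNReal.rpow_mul, ← ENNReal.rpow_mul,
      one_div_mul_cancel hp0.ne', ENNReal.rpow_one, ENNReal.rpow_one] at h'
    exact h'
  rw [← lintegral_enorm_rpow_rpow_inv hp0, ← lintegral_enorm_rpow_rpow_inv hp0]
  refine (ENNReal.rpow_le_rpow key (one_div_nonneg.2 hp0.le)).trans ?_
  rw [ENNReal.mul_rpow_of_nonneg _ _ (by positivity), ← ENNReal.rpow_mul,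
    mul_one_div_cancel hp0.ne', ENNReal.rpow_one]

section
variable {E : Type*} [NormedAddCommGroup E] [InnerProductSpace ℝ E] [MeasurableSpace E]
  [BorelSpace E] [FiniteDimensional ℝ E]

theorem norm_fourierInv_le (w : E → ℂ) (x : E) : ‖𝓕⁻ w x‖ ≤ ∫ ξ, ‖w ξ‖ := by
  rw [Real.fourierInv_eq_fourier_neg]
  exact VectorFourier.norm_fourierIntegral_le_integral_norm _ _ _ _ _

theorem continuous_fourierInv {w : E → ℂ} (hw : Integrable w) : Continuous (𝓕⁻ w) := by
  have h : Continuous (𝓕 w) := VectorFourier.fourierIntegral_continuous Real.continuous_fourierChar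
    (by exact continuous_inner) hw
  have e : 𝓕⁻ w = fun x => 𝓕 w (-x) := funext fun x => Real.fourierInv_eq_fourier_neg w x
  rw [e]
  exact h.comp continuous_neg

theorem integrable_mul_of_norm_le {σ w : E → ℂ} (hσ : Measurable σ) {K : ℝ} (hK : ∀ ξ, ‖σ ξ‖ ≤ K)
    (hw : Integrable w) : Integrable fun ξ => σ ξ * w ξ :=
  hw.bdd_mul hσ.aestronglyMeasurable (.of_forall hK)

/-- Averaging translates of an inverse Fourier transform against an integrable kernel
is a Fourier multiplier. -/
theorem integral_mul_fourierInv_translate {T : Type*} [MeasurableSpace T] {ν : Measure T} [SFinite ν]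
    {γ : T → E} (hγ : Measurable γ) {κ : T → ℂ} (hκ : Integrable κ ν) {w : E → ℂ}
    (hw : Integrable w) (x : E) :
    ∫ t, κ t * 𝓕⁻ w (x - γ t) ∂ν
      = 𝓕⁻ (fun ξ => (∫ t, Complex.exp (↑(-2 * π * inner ℝ (γ t) ξ) * Complex.I) * κ t ∂ν) * w ξ) x := by
  have hi : Integrable (Function.uncurry fun t ξ =>
      Complex.exp (↑(2 * π * inner ℝ ξ (x - γ t)) * Complex.I) * (κ t * w ξ)) (ν.prod volume) := by
    refine (hκ.mul_prod hw).bdd_mul (c := 1) ?_ (.of_forall fun z => ?_)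
    · have h1 : Measurable fun z : T × E => γ z.1 := hγ.comp measurable_fst
      refine Measurable.aestronglyMeasurable ?_
      have h2 : Measurable fun z : T × E => inner ℝ z.2 (x - γ z.1) :=
        measurable_snd.inner (measurable_const.sub h1)
      fun_prop
    · rw [Complex.norm_exp_ofReal_mul_I]
  have h := integral_integral_swap hi
  simp only [Real.fourierInv_eq', smul_eq_mul]
  calc _ = ∫ t, ∫ ξ, Complex.exp (↑(2 * π * inner ℝ ξ (x - γ t)) * Complex.I) * (κ t * w ξ) ∂volume ∂ν := by
        refine integral_congr_ae (.of_forall fun t => ?_)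
        simp only
        rw [← integral_const_mul]
        refine integral_congr_ae (.of_forall fun ξ => ?_)
        simp only
        ring
    _ = _ := by
        rw [h]
        refine integral_congr_ae (.of_forall fun ξ => ?_)
        simp only
        rw [← integral_mul_const, ← integral_const_mul]
        refine integral_congr_ae (.of_forall fun t => ?_)
        simp only
        have : Complex.exp (↑(2 * π * inner ℝ ξ (x - γ t)) * Complex.I)
            = Complex.exp (↑(2 * π * inner ℝ ξ x) * Complex.I)
              * Complex.exp (↑(-2 * π * inner ℝ (γ t) ξ) * Complex.I) := by
          rw [← Complex.exp_add, inner_sub_right, real_inner_comm (γ t) ξ]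
          congr 1
          push_cast
          ring
        rw [this]
        ring

theorem tendsto_fourierInv_mul {σ : ℕ → E → ℂ} {σ' w : E → ℂ} {K : ℝ} (hσ : ∀ n, Measurable (σ n))
    (hK : ∀ n ξ, ‖σ n ξ‖ ≤ K)
    (hlim : ∀ ξ, Filter.Tendsto (fun n => σ n ξ) Filter.atTop (nhds (σ' ξ))) (hw : Integrable w)
    (x : E) : Filter.Tendsto (fun n => 𝓕⁻ (fun ξ => σ n ξ * w ξ) x) Filter.atTop
      (nhds (𝓕⁻ (fun ξ => σ' ξ * w ξ) x)) := by
  simp only [Real.fourierInv_eq', smul_eq_mul]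
  refine tendsto_integral_of_dominated_convergence (fun ξ => K * ‖w ξ‖) (fun n => ?_)
    (hw.norm.const_mul K) (fun n => ?_) ?_
  · refine AEStronglyMeasurable.mul ?_ ((hσ n).aestronglyMeasurable.mul hw.1)
    have : Continuous fun v : E => Complex.exp (↑(2 * π * inner ℝ v x) * Complex.I) := by fun_prop
    exact this.aestronglyMeasurable
  · refine .of_forall fun ξ => ?_
    rw [norm_mul, Complex.norm_exp_ofReal_mul_I, one_mul, norm_mul]
    gcongr
    exact hK n ξ
  · exact .of_forall fun ξ => ((hlim ξ).mul_const _).const_mul _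

/-- `σ` is a measurable symbol bounded by one whose Fourier multiplier is bounded on `L^p`
with norm at most `C`. -/
structure IsLpMultiplier (p : ℝ≥0∞) (C : ℝ≥0) (σ : E → ℂ) : Prop where
  measurable : Measurable σ
  norm_le_one : ∀ ξ, ‖σ ξ‖ ≤ 1
  eLpNorm_le : ∀ w : E → ℂ, Integrable w →
    eLpNorm (𝓕⁻ fun ξ => σ ξ * w ξ) p ≤ C * eLpNorm (𝓕⁻ w) p

namespace IsLpMultiplier
variable {p : ℝ≥0∞} {C C' : ℝ≥0} {σ σ' : E → ℂ}

theorem one : IsLpMultiplier p 1 (fun _ : E => 1) :=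
  ⟨measurable_const, fun _ => by simp, fun w _ => by simp⟩

theorem integrable_mul (h : IsLpMultiplier p C σ) {w : E → ℂ} (hw : Integrable w) :
    Integrable fun ξ => σ ξ * w ξ :=
  integrable_mul_of_norm_le h.measurable h.norm_le_one hw

theorem mul (h : IsLpMultiplier p C σ) (h' : IsLpMultiplier p C' σ') :
    IsLpMultiplier p (C * C') (fun ξ => σ ξ * σ' ξ) := by
  refine ⟨h.measurable.mul h'.measurable, fun ξ => ?_, fun w hw => ?_⟩
  · rw [norm_mul]
    exact mul_le_one₀ (h.norm_le_one ξ) (norm_nonneg _) (h'.norm_le_one ξ)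
  · simp only [mul_assoc]
    refine (h.eLpNorm_le _ (h'.integrable_mul hw)).trans ?_
    rw [ENNReal.coe_mul, mul_assoc]
    gcongr
    exact h'.eLpNorm_le w hw

theorem prod {ι : Type*} (s : Finset ι) {σ : ι → E → ℂ} (h : ∀ i, IsLpMultiplier p C (σ i)) :
    IsLpMultiplier p (C ^ s.card) (fun ξ => ∏ i ∈ s, σ i ξ) := by
  classical
  induction s using Finset.induction_on with
  | empty => simpa using one
  | insert a s ha ih =>
    simp only [Finset.prod_insert ha, Finset.card_insert_of_notMem ha]
    rw [pow_succ']
    exact (h a).mul ih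

theorem congr_ae (h : IsLpMultiplier p C σ) (hm : Measurable σ') (hn : ∀ ξ, ‖σ' ξ‖ ≤ 1)
    (e : σ' =ᵐ[volume] σ) : IsLpMultiplier p C σ' := by
  refine ⟨hm, hn, fun w hw => ?_⟩
  have : 𝓕⁻ (fun ξ => σ' ξ * w ξ) = 𝓕⁻ (fun ξ => σ ξ * w ξ) := by
    ext x
    simp only [Real.fourierInv_eq', smul_eq_mul]
    refine integral_congr_ae ?_
    filter_upwards [e] with ξ hξ
    rw [hξ]
  rw [this]
  exact h.eLpNorm_le w hw

theorem fourierInv_comp_neg (w : E → ℂ) (x : E) : 𝓕⁻ (fun ξ => w (-ξ)) x = 𝓕⁻ w (-x) := by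
  rw [Real.fourierInv_eq', Real.fourierInv_eq', ← integral_neg_eq_self]
  simp

theorem eLpNorm_comp_neg (f : E → ℂ) (hf : Continuous f) : eLpNorm (fun x => f (-x)) p = eLpNorm f p :=
  eLpNorm_comp_measurePreserving hf.aestronglyMeasurable (Measure.measurePreserving_neg volume)

theorem comp_neg (h : IsLpMultiplier p C σ) : IsLpMultiplier p C (fun ξ => σ (-ξ)) := by
  refine ⟨h.measurable.comp measurable_neg, fun ξ => h.norm_le_one _, fun w hw => ?_⟩
  have e : 𝓕⁻ (fun ξ => σ (-ξ) * w ξ) = fun x => 𝓕⁻ (fun ξ => σ ξ * w (-ξ)) (-x) := by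
    ext x
    rw [← fourierInv_comp_neg]
    simp
  have e' : 𝓕⁻ (fun ξ => w (-ξ)) = fun x => 𝓕⁻ w (-x) := funext fun x => fourierInv_comp_neg w x
  rw [e, eLpNorm_comp_neg _ (continuous_fourierInv (h.integrable_mul hw.comp_neg))]
  refine (h.eLpNorm_le _ hw.comp_neg).trans ?_
  rw [e', eLpNorm_comp_neg _ (continuous_fourierInv hw)]

theorem of_tendsto {σ : ℕ → E → ℂ} {σ' : E → ℂ} (h : ∀ n, IsLpMultiplier p C (σ n))
    (hlim : ∀ ξ, Filter.Tendsto (fun n => σ n ξ) Filter.atTop (nhds (σ' ξ))) :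
    IsLpMultiplier p C σ' := by
  refine ⟨measurable_of_tendsto_metrizable (fun n => (h n).measurable) (tendsto_pi_nhds.2 hlim),
    fun ξ => le_of_tendsto (hlim ξ).norm (.of_forall fun n => (h n).norm_le_one ξ), fun w hw => ?_⟩
  exact eLpNorm_le_of_tendsto
    (fun n => (continuous_fourierInv ((h n).integrable_mul hw)).aestronglyMeasurable)
    (fun x => tendsto_fourierInv_mul (fun n => (h n).measurable) (fun n => (h n).norm_le_one) hlim hw x)
    (fun n => (h n).eLpNorm_le w hw)

end IsLpMultiplier
end

theorem isLpMultiplier_cauchyDiffSymbol {p : ℝ} (hp : 1 < p) :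
    ∃ C : ℝ≥0, ∀ (d : ℕ) (i : Fin d) (y Y : ℝ), 0 < y → y ≤ Y →
      IsLpMultiplier (ENNReal.ofReal p) C (fun ξ : Rd d => cauchyDiffSymbol y Y (ξ i)) := by
  obtain ⟨C, hC⟩ := exists_eLpNorm_cauchyDiff_single_le hp
  refine ⟨C, fun d i y Y hy hY => ⟨?_, fun ξ => ?_, fun w hw => ?_⟩⟩
  · exact (continuous_cauchyDiffSymbol y Y).measurable.comp (by fun_prop)
  · rw [cauchyDiffSymbol]
    have hpi := Real.pi_pos
    split_ifs with h
    · rw [Complex.norm_real, Real.norm_eq_abs, abs_of_nonneg]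
      · have h1 : Real.exp (-(2 * π * y) * ξ i) ≤ 1 := by
          rw [Real.exp_le_one_iff]
          have : 0 ≤ 2 * π * y * ξ i := by positivity
          linarith
        have := Real.exp_pos (-(2 * π * Y) * ξ i)
        linarith
      · rw [sub_nonneg, Real.exp_le_exp]
        have : 2 * π * y * ξ i ≤ 2 * π * Y * ξ i := by gcongr
        linarith
    · simp
  · have h := hC d i y Y hy hY (𝓕⁻ w) (continuous_fourierInv hw).measurable
      ⟨_, fun t => norm_fourierInv_le w t⟩
    have e : (fun x => ∫ t : ℝ, cauchyDiff y Y t * 𝓕⁻ w (x - t • (EuclideanSpace.single i 1 : Rd d)))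
        = 𝓕⁻ fun ξ : Rd d => cauchyDiffSymbol y Y (ξ i) * w ξ := by
      ext x
      rw [integral_mul_fourierInv_translate (γ := fun t : ℝ => t • (EuclideanSpace.single i 1 : Rd d))
        (by fun_prop) (integrable_cauchyDiff hy hY) hw]
      refine congrArg (fun W : Rd d → ℂ => (𝓕⁻ W : Rd d → ℂ) x) (funext fun ξ => ?_)
      rw [← integral_cauchyDiff_mul_exp hy hY]
      simp [inner_smul_left, EuclideanSpace.inner_single_left, mul_assoc]
    rwa [e] at h

/-- One-sided exponential: supported on positive (`b = true`) or nonpositive (`b = false`) reals. -/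
def halfExp : Bool → ℝ → ℝ → ℂ
  | true, s, x => if 0 < x then (Real.exp (-s * x) : ℂ) else 0
  | false, s, x => if x ≤ 0 then (Real.exp (s * x) : ℂ) else 0

theorem measurable_halfExp (b : Bool) (s : ℝ) : Measurable (halfExp b s) := by
  cases b
  · exact Measurable.ite measurableSet_Iic (by fun_prop) measurable_const
  · exact Measurable.ite measurableSet_Ioi (by fun_prop) measurable_const

theorem norm_halfExp_le_one (b : Bool) {s : ℝ} (hs : 0 ≤ s) (x : ℝ) : ‖halfExp b s x‖ ≤ 1 := by
  cases b <;> simp only [halfExp] <;> split_ifs with h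
  · rw [Complex.norm_real, Real.norm_of_nonneg (by positivity), Real.exp_le_one_iff]
    exact mul_nonpos_of_nonneg_of_nonpos hs h
  · simp
  · rw [Complex.norm_real, Real.norm_of_nonneg (by positivity), Real.exp_le_one_iff, neg_mul]
    have : 0 ≤ s * x := by positivity
    linarith
  · simp

theorem halfExp_false_eq {x : ℝ} (hx : x ≠ 0) (s : ℝ) : halfExp false s x = halfExp true s (-x) := by
  rcases lt_or_gt_of_ne hx with h | h
  · rw [halfExp, halfExp, if_pos h.le, if_pos (by linarith)]
    simp
  · rw [halfExp, halfExp, if_neg (by linarith), if_neg (by linarith)]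

/-- One-sided exponentials in one coordinate are `L^p` multipliers, uniformly in the rate. -/
theorem isLpMultiplier_halfExp {p : ℝ} (hp : 1 < p) :
    ∃ C : ℝ≥0, ∀ (d : ℕ) (i : Fin d) (b : Bool) (s : ℝ), 0 ≤ s →
      IsLpMultiplier (ENNReal.ofReal p) C (fun ξ : Rd d => halfExp b s (ξ i)) := by
  obtain ⟨C, hC⟩ := isLpMultiplier_cauchyDiffSymbol hp
  have hpi := Real.pi_pos
  have hpos : ∀ (d : ℕ) (i : Fin d) (s : ℝ), 0 ≤ s →
      IsLpMultiplier (ENNReal.ofReal p) C (fun ξ : Rd d => halfExp true s (ξ i)) := by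
    intro d i s hs
    refine IsLpMultiplier.of_tendsto
      (σ := fun (n : ℕ) ξ => cauchyDiffSymbol (s / (2 * π) + 1 / ((n : ℝ) + 1)) (s / (2 * π) + 1 + n) (ξ i))
      (fun n => hC d i _ _ (by positivity) ?_) (fun ξ => ?_)
    · have : 1 / ((n : ℝ) + 1) ≤ 1 := by
        rw [div_le_one (by positivity)]; linarith [(Nat.cast_nonneg n : (0 : ℝ) ≤ n)]
      have := (Nat.cast_nonneg n : (0 : ℝ) ≤ n)
      linarith
    · simp only [cauchyDiffSymbol, halfExp]
      split_ifs with h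
      · refine (Complex.continuous_ofReal.tendsto _).comp ?_
        rw [← sub_zero (Real.exp (-s * ξ i))]
        refine Filter.Tendsto.sub ?_ ?_
        · refine (Real.continuous_exp.tendsto _).comp ?_
          have h1 := ((tendsto_one_div_add_atTop_nhds_zero_nat (𝕜 := ℝ)).const_add (s / (2 * π))).const_mul
            (-(2 * π)) |>.mul_const (ξ i)
          rw [add_zero, show -(2 * π) * (s / (2 * π)) = -s by field_simp] at h1
          refine h1.congr fun n => ?_
          ring
        · refine Real.tendsto_exp_atBot.comp ?_
          have h1 : Filter.Tendsto (fun n : ℕ => (2 * π * ξ i) * (s / (2 * π) + 1 + (n : ℝ)))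
              Filter.atTop Filter.atTop :=
            Filter.Tendsto.const_mul_atTop (by positivity)
              (Filter.tendsto_atTop_add_const_left _ _ tendsto_natCast_atTop_atTop)
          refine (Filter.tendsto_neg_atTop_atBot.comp h1).congr fun n => ?_
          simp only [Function.comp]
          ring
      · exact tendsto_const_nhds
  refine ⟨C, fun d i b s hs => ?_⟩
  cases b
  · refine (hpos d i s hs).comp_neg.congr_ae
      ((measurable_halfExp _ _).comp (by fun_prop)) (fun ξ => norm_halfExp_le_one _ hs _) ?_
    have hker : LinearMap.ker (EuclideanSpace.proj i : Rd d →L[ℝ] ℝ).toLinearMap ≠ ⊤ := by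
      intro h
      have : (EuclideanSpace.single i 1 : Rd d) ∈
        LinearMap.ker (EuclideanSpace.proj i : Rd d →L[ℝ] ℝ).toLinearMap := h ▸ Submodule.mem_top
      simp at this
    have hnull := Measure.addHaar_submodule (volume : Measure (Rd d)) _ hker
    have h0 : ∀ᵐ ξ : Rd d, ξ i ≠ 0 := by
      rw [ae_iff]
      convert hnull using 2
      ext ξ
      simp
    filter_upwards [h0] with ξ hξ
    exact halfExp_false_eq hξ s
  · exact hpos d i s hs

section
variable {E : Type*} [NormedAddCommGroup E] [InnerProductSpace ℝ E] [MeasurableSpace E]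
  [BorelSpace E] [FiniteDimensional ℝ E]

/-- Convolution with a kernel of mass at most `c` and height at most `c * N` improves integrability. -/
theorem eLpNorm_integral_translate_le_of_le {K h : E → ℂ} (hK : Measurable K) (hh : Measurable h)
    {c : ℝ≥0} {N : ℝ≥0∞} (hK1 : ∫⁻ t, ‖K t‖ₑ ≤ c) (hKN : ∀ t, ‖K t‖ₑ ≤ c * N)
    {p : ℝ} (hp : 1 ≤ p) {r : ℝ≥0∞} (hr : ENNReal.ofReal p ≤ r) :
    eLpNorm (fun x => ∫ t, K t * h (x - t)) r
      ≤ c * N ^ (1 / p - r.toReal⁻¹) * eLpNorm h (ENNReal.ofReal p) := by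
  have hp0 : 0 < p := by linarith
  set H := eLpNorm h (ENNReal.ofReal p)
  have hH : ∫⁻ x, ‖h x‖ₑ ^ p = H ^ p := by
    have := lintegral_enorm_rpow_rpow_inv (μ := (volume : Measure E)) hp0 h
    rw [show H = _ from this.symm, ← ENNReal.rpow_mul, one_div_mul_cancel hp0.ne', ENNReal.rpow_one]
  have hsup : ∀ x, ‖∫ t, K t * h (x - t)‖ₑ ≤ c * N ^ (1 / p) * H := by
    intro x
    have hxm : Measurable fun t => ‖h (x - t)‖ₑ :=
      (hh.comp (g := h) (f := fun t => x - t) (by fun_prop)).enorm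
    have h1 : (∫⁻ t, ‖K t‖ₑ * ‖h (x - t)‖ₑ) ^ p ≤ (c : ℝ≥0∞) ^ (p - 1) * (c * N * H ^ p) := by
      refine (rpow_lintegral_mul_le hK.enorm hxm hp).trans ?_
      gcongr
      calc _ ≤ ∫⁻ t, c * N * ‖h (x - t)‖ₑ ^ p := by
            gcongr with t
            exact hKN t
        _ = c * N * H ^ p := by
            rw [lintegral_const_mul _ (hxm.pow_const _),
              lintegral_sub_left_eq_self (fun t => ‖h t‖ₑ ^ p) x, hH]
    have h2 : (c : ℝ≥0∞) ^ (p - 1) * (c * N * H ^ p) = (c * N ^ (1 / p) * H) ^ p := by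
      rw [ENNReal.mul_rpow_of_nonneg _ _ hp0.le, ENNReal.mul_rpow_of_nonneg _ _ hp0.le,
        ← ENNReal.rpow_mul, one_div_mul_cancel hp0.ne', ENNReal.rpow_one, ← mul_assoc, ← mul_assoc]
      congr 2
      nth_rewrite 2 [← ENNReal.rpow_one (c : ℝ≥0∞)]
      rw [← ENNReal.rpow_add_of_nonneg _ _ (by linarith) zero_le_one, sub_add_cancel]
    rw [h2, ENNReal.rpow_le_rpow_iff hp0] at h1
    refine (enorm_integral_le_lintegral_enorm _).trans (le_trans (le_of_eq ?_) h1)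
    simp only [enorm_mul]
  have hLp : eLpNorm (fun x => ∫ t, K t * h (x - t)) (ENNReal.ofReal p) ≤ c * H :=
    (eLpNorm_integral_translate_le measurable_id hK hh hp).trans (by gcongr)
  rcases eq_or_ne r ∞ with rfl | hrt
  · simp only [ENNReal.toReal_top, inv_zero, sub_zero]
    rw [eLpNorm_exponent_top]
    exact eLpNormEssSup_le_of_ae_enorm_bound (.of_forall hsup)
  lift r to ℝ≥0 using hrt
  obtain ⟨ρ, hρ⟩ : ∃ ρ : ℝ, (r : ℝ) = ρ := ⟨_, rfl⟩
  have hr' : (r : ℝ≥0∞) = ENNReal.ofReal ρ := by rw [← hρ, ENNReal.ofReal_coe_nnreal]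
  have hpρ : p ≤ ρ := by
    rw [hr'] at hr
    exact (ENNReal.ofReal_le_ofReal_iff (hρ ▸ r.2)).1 hr
  have hρ0 : 0 < ρ := by linarith
  have hTp : ∫⁻ x, ‖∫ t, K t * h (x - t)‖ₑ ^ p ≤ (c * H) ^ p := by
    rw [← lintegral_enorm_rpow_rpow_inv hp0] at hLp
    have := ENNReal.rpow_le_rpow hLp hp0.le
    rwa [← ENNReal.rpow_mul, one_div_mul_cancel hp0.ne', ENNReal.rpow_one] at this
  rw [ENNReal.coe_toReal, hρ, hr', ← lintegral_enorm_rpow_rpow_inv hρ0, one_div ρ,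
    ENNReal.rpow_inv_le_iff hρ0]
  calc ∫⁻ x, ‖∫ t, K t * h (x - t)‖ₑ ^ ρ
      ≤ ∫⁻ x, (c * N ^ (1 / p) * H) ^ (ρ - p) * ‖∫ t, K t * h (x - t)‖ₑ ^ p := by
        refine lintegral_mono fun x => ?_
        calc ‖∫ t, K t * h (x - t)‖ₑ ^ ρ
            = ‖∫ t, K t * h (x - t)‖ₑ ^ (ρ - p) * ‖∫ t, K t * h (x - t)‖ₑ ^ p := by
              rw [← ENNReal.rpow_add_of_nonneg _ _ (by linarith) hp0.le, sub_add_cancel]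
          _ ≤ _ := by
              gcongr
              exact hsup x
    _ ≤ (c * N ^ (1 / p) * H) ^ (ρ - p) * (c * H) ^ p := by
        have hm : Measurable fun x => ∫ t, K t * h (x - t) :=
          measurable_integral_translate measurable_id hK hh
        rw [lintegral_const_mul _ (hm.enorm.pow_const p)]
        gcongr
    _ = _ := by
        have h0 : 0 ≤ ρ - p := by linarith
        rw [ENNReal.mul_rpow_of_nonneg _ _ h0, ENNReal.mul_rpow_of_nonneg _ _ h0,
          ENNReal.mul_rpow_of_nonneg _ _ hp0.le, ENNReal.mul_rpow_of_nonneg _ _ hρ0.le,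
          ENNReal.mul_rpow_of_nonneg _ _ hρ0.le, ← ENNReal.rpow_mul, ← ENNReal.rpow_mul]
        have e1 : ∀ a : ℝ≥0∞, a ^ ρ = a ^ (ρ - p) * a ^ p := fun a => by
          rw [← ENNReal.rpow_add_of_nonneg _ _ h0 hp0.le, sub_add_cancel]
        have e2 : 1 / p * (ρ - p) = (1 / p - ρ⁻¹) * ρ := by field_simp
        rw [e1 c, e1 H, e2]
        ring

theorem fourierInv_comp_smul (w : E → ℂ) {s : ℝ} (hs : 0 < s) (x : E) :
    𝓕⁻ (fun ξ => w (s • ξ)) x = ((s ^ Module.finrank ℝ E)⁻¹ : ℝ) * 𝓕⁻ w (s⁻¹ • x) := by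
  rw [Real.fourierInv_eq', Real.fourierInv_eq']
  have h := Measure.integral_comp_smul (μ := (volume : Measure E))
    (fun ξ => Complex.exp (↑(2 * π * inner ℝ ξ (s⁻¹ • x)) * Complex.I) • w ξ) s
  rw [abs_of_nonneg (by positivity), Complex.real_smul] at h
  rw [← h]
  refine integral_congr_ae (.of_forall fun ξ => ?_)
  simp only
  rw [inner_smul_left, inner_smul_right, ← mul_assoc ((starRingEnd ℝ) s)]
  simp [hs.ne']

theorem lintegral_fourierInv_comp_smul (w : E → ℂ) (hw : Integrable (𝓕⁻ w)) {s : ℝ} (hs : 0 < s) :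
    ∫⁻ x, ‖𝓕⁻ (fun ξ => w (s • ξ)) x‖ₑ = ∫⁻ x, ‖𝓕⁻ w x‖ₑ := by
  have hi : Integrable fun x => ((s ^ Module.finrank ℝ E)⁻¹ : ℝ) * 𝓕⁻ w (s⁻¹ • x) :=
    (hw.comp_smul (inv_ne_zero hs.ne')).const_mul _
  simp only [fourierInv_comp_smul w hs]
  rw [← ofReal_integral_norm_eq_lintegral_enorm hi, ← ofReal_integral_norm_eq_lintegral_enorm hw]
  congr 1
  simp only [norm_mul, Complex.norm_real]
  rw [integral_const_mul, Measure.integral_comp_smul volume (fun x => ‖𝓕⁻ w x‖),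
    Real.norm_of_nonneg (by positivity), abs_of_nonneg (by positivity), smul_eq_mul, ← mul_assoc]
  have : (s ^ Module.finrank ℝ E)⁻¹ * ((s⁻¹) ^ Module.finrank ℝ E)⁻¹ = 1 := by
    rw [inv_pow, inv_inv]
    exact inv_mul_cancel₀ (by positivity)
  rw [this, one_mul]
end

/-- Bernstein's inequality for a smooth compactly supported cut-off dilated dyadically. -/
theorem exists_bernstein {d : ℕ} {χ : Rd d → ℝ} (h1 : ContDiff ℝ (⊤ : ℕ∞) χ)
    (h2 : HasCompactSupport χ) :
    ∃ C : ℝ≥0, ∀ (k : ℤ) (p : ℝ) (r : ℝ≥0∞), 1 ≤ p → ENNReal.ofReal p ≤ r →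
      ∀ w : Rd d → ℂ, Integrable w →
        eLpNorm (𝓕⁻ fun ξ => (χ ((2 : ℝ) ^ (-k) • ξ) : ℂ) * w ξ) r
          ≤ C * ENNReal.ofReal ((2 : ℝ) ^ ((k : ℝ) * d * (1 / p - r.toReal⁻¹)))
            * eLpNorm (𝓕⁻ w) (ENNReal.ofReal p) := by
  set χc : Rd d → ℂ := fun ξ => χ ξ
  have hχ1 : ContDiff ℝ (⊤ : ℕ∞) χc := Complex.ofRealCLM.contDiff.comp h1
  have hχ2 : HasCompactSupport χc := h2.comp_left (g := ((↑) : ℝ → ℂ)) Complex.ofReal_zero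
  have hdil1 : ∀ k : ℤ, ContDiff ℝ (⊤ : ℕ∞) fun ξ => χc ((2 : ℝ) ^ (-k) • ξ) := fun k =>
    hχ1.comp (contDiff_const_smul _)
  have hdil2 : ∀ k : ℤ, HasCompactSupport fun ξ => χc ((2 : ℝ) ^ (-k) • ξ) := fun k =>
    hχ2.comp_smul (by positivity)
  set S : ℤ → 𝓢(Rd d, ℂ) := fun k => (hdil2 k).toSchwartzMap (hdil1 k)
  have hS : ∀ k, ⇑(S k) = fun ξ => χc ((2 : ℝ) ^ (-k) • ξ) := fun k => by ext; rfl
  have hSi : ∀ k : ℤ, Integrable (𝓕⁻ fun ξ => χc ((2 : ℝ) ^ (-k) • ξ)) := fun k => by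
    rw [← hS, ← SchwartzMap.fourierInv_coe]
    exact SchwartzMap.integrable _
  have hinv : ∀ k : ℤ, 𝓕 (𝓕⁻ fun ξ => χc ((2 : ℝ) ^ (-k) • ξ)) = fun ξ => χc ((2 : ℝ) ^ (-k) • ξ) := by
    intro k
    rw [← hS, ← SchwartzMap.fourierInv_coe, ← SchwartzMap.fourier_coe,
      FourierTransform.fourier_fourierInv_eq]
  have hSi0 : Integrable (𝓕⁻ χc) := by simpa using hSi 0
  have hχi : Integrable χc := hχ1.continuous.integrable_of_hasCompactSupport hχ2
  set c : ℝ≥0 := max (∫⁻ t, ‖𝓕⁻ χc t‖ₑ).toNNReal (∫ ξ, ‖χc ξ‖).toNNReal with hc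
  refine ⟨c, fun k p r hp hr w hw => ?_⟩
  have hs : (0 : ℝ) < 2 ^ (-k) := by positivity
  set K := 𝓕⁻ fun ξ => χc ((2 : ℝ) ^ (-k) • ξ) with hK
  have hKc : Continuous K := by
    rw [hK, ← hS]
    exact continuous_fourierInv (S k).integrable
  have hK1 : ∫⁻ t, ‖K t‖ₑ ≤ c := by
    rw [hK, lintegral_fourierInv_comp_smul χc hSi0 hs, ← ENNReal.coe_toNNReal hSi0.2.ne]
    exact ENNReal.coe_le_coe.2 (le_max_left _ _)
  have hKN : ∀ t, ‖K t‖ₑ ≤ c * ENNReal.ofReal ((2 : ℝ) ^ ((k : ℝ) * d)) := fun t => by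
    have h3 := norm_fourierInv_le (fun ξ => χc ((2 : ℝ) ^ (-k) • ξ)) t
    rw [Measure.integral_comp_smul volume (fun ξ => ‖χc ξ‖), abs_of_nonneg (by positivity),
      smul_eq_mul, mul_comm] at h3
    have h4 : (((2 : ℝ) ^ (-k)) ^ Module.finrank ℝ (Rd d))⁻¹ = (2 : ℝ) ^ ((k : ℝ) * d) := by
      rw [finrank_euclideanSpace_fin, zpow_neg, inv_pow, inv_inv, Real.rpow_mul (by norm_num),
        Real.rpow_intCast, Real.rpow_natCast]
    rw [h4] at h3
    rw [← ofReal_norm]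
    refine (ENNReal.ofReal_le_ofReal h3).trans ?_
    rw [ENNReal.ofReal_mul (integral_nonneg fun _ => norm_nonneg _)]
    gcongr
    rw [ENNReal.ofReal]
    exact ENNReal.coe_le_coe.2 (le_max_right _ _)
  have key := eLpNorm_integral_translate_le_of_le hKc.measurable (continuous_fourierInv hw).measurable
    hK1 hKN hp hr
  have e : (fun x => ∫ t, K t * 𝓕⁻ w (x - t)) = 𝓕⁻ fun ξ => χc ((2 : ℝ) ^ (-k) • ξ) * w ξ := by
    ext x
    have h5 := integral_mul_fourierInv_translate (γ := fun t : Rd d => t) measurable_id (hSi k) hw x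
    rw [h5]
    refine congrArg (fun W : Rd d → ℂ => (𝓕⁻ W : Rd d → ℂ) x) (funext fun ξ => ?_)
    rw [← congrFun (hinv k) ξ, Real.fourier_eq']
    simp
  rw [e] at key
  refine key.trans_eq ?_
  rw [ENNReal.ofReal_rpow_of_pos (by positivity), ← Real.rpow_mul (by norm_num)]

/-- A product of one-sided exponentials in each of the coordinates. -/
def halfExpProd {d : ℕ} (b : Fin d → Bool) (s : Fin d → ℝ) (ξ : Rd d) : ℂ :=
  ∏ i, halfExp (b i) (s i) (ξ i)

theorem isLpMultiplier_halfExpProd {p : ℝ} (hp : 1 < p) (d : ℕ) :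
    ∃ C : ℝ≥0, ∀ (b : Fin d → Bool) (s : Fin d → ℝ), (∀ i, 0 ≤ s i) →
      IsLpMultiplier (ENNReal.ofReal p) C (halfExpProd b s) := by
  obtain ⟨C, hC⟩ := isLpMultiplier_halfExp hp
  exact ⟨C ^ (Finset.univ : Finset (Fin d)).card, fun b s hs =>
    IsLpMultiplier.prod Finset.univ fun i => hC d i (b i) (s i) (hs i)⟩

/-- The symbol of `(A, B) ↦ e^{τΛ₁}(e^{-τΛ₁}A · e^{-τΛ₁}B)`. -/
def gevreySymbol {d : ℕ} (τ : ℝ) (ξ η : Rd d) : ℝ :=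
  Real.exp (τ * (∑ i, |ξ i + η i| - ∑ i, |ξ i| - ∑ i, |η i|))

/-- The decay rate of an input factor supported on the half-line `b`, when the output lies on the
half-line `o`. -/
def inputRate (τ : ℝ) (o b : Bool) : ℝ := if b = o then 0 else 2 * τ

theorem inputRate_nonneg {τ : ℝ} (hτ : 0 ≤ τ) (o b : Bool) : 0 ≤ inputRate τ o b := by
  unfold inputRate
  split_ifs <;> linarith

theorem exp_abs_add_eq_sum_halfExp (τ a b : ℝ) :
    (Real.exp (τ * (|a + b| - |a| - |b|)) : ℂ) = ∑ κ : Bool × Bool × Bool,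
      halfExp κ.1 0 (a + b) * (halfExp κ.2.1 (inputRate τ κ.1 κ.2.1) a *
        halfExp κ.2.2 (inputRate τ κ.1 κ.2.2) b) := by
  simp only [Fintype.sum_prod_type, Fintype.sum_bool, inputRate, halfExp]
  rcases le_or_gt a 0 with ha | ha <;> rcases le_or_gt b 0 with hb | hb <;>
    rcases le_or_gt (a + b) 0 with hab | hab
  · simp [ha, hb, hab, ha.not_gt, hb.not_gt, hab.not_gt, abs_of_nonpos]
  · linarith
  · simp [ha, hb, hab, ha.not_gt, hb.not_ge, hab.not_gt, abs_of_nonpos, abs_of_pos]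
    ring_nf
  · simp [ha, hb, hab, ha.not_gt, hb.not_ge, hab.not_ge, abs_of_nonpos, abs_of_pos]
    ring_nf
  · simp [ha, hb, hab, ha.not_ge, hb.not_gt, hab.not_gt, abs_of_nonpos, abs_of_pos]
    ring_nf
  · simp [ha, hb, hab, ha.not_ge, hb.not_gt, hab.not_ge, abs_of_nonpos, abs_of_pos]
    ring_nf
  · linarith
  · simp [ha, hb, hab, ha.not_ge, hb.not_ge, hab.not_ge, abs_of_pos]

theorem gevreySymbol_eq_sum {d : ℕ} (τ : ℝ) (ξ η : Rd d) :
    (gevreySymbol τ ξ η : ℂ) = ∑ κ : Fin d → Bool × Bool × Bool,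
      halfExpProd (fun i => (κ i).1) (fun _ => 0) (ξ + η) *
        (halfExpProd (fun i => (κ i).2.1) (fun i => inputRate τ (κ i).1 (κ i).2.1) ξ *
          halfExpProd (fun i => (κ i).2.2) (fun i => inputRate τ (κ i).1 (κ i).2.2) η) := by
  have h : gevreySymbol τ ξ η = ∏ i, Real.exp (τ * (|ξ i + η i| - |ξ i| - |η i|)) := by
    rw [gevreySymbol, ← Real.exp_sum, ← Finset.mul_sum, Finset.sum_sub_distrib,
      Finset.sum_sub_distrib]
  simp only [h, Complex.ofReal_prod, exp_abs_add_eq_sum_halfExp, Fintype.prod_sum, halfExpProd,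
    Finset.prod_mul_distrib, PiLp.add_apply]

theorem gevreySymbol_nonneg {d : ℕ} (τ : ℝ) (ξ η : Rd d) : 0 ≤ gevreySymbol τ ξ η :=
  (Real.exp_pos _).le

theorem gevreySymbol_le_one {d : ℕ} {τ : ℝ} (hτ : 0 ≤ τ) (ξ η : Rd d) : gevreySymbol τ ξ η ≤ 1 := by
  refine Real.exp_le_one_iff.2 (mul_nonpos_of_nonneg_of_nonpos hτ ?_)
  rw [sub_sub, ← Finset.sum_add_distrib, sub_nonpos]
  exact Finset.sum_le_sum fun i _ => abs_add_le _ _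

theorem gevreySymbol_comm {d : ℕ} (τ : ℝ) (ξ η : Rd d) : gevreySymbol τ ξ η = gevreySymbol τ η ξ := by
  simp only [gevreySymbol, add_comm, sub_right_comm]

/-- The bilinear operator `(A, B) ↦ e^{τΛ₁}(e^{-τΛ₁}A · e^{-τΛ₁}B)` on the Fourier side. -/
def bilin {d : ℕ} (τ : ℝ) (u v : Rd d → ℂ) (ξ : Rd d) : ℂ :=
  ∫ t, (gevreySymbol τ t (ξ - t) : ℂ) * (u t * v (ξ - t))

theorem bilin_comm {d : ℕ} (τ : ℝ) (u v : Rd d → ℂ) : bilin τ u v = bilin τ v u := by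
  ext ξ
  rw [bilin, ← integral_sub_left_eq_self _ volume ξ]
  simp only [bilin, sub_sub_cancel, gevreySymbol_comm τ (ξ - _), mul_comm (u _)]

section
variable {d : ℕ} {u v : Rd d → ℂ}

theorem integrable_mul_comp_sub (hu : Integrable u) (hv : Integrable v) (hb : ∃ M, ∀ t, ‖v t‖ ≤ M)
    (ξ : Rd d) : Integrable fun t => u t * v (ξ - t) := by
  obtain ⟨M, hM⟩ := hb
  exact hu.mul_bdd (c := M) (hv.comp_sub_left ξ).1 (.of_forall fun t => hM _)

theorem integrable_bilin_integrand {τ : ℝ} (hτ : 0 ≤ τ) (hu : Integrable u) (hv : Integrable v)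
    (hb : ∃ M, ∀ t, ‖v t‖ ≤ M) (ξ : Rd d) :
    Integrable fun t => (gevreySymbol τ t (ξ - t) : ℂ) * (u t * v (ξ - t)) := by
  have hc : Continuous fun t : Rd d => (gevreySymbol τ t (ξ - t) : ℂ) := by
    unfold gevreySymbol
    fun_prop
  refine integrable_mul_of_norm_le hc.measurable (K := 1) (fun t => ?_)
    (integrable_mul_comp_sub hu hv hb ξ)
  rw [Complex.norm_real, Real.norm_of_nonneg (gevreySymbol_nonneg _ _ _)]
  exact gevreySymbol_le_one hτ _ _

theorem integrable_integral_mul_comp_sub (hu : Integrable u) (hv : Integrable v) :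
    Integrable fun ξ => ∫ t, u t * v (ξ - t) := by
  exact hu.integrable_convolution (ContinuousLinearMap.mul ℂ ℂ) hv

theorem fourierInv_integral_mul_comp_sub (hu : Integrable u) (hv : Integrable v) (x : Rd d) :
    𝓕⁻ (fun ξ => ∫ t, u t * v (ξ - t)) x = 𝓕⁻ u x * 𝓕⁻ v x := by
  rw [Real.fourierInv_eq_fourier_neg, Real.fourierInv_eq_fourier_neg, Real.fourierInv_eq_fourier_neg]
  exact Real.fourier_mul_convolution_eq hu hv (-x)

theorem bilin_eq_sum {τ : ℝ} (hτ : 0 ≤ τ) (hu : Integrable u) (hv : Integrable v)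
    (hb : ∃ M, ∀ t, ‖v t‖ ≤ M) (ξ : Rd d) :
    bilin τ u v ξ = ∑ κ : Fin d → Bool × Bool × Bool,
      halfExpProd (fun i => (κ i).1) (fun _ => 0) ξ *
        ∫ t, (halfExpProd (fun i => (κ i).2.1) (fun i => inputRate τ (κ i).1 (κ i).2.1) t * u t) *
          (halfExpProd (fun i => (κ i).2.2) (fun i => inputRate τ (κ i).1 (κ i).2.2) (ξ - t) *
            v (ξ - t)) := by
  obtain ⟨C, hC⟩ := isLpMultiplier_halfExpProd (p := 2) (by norm_num) d
  simp only [bilin, gevreySymbol_eq_sum, add_sub_cancel, Finset.sum_mul]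
  rw [integral_finsetSum]
  · refine Finset.sum_congr rfl fun κ _ => ?_
    rw [← integral_const_mul]
    exact integral_congr_ae (.of_forall fun t => by ring)
  · intro κ _
    have hN := hC (fun i => (κ i).2.2) (fun i => inputRate τ (κ i).1 (κ i).2.2)
      fun i => inputRate_nonneg hτ _ _
    have hM := hC (fun i => (κ i).2.1) (fun i => inputRate τ (κ i).1 (κ i).2.1)
      fun i => inputRate_nonneg hτ _ _
    refine ((integrable_mul_comp_sub (hM.integrable_mul hu) (hN.integrable_mul hv) ?_ ξ).const_mul
      (halfExpProd (fun i => (κ i).1) (fun _ => 0) ξ)).congr (.of_forall fun t => by ring)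
    obtain ⟨M, hM⟩ := hb
    refine ⟨M, fun t => ?_⟩
    rw [norm_mul]
    exact (mul_le_of_le_one_left (norm_nonneg _) (hN.norm_le_one t)).trans (hM t)

theorem fourierInv_sum {ι : Type*} (s : Finset ι) {w : ι → Rd d → ℂ} (hw : ∀ i ∈ s, Integrable (w i)) :
    𝓕⁻ (fun ξ => ∑ i ∈ s, w i ξ) = ∑ i ∈ s, 𝓕⁻ (w i) := by
  ext x
  simp only [Finset.sum_apply, Real.fourierInv_eq, Finset.smul_sum]
  exact integral_finsetSum _ fun i hi =>
    (Real.fourierIntegral_convergent_iff (V := Rd d) (-x)).2 (hw i hi) |>.congr (.of_forall fun t => by simp)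

end

theorem exists_eLpNorm_bilin_block_le {d : ℕ} {φ χ : Rd d → ℝ} (hφ : ContDiff ℝ (⊤ : ℕ∞) φ)
    (hφc : HasCompactSupport φ) (hχ : ContDiff ℝ (⊤ : ℕ∞) χ) (hχc : HasCompactSupport χ)
    {p q ρ : ℝ} (hp : 1 < p) (hq : 1 < q) (hρ : 1 ≤ ρ) (hρq : ρ ≤ q) {r : ℝ≥0∞}
    (hr : ENNReal.ofReal p ≤ r) (hρr : ENNReal.HolderTriple r (ENNReal.ofReal p) (ENNReal.ofReal ρ)) :
    ∃ C : ℝ≥0, ∀ τ : ℝ, 0 ≤ τ → ∀ (j k : ℤ) (u v : Rd d → ℂ), Integrable u → Integrable v →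
      (∃ M, ∀ t, ‖v t‖ ≤ M) → (∀ ξ, (χ ((2 : ℝ) ^ (-k) • ξ) : ℂ) * u ξ = u ξ) →
      eLpNorm (𝓕⁻ fun ξ => (φ ((2 : ℝ) ^ (-j) • ξ) : ℂ) * bilin τ u v ξ) (ENNReal.ofReal q) ≤
        C * ENNReal.ofReal ((2 : ℝ) ^ ((j : ℝ) * d * (1 / ρ - 1 / q))) *
          ENNReal.ofReal ((2 : ℝ) ^ ((k : ℝ) * d * (1 / p - r.toReal⁻¹))) *
          (eLpNorm (𝓕⁻ u) (ENNReal.ofReal p) * eLpNorm (𝓕⁻ v) (ENNReal.ofReal p)) := by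
  obtain ⟨Cp, hCp⟩ := isLpMultiplier_halfExpProd hp d
  obtain ⟨Cq, hCq⟩ := isLpMultiplier_halfExpProd hq d
  obtain ⟨Cφ, hCφ⟩ := exists_bernstein hφ hφc
  obtain ⟨Cχ, hCχ⟩ := exists_bernstein hχ hχc
  refine ⟨Fintype.card (Fin d → Bool × Bool × Bool) * (Cq * Cφ * (Cχ * Cp * Cp)), ?_⟩
  intro τ hτ j k u v hu hv hb huk
  have hφm : ∃ K, ∀ ξ, ‖(φ ((2 : ℝ) ^ (-j) • ξ) : ℂ)‖ ≤ K := by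
    obtain ⟨K, hK⟩ := hφc.exists_bound_of_continuous hφ.continuous
    exact ⟨K, fun ξ => by simpa using hK _⟩
  obtain ⟨K, hK⟩ := hφm
  have hφmeas : Measurable fun ξ => (φ ((2 : ℝ) ^ (-j) • ξ) : ℂ) :=
    (Complex.continuous_ofReal.comp (hφ.continuous.comp (continuous_const_smul _))).measurable
  let O : (Fin d → Bool × Bool × Bool) → Rd d → ℂ := fun κ => halfExpProd (fun i => (κ i).1) (fun _ => 0)
  let M : (Fin d → Bool × Bool × Bool) → Rd d → ℂ := fun κ ξ =>
    halfExpProd (fun i => (κ i).2.1) (fun i => inputRate τ (κ i).1 (κ i).2.1) ξ * u ξ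
  let N : (Fin d → Bool × Bool × Bool) → Rd d → ℂ := fun κ ξ =>
    halfExpProd (fun i => (κ i).2.2) (fun i => inputRate τ (κ i).1 (κ i).2.2) ξ * v ξ
  have hO κ : IsLpMultiplier (ENNReal.ofReal q) Cq (O κ) := hCq _ _ fun _ => le_rfl
  have hM (κ : Fin d → Bool × Bool × Bool) := hCp (fun i => (κ i).2.1) (fun i => inputRate τ (κ i).1 (κ i).2.1)
    fun i => inputRate_nonneg hτ _ _
  have hN (κ : Fin d → Bool × Bool × Bool) := hCp (fun i => (κ i).2.2) (fun i => inputRate τ (κ i).1 (κ i).2.2)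
    fun i => inputRate_nonneg hτ _ _
  have hMi κ : Integrable (M κ) := (hM κ).integrable_mul hu
  have hNi κ : Integrable (N κ) := (hN κ).integrable_mul hv
  have hci κ : Integrable fun ξ => ∫ t, M κ t * N κ (ξ - t) :=
    integrable_integral_mul_comp_sub (hMi κ) (hNi κ)
  have hpi κ : Integrable fun ξ => (φ ((2 : ℝ) ^ (-j) • ξ) : ℂ) * ∫ t, M κ t * N κ (ξ - t) :=
    integrable_mul_of_norm_le hφmeas hK (hci κ)
  have e : (fun ξ => (φ ((2 : ℝ) ^ (-j) • ξ) : ℂ) * bilin τ u v ξ) = fun ξ => ∑ κ,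
      O κ ξ * ((φ ((2 : ℝ) ^ (-j) • ξ) : ℂ) * ∫ t, M κ t * N κ (ξ - t)) := by
    ext ξ
    rw [bilin_eq_sum hτ hu hv hb, Finset.mul_sum]
    exact Finset.sum_congr rfl fun κ _ => by ring
  rw [e, fourierInv_sum _ fun κ _ => (hO κ).integrable_mul (hpi κ)]
  refine (eLpNorm_sum_le (fun κ _ =>
    (continuous_fourierInv ((hO κ).integrable_mul (hpi κ))).aestronglyMeasurable)
    (ENNReal.one_le_ofReal.2 hq.le)).trans ?_
  have key κ : eLpNorm (𝓕⁻ fun ξ => O κ ξ * ((φ ((2 : ℝ) ^ (-j) • ξ) : ℂ) *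
      ∫ t, M κ t * N κ (ξ - t))) (ENNReal.ofReal q) ≤
      Cq * (Cφ * ENNReal.ofReal ((2 : ℝ) ^ ((j : ℝ) * d * (1 / ρ - 1 / q))) *
        ((Cχ * ENNReal.ofReal ((2 : ℝ) ^ ((k : ℝ) * d * (1 / p - r.toReal⁻¹))) *
          (Cp * eLpNorm (𝓕⁻ u) (ENNReal.ofReal p))) * (Cp * eLpNorm (𝓕⁻ v) (ENNReal.ofReal p)))) := by
    refine ((hO κ).eLpNorm_le _ (hpi κ)).trans (mul_le_mul_right ?_ _)
    have h1 := hCφ j ρ (ENNReal.ofReal q) hρ (ENNReal.ofReal_le_ofReal hρq) _ (hci κ)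
    rw [ENNReal.toReal_ofReal (by linarith), ← one_div q] at h1
    refine h1.trans (mul_le_mul_right ?_ _)
    have h2 : 𝓕⁻ (fun ξ => ∫ t, M κ t * N κ (ξ - t)) = 𝓕⁻ (M κ) • 𝓕⁻ (N κ) :=
      funext fun x => fourierInv_integral_mul_comp_sub (hMi κ) (hNi κ) x
    rw [h2]
    refine (eLpNorm_smul_le_mul_eLpNorm (p := r) (q := ENNReal.ofReal p)
      (continuous_fourierInv (hNi κ)).aestronglyMeasurable
      (continuous_fourierInv (hMi κ)).aestronglyMeasurable).trans ?_
    refine mul_le_mul' ?_ ((hN κ).eLpNorm_le v hv)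
    have h3 := hCχ k p r hp.le hr _ (hMi κ)
    have h4 : (fun ξ => (χ ((2 : ℝ) ^ (-k) • ξ) : ℂ) * M κ ξ) = M κ := funext fun ξ => by
      simp only [M]
      rw [mul_left_comm, huk]
    rw [h4] at h3
    exact h3.trans (mul_le_mul_right ((hM κ).eLpNorm_le u hu) _)
  refine (Finset.sum_le_sum fun κ _ => key κ).trans_eq ?_
  rw [Finset.sum_const, Finset.card_univ, nsmul_eq_mul]
  push_cast
  ring

theorem le_add_of_two_zpow_le {a b n : ℤ} {c : ℝ} (h : (2 : ℝ) ^ a ≤ c * (2 : ℝ) ^ b)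
    (hc : c < (2 : ℝ) ^ (n + 1)) : a ≤ b + n := by
  by_contra! hlt
  have h1 : (2 : ℝ) ^ (n + 1 + b) ≤ (2 : ℝ) ^ a := zpow_le_zpow_right₀ (by norm_num) (by omega)
  rw [zpow_add₀ (by norm_num)] at h1
  have h2 : (0 : ℝ) < (2 : ℝ) ^ b := by positivity
  nlinarith [mul_lt_mul_of_pos_right hc h2]

/-- The dyadic frequency localization of `u` at scale `2 ^ k`. -/
def freqBlock {d : ℕ} (φ : Rd d → ℝ) (k : ℤ) (u : Rd d → ℂ) (ξ : Rd d) : ℂ :=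
  (φ ((2 : ℝ) ^ (-k) • ξ) : ℂ) * u ξ

section
variable {d : ℕ} {φ : Rd d → ℝ}
theorem dyadic_norm_bounds (hφ3 : ∀ x : Rd d, φ x ≠ 0 → 3/4 ≤ ‖x‖ ∧ ‖x‖ ≤ 8/3)
    {k : ℤ} {ξ : Rd d} (h : φ ((2 : ℝ) ^ (-k) • ξ) ≠ 0) :
    3 / 4 * (2 : ℝ) ^ k ≤ ‖ξ‖ ∧ ‖ξ‖ ≤ 8 / 3 * (2 : ℝ) ^ k := by
  have h1 := hφ3 _ h
  have hk : (0 : ℝ) < (2 : ℝ) ^ k := by positivity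
  rw [norm_smul, Real.norm_of_nonneg (by positivity), zpow_neg, inv_mul_eq_div, le_div_iff₀ hk,
    div_le_iff₀ hk] at h1
  exact h1

theorem hasCompactSupport_of_annulus (hφ3 : ∀ x : Rd d, φ x ≠ 0 → 3/4 ≤ ‖x‖ ∧ ‖x‖ ≤ 8/3)
    : HasCompactSupport φ :=
  HasCompactSupport.of_support_subset_isCompact (isCompact_closedBall (0 : Rd d) (8 / 3)) fun x hx =>
    mem_closedBall_zero_iff.2 (hφ3 x hx).2

theorem exists_sum_dyadic_le (hφ1 : ContDiff ℝ (⊤ : ℕ∞) φ)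
    (hφ3 : ∀ x : Rd d, φ x ≠ 0 → 3/4 ≤ ‖x‖ ∧ ‖x‖ ≤ 8/3)
    : ∃ K : ℝ, ∀ (s : Finset ℤ) (ξ : Rd d),
    ‖∑ k ∈ s, (φ ((2 : ℝ) ^ (-k) • ξ) : ℂ)‖ ≤ K := by
  obtain ⟨K, hK⟩ := (hasCompactSupport_of_annulus hφ3).exists_bound_of_continuous hφ1.continuous
  have hK0 : 0 ≤ K := (norm_nonneg _).trans (hK 0)
  refine ⟨3 * K, fun s ξ => ?_⟩
  by_cases hex : ∃ k : ℤ, φ ((2 : ℝ) ^ (-k) • ξ) ≠ 0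
  · obtain ⟨k₀, hk₀⟩ := hex
    have h0 := dyadic_norm_bounds hφ3 hk₀
    have hsub : ∀ k : ℤ, φ ((2 : ℝ) ^ (-k) • ξ) ≠ 0 → k ∈ Finset.Icc (k₀ - 1) (k₀ + 1) := fun k hk => by
      have h1 := dyadic_norm_bounds hφ3 hk
      have h2 := le_add_of_two_zpow_le (a := k) (b := k₀) (n := 1) (c := 32 / 9) (by linarith)
        (by norm_num)
      have h3 := le_add_of_two_zpow_le (a := k₀) (b := k) (n := 1) (c := 32 / 9) (by linarith)
        (by norm_num)
      rw [Finset.mem_Icc]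
      omega
    rw [← Finset.sum_filter_ne_zero]
    refine (norm_sum_le_of_le _ fun k _ => (Complex.norm_real _).trans_le (hK _)).trans ?_
    rw [Finset.sum_const, nsmul_eq_mul]
    refine mul_le_mul_of_nonneg_right ?_ hK0
    have hcard := Finset.card_le_card (s := {k ∈ s | (φ ((2 : ℝ) ^ (-k) • ξ) : ℂ) ≠ 0})
      (t := Finset.Icc (k₀ - 1) (k₀ + 1)) fun k hk =>
        hsub k (Complex.ofReal_ne_zero.1 (Finset.mem_filter.1 hk).2)
    rw [Int.card_Icc, show (k₀ + 1 + 1 - (k₀ - 1)).toNat = 3 by omega] at hcard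
    exact_mod_cast hcard
  · push Not at hex
    simpa only [hex, Complex.ofReal_zero, Finset.sum_const_zero, norm_zero] using
      mul_nonneg zero_le_three hK0

theorem measurable_dyadic (hφ1 : ContDiff ℝ (⊤ : ℕ∞) φ) (k : ℤ) : Measurable fun ξ : Rd d => (φ ((2 : ℝ) ^ (-k) • ξ) : ℂ) :=
  (Complex.continuous_ofReal.comp (hφ1.continuous.comp (continuous_const_smul _))).measurable

theorem exists_dyadic_le (hφ1 : ContDiff ℝ (⊤ : ℕ∞) φ)
    (hφ3 : ∀ x : Rd d, φ x ≠ 0 → 3/4 ≤ ‖x‖ ∧ ‖x‖ ≤ 8/3)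
    : ∃ K : ℝ, ∀ (k : ℤ) (ξ : Rd d), ‖(φ ((2 : ℝ) ^ (-k) • ξ) : ℂ)‖ ≤ K := by
  obtain ⟨K, hK⟩ := exists_sum_dyadic_le hφ1 hφ3
  exact ⟨K, fun k ξ => by simpa using hK {k} ξ⟩

theorem integrable_freqBlock (hφ1 : ContDiff ℝ (⊤ : ℕ∞) φ)
    (hφ3 : ∀ x : Rd d, φ x ≠ 0 → 3/4 ≤ ‖x‖ ∧ ‖x‖ ≤ 8/3)
    (k : ℤ) {u : Rd d → ℂ} (hu : Integrable u) :
    Integrable (freqBlock φ k u) := by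
  obtain ⟨K, hK⟩ := exists_dyadic_le hφ1 hφ3
  exact integrable_mul_of_norm_le (measurable_dyadic hφ1 k) (hK k) hu

theorem exists_freqBlock_le (hφ1 : ContDiff ℝ (⊤ : ℕ∞) φ)
    (hφ3 : ∀ x : Rd d, φ x ≠ 0 → 3/4 ≤ ‖x‖ ∧ ‖x‖ ≤ 8/3)
    (k : ℤ) {u : Rd d → ℂ} (hu : ∃ M, ∀ t, ‖u t‖ ≤ M) :
    ∃ M, ∀ t, ‖freqBlock φ k u t‖ ≤ M := by
  obtain ⟨K, hK⟩ := exists_dyadic_le hφ1 hφ3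
  obtain ⟨M, hM⟩ := hu
  refine ⟨K * M, fun t => ?_⟩
  rw [freqBlock, norm_mul]
  exact mul_le_mul (hK k t) (hM t) (norm_nonneg _) ((norm_nonneg _).trans (hK k t))

/-- Frequency interactions: the product of a block at scale `k` with one at a scale `l ≥ k` only
meets frequencies `2 ^ j` with `j ≤ l + 2`, and `j ≥ l - 2` when `k` is much smaller than `l`. -/
theorem freqBlock_bilin_eq_zero (hφ3 : ∀ x : Rd d, φ x ≠ 0 → 3/4 ≤ ‖x‖ ∧ ‖x‖ ≤ 8/3)
    {τ : ℝ} {j k l : ℤ} (hkl : k ≤ l) (u v : Rd d → ℂ)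
    (h : ¬(j ≤ l + 2 ∧ (l - 2 ≤ k ∨ l ≤ j + 2))) :
    freqBlock φ j (bilin τ (freqBlock φ k u) (freqBlock φ l v)) = 0 := by
  ext ξ
  by_contra hne
  refine h ?_
  rw [Pi.zero_apply, freqBlock] at hne
  have hj := dyadic_norm_bounds hφ3 (Complex.ofReal_ne_zero.1 (left_ne_zero_of_mul hne))
  have hb := right_ne_zero_of_mul hne
  obtain ⟨t, ht⟩ : ∃ t, freqBlock φ k u t * freqBlock φ l v (ξ - t) ≠ 0 := by
    by_contra! h0
    exact hb (by simp [bilin, h0])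
  have hk := dyadic_norm_bounds hφ3
    (Complex.ofReal_ne_zero.1 (left_ne_zero_of_mul (left_ne_zero_of_mul ht)))
  have hl := dyadic_norm_bounds hφ3
    (Complex.ofReal_ne_zero.1 (left_ne_zero_of_mul (right_ne_zero_of_mul ht)))
  have h1 : ‖ξ‖ ≤ ‖t‖ + ‖ξ - t‖ := by simpa using norm_add_le t (ξ - t)
  have h2 : ‖ξ - t‖ ≤ ‖ξ‖ + ‖t‖ := norm_sub_le _ _
  have h3 : (2 : ℝ) ^ k ≤ (2 : ℝ) ^ l := zpow_le_zpow_right₀ (by norm_num) hkl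
  refine ⟨le_add_of_two_zpow_le (c := 64 / 9) (by linarith) (by norm_num), ?_⟩
  rcases le_or_gt (l - 2) k with hk' | hk'
  · exact Or.inl hk'
  · right
    have h4 : (2 : ℝ) ^ (k + 3) ≤ (2 : ℝ) ^ l := zpow_le_zpow_right₀ (by norm_num) (by omega)
    rw [zpow_add₀ (by norm_num), show (2 : ℝ) ^ (3 : ℤ) = 8 by norm_num] at h4
    exact le_add_of_two_zpow_le (c := 32 / 5) (by linarith) (by norm_num)

/-- Summation of the dyadic localizations over a finite set of scales. -/
theorem sum_freqBlock (s : Finset ℤ) (u : Rd d → ℂ) (ξ : Rd d) :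
    ∑ k ∈ s, freqBlock φ k u ξ = (∑ k ∈ s, (φ ((2 : ℝ) ^ (-k) • ξ) : ℂ)) * u ξ :=
  (Finset.sum_mul _ _ _).symm

theorem tendsto_sum_dyadic (hφ4 : ∀ ξ : Rd d, ξ ≠ 0 → ∑' j : ℤ, φ (((2 : ℝ) ^ (-j)) • ξ) = 1)
    {ξ : Rd d} (hξ : ξ ≠ 0) : Filter.Tendsto
      (fun n : ℕ => ∑ k ∈ Finset.Icc (-(n : ℤ)) n, (φ ((2 : ℝ) ^ (-k) • ξ) : ℂ))
      Filter.atTop (nhds 1) := by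
  have h1 : Summable fun j : ℤ => φ (((2 : ℝ) ^ (-j)) • ξ) := by
    by_contra hns
    exact zero_ne_one ((tsum_eq_zero_of_not_summable hns).symm.trans (hφ4 ξ hξ))
  have h2 := h1.hasSum.comp Finset.tendsto_Icc_neg
  rw [hφ4 ξ hξ] at h2
  refine ((Complex.continuous_ofReal.tendsto 1).comp h2).congr fun n => ?_
  simp only [Function.comp_apply, Complex.ofReal_sum]

theorem bilin_sum_freqBlock (hφ1 : ContDiff ℝ (⊤ : ℕ∞) φ)
    (hφ3 : ∀ x : Rd d, φ x ≠ 0 → 3/4 ≤ ‖x‖ ∧ ‖x‖ ≤ 8/3)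
    {τ : ℝ} (hτ : 0 ≤ τ) {u v : Rd d → ℂ} (hu : Integrable u) (hv : Integrable v)
    (hb : ∃ M, ∀ t, ‖v t‖ ≤ M) (s : Finset ℤ) (ξ : Rd d) :
    bilin τ (fun t => ∑ k ∈ s, freqBlock φ k u t) (fun t => ∑ k ∈ s, freqBlock φ k v t) ξ =
      ∑ k ∈ s, ∑ l ∈ s, bilin τ (freqBlock φ k u) (freqBlock φ l v) ξ := by
  have hi k l := integrable_bilin_integrand hτ (integrable_freqBlock hφ1 hφ3 k hu)
    (integrable_freqBlock hφ1 hφ3 l hv) (exists_freqBlock_le hφ1 hφ3 l hb) ξ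
  simp only [bilin, Finset.sum_mul_sum]
  simp only [Finset.mul_sum]
  rw [integral_finsetSum _ fun k _ => integrable_finsetSum _ fun l _ => hi k l]
  exact Finset.sum_congr rfl fun k _ => integral_finsetSum _ fun l _ => hi k l

theorem integrable_bilin {τ : ℝ} (hτ : 0 ≤ τ) {u v : Rd d → ℂ} (hu : Integrable u) (hv : Integrable v)
    (hb : ∃ M, ∀ t, ‖v t‖ ≤ M) : Integrable (bilin τ u v) := by
  obtain ⟨C, hC⟩ := isLpMultiplier_halfExpProd (p := 2) (by norm_num) d
  rw [funext fun ξ => bilin_eq_sum hτ hu hv hb ξ]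
  refine integrable_finsetSum _ fun κ _ => (hC _ _ fun _ => le_rfl).integrable_mul ?_
  exact integrable_integral_mul_comp_sub
    ((hC _ _ fun i => inputRate_nonneg hτ _ _).integrable_mul hu)
    ((hC _ _ fun i => inputRate_nonneg hτ _ _).integrable_mul hv)

theorem norm_bilin_integrand_le {τ : ℝ} (hτ : 0 ≤ τ) (ξ t : Rd d) (z : ℂ) :
    ‖(gevreySymbol τ t (ξ - t) : ℂ) * z‖ ≤ ‖z‖ := by
  rw [norm_mul, Complex.norm_real, Real.norm_of_nonneg (gevreySymbol_nonneg _ _ _)]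
  exact mul_le_of_le_one_left (norm_nonneg _) (gevreySymbol_le_one hτ _ _)

theorem tendsto_fourierInv_of_dominated {w : ℕ → Rd d → ℂ} {w' : Rd d → ℂ} {g : Rd d → ℝ}
    (hw : ∀ n, Integrable (w n)) (hg : Integrable g) (hwg : ∀ n ξ, ‖w n ξ‖ ≤ g ξ)
    (hlim : ∀ ξ, Filter.Tendsto (fun n => w n ξ) Filter.atTop (nhds (w' ξ))) (x : Rd d) :
    Filter.Tendsto (fun n => 𝓕⁻ (w n) x) Filter.atTop (nhds (𝓕⁻ w' x)) := by
  simp only [Real.fourierInv_eq', smul_eq_mul]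
  have hc : Continuous fun ξ : Rd d => Complex.exp (↑(2 * π * inner ℝ ξ x) * Complex.I) := by fun_prop
  refine tendsto_integral_of_dominated_convergence g
    (fun n => hc.aestronglyMeasurable.mul (hw n).1) hg (fun n => .of_forall fun ξ => ?_)
    (.of_forall fun ξ => (hlim ξ).const_mul _)
  rw [norm_mul, Complex.norm_exp_ofReal_mul_I, one_mul]
  exact hwg n ξ

theorem tendsto_fourierInv_freqBlock_bilin (hφ1 : ContDiff ℝ (⊤ : ℕ∞) φ)
    (hφ3 : ∀ x : Rd d, φ x ≠ 0 → 3/4 ≤ ‖x‖ ∧ ‖x‖ ≤ 8/3)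
    (hφ4 : ∀ ξ : Rd d, ξ ≠ 0 → ∑' j : ℤ, φ (((2 : ℝ) ^ (-j)) • ξ) = 1) (hd : d ≠ 0)
    {τ : ℝ} (hτ : 0 ≤ τ) {u v : Rd d → ℂ} (hu : Integrable u) (hv : Integrable v)
    (hb : ∃ M, ∀ t, ‖v t‖ ≤ M) (j : ℤ) (x : Rd d) :
    Filter.Tendsto (fun n : ℕ => ∑ k ∈ Finset.Icc (-(n : ℤ)) n, ∑ l ∈ Finset.Icc (-(n : ℤ)) n,
      𝓕⁻ (freqBlock φ j (bilin τ (freqBlock φ k u) (freqBlock φ l v))) x) Filter.atTop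
      (nhds (𝓕⁻ (freqBlock φ j (bilin τ u v)) x)) := by
  have : Nonempty (Fin d) := ⟨⟨0, Nat.pos_of_ne_zero hd⟩⟩
  obtain ⟨K, hK⟩ := exists_sum_dyadic_le hφ1 hφ3
  obtain ⟨K', hK'⟩ := exists_dyadic_le hφ1 hφ3
  have hK0 : 0 ≤ K := (norm_nonneg _).trans (hK ∅ 0)
  have hK0' : 0 ≤ K' := (norm_nonneg _).trans (hK' 0 0)
  have hi k l := integrable_freqBlock hφ1 hφ3 j (integrable_bilin hτ (integrable_freqBlock hφ1 hφ3 k hu)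
    (integrable_freqBlock hφ1 hφ3 l hv) (exists_freqBlock_le hφ1 hφ3 l hb))
  let S : ℕ → (Rd d → ℂ) → Rd d → ℂ := fun n w t => ∑ k ∈ Finset.Icc (-(n : ℤ)) n, freqBlock φ k w t
  have hS (n : ℕ) : (fun ξ => ∑ k ∈ Finset.Icc (-(n : ℤ)) n, ∑ l ∈ Finset.Icc (-(n : ℤ)) n,
      freqBlock φ j (bilin τ (freqBlock φ k u) (freqBlock φ l v)) ξ) =
      freqBlock φ j (bilin τ (S n u) (S n v)) := by
    ext ξ
    rw [freqBlock, bilin_sum_freqBlock hφ1 hφ3 hτ hu hv hb]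
    simp only [freqBlock, Finset.mul_sum]
  have hF (n : ℕ) : ∑ k ∈ Finset.Icc (-(n : ℤ)) n, ∑ l ∈ Finset.Icc (-(n : ℤ)) n,
      𝓕⁻ (freqBlock φ j (bilin τ (freqBlock φ k u) (freqBlock φ l v))) x =
      𝓕⁻ (freqBlock φ j (bilin τ (S n u) (S n v))) x := by
    rw [← hS, fourierInv_sum _ fun k _ => integrable_finsetSum _ fun l _ => hi k l, Finset.sum_apply]
    refine Finset.sum_congr rfl fun k _ => ?_
    rw [fourierInv_sum _ fun l _ => hi k l, Finset.sum_apply]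
  simp only [hF]
  have hSle (n : ℕ) (w : Rd d → ℂ) (t : Rd d) : ‖S n w t‖ ≤ K * ‖w t‖ := by
    simp only [S, sum_freqBlock, norm_mul]
    exact mul_le_mul_of_nonneg_right (hK _ _) (norm_nonneg _)
  have hSl (w : Rd d → ℂ) {t : Rd d} (ht : t ≠ 0) :
      Filter.Tendsto (fun n => S n w t) Filter.atTop (nhds (w t)) := by
    simpa only [S, sum_freqBlock, one_mul] using (tendsto_sum_dyadic hφ4 ht).mul_const (w t)
  have hSi (n : ℕ) {w : Rd d → ℂ} (hw : Integrable w) : Integrable (S n w) :=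
    integrable_finsetSum _ fun k _ => integrable_freqBlock hφ1 hφ3 k hw
  have hSb (n : ℕ) : ∃ M, ∀ t, ‖S n v t‖ ≤ M := by
    obtain ⟨M, hM⟩ := hb
    exact ⟨K * M, fun t => (hSle n v t).trans (mul_le_mul_of_nonneg_left (hM t) hK0)⟩
  have hprod (n : ℕ) (ξ t : Rd d) : ‖S n u t * S n v (ξ - t)‖ ≤ K * K * (‖u t‖ * ‖v (ξ - t)‖) := by
    rw [norm_mul]
    exact (mul_le_mul (hSle n u t) (hSle n v _) (norm_nonneg _) (by positivity)).trans_eq (by ring)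
  have hpi (ξ : Rd d) : Integrable fun t => K * K * (‖u t‖ * ‖v (ξ - t)‖) := by
    simpa only [norm_mul] using ((integrable_mul_comp_sub hu hv hb ξ).norm).const_mul (K * K)
  refine tendsto_fourierInv_of_dominated
    (g := fun ξ => K' * ∫ t, K * K * (‖u t‖ * ‖v (ξ - t)‖))
    (fun n => integrable_freqBlock hφ1 hφ3 j
      (integrable_bilin hτ (hSi n hu) (hSi n hv) (hSb n))) ?_ (fun n ξ => ?_) (fun ξ => ?_) x
  · simp only [integral_const_mul]
    exact ((hu.norm.integrable_convolution (ContinuousLinearMap.mul ℝ ℝ) hv.norm).const_mul _).const_mul _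
  · rw [freqBlock, norm_mul]
    refine mul_le_mul (hK' _ _) ?_ (norm_nonneg _) hK0'
    exact norm_integral_le_of_norm_le (hpi ξ) (.of_forall fun t =>
      (norm_bilin_integrand_le hτ _ _ _).trans (hprod n ξ t))
  · refine Filter.Tendsto.const_mul _ ?_
    refine tendsto_integral_of_dominated_convergence _
      (fun n => (integrable_bilin_integrand hτ (hSi n hu) (hSi n hv) (hSb n) ξ).1) (hpi ξ)
      (fun n => .of_forall fun t => (norm_bilin_integrand_le hτ _ _ _).trans (hprod n ξ t)) ?_
    filter_upwards [Measure.ae_ne volume (0 : Rd d), Measure.ae_ne volume ξ] with t ht htξ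
    exact ((hSl u ht).mul (hSl v (sub_ne_zero.2 htξ.symm))).const_mul _

end

theorem exists_eLpNorm_freqBlock_bilin_le {d : ℕ} {φ : Rd d → ℝ} (hφ1 : ContDiff ℝ (⊤ : ℕ∞) φ)
    (hφ3 : ∀ x : Rd d, φ x ≠ 0 → 3/4 ≤ ‖x‖ ∧ ‖x‖ ≤ 8/3)
    {p q ρ : ℝ} (hp : 1 < p) (hq : 1 < q) (hρ : 1 ≤ ρ) (hρq : ρ ≤ q) (hρp : ρ ≤ p) (hpρ : p ≤ 2 * ρ) :
    ∃ C : ℝ≥0, ∀ τ : ℝ, 0 ≤ τ → ∀ (j k : ℤ) (u v : Rd d → ℂ), Integrable u → Integrable v →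
      (∃ M, ∀ t, ‖v t‖ ≤ M) →
      eLpNorm (𝓕⁻ (freqBlock φ j (bilin τ (freqBlock φ k u) v))) (ENNReal.ofReal q) ≤
        C * ENNReal.ofReal ((2 : ℝ) ^ ((j : ℝ) * (d / ρ - d / q))) *
          ENNReal.ofReal ((2 : ℝ) ^ ((k : ℝ) * (2 * (d / p) - d / ρ))) *
          (eLpNorm (𝓕⁻ (freqBlock φ k u)) (ENNReal.ofReal p) * eLpNorm (𝓕⁻ v) (ENNReal.ofReal p)) := by
  have hp0 : 0 < p := by linarith
  have hρ0 : 0 < ρ := by linarith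
  let χ : ContDiffBump (0 : Rd d) := ⟨8 / 3, 3, by norm_num, by norm_num⟩
  have h0 : 0 ≤ ρ⁻¹ - p⁻¹ := sub_nonneg.2 (inv_anti₀ hρ0 hρp)
  have hle : ρ⁻¹ - p⁻¹ ≤ p⁻¹ := by
    have h1 : (2 * ρ)⁻¹ ≤ p⁻¹ := inv_anti₀ hp0 hpρ
    rw [mul_inv] at h1
    linarith
  have hr : ENNReal.ofReal p ≤ (ENNReal.ofReal (ρ⁻¹ - p⁻¹))⁻¹ := by
    rw [ENNReal.le_inv_iff_le_inv, ← ENNReal.ofReal_inv_of_pos hp0]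
    exact ENNReal.ofReal_le_ofReal hle
  have hH : ENNReal.HolderTriple (ENNReal.ofReal (ρ⁻¹ - p⁻¹))⁻¹ (ENNReal.ofReal p)
      (ENNReal.ofReal ρ) := ⟨by
    rw [inv_inv, ← ENNReal.ofReal_inv_of_pos hp0, ← ENNReal.ofReal_inv_of_pos hρ0,
      ← ENNReal.ofReal_add h0 (by positivity), sub_add_cancel]⟩
  obtain ⟨C, hC⟩ := exists_eLpNorm_bilin_block_le hφ1 (hasCompactSupport_of_annulus hφ3)
    χ.contDiff χ.hasCompactSupport hp hq hρ hρq hr hH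
  refine ⟨C, fun τ hτ j k u v hu hv hb => ?_⟩
  have h1 := hC τ hτ j k (freqBlock φ k u) v (integrable_freqBlock hφ1 hφ3 k hu) hv hb fun ξ => by
    by_cases h : φ ((2 : ℝ) ^ (-k) • ξ) = 0
    · rw [freqBlock, h, Complex.ofReal_zero, zero_mul, mul_zero]
    · rw [χ.one_of_mem_closedBall (mem_closedBall_zero_iff.2 (hφ3 _ h).2), Complex.ofReal_one, one_mul]
  refine h1.trans_eq ?_
  rw [ENNReal.toReal_inv, inv_inv, ENNReal.toReal_ofReal h0]
  rw [show (j : ℝ) * d * (1 / ρ - 1 / q) = j * (d / ρ - d / q) by ring,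
    show (k : ℝ) * d * (1 / p - (ρ⁻¹ - p⁻¹)) = k * (2 * (d / p) - d / ρ) by ring]

theorem exponent_low_high {x y ε j k l : ℝ} (hx : 0 ≤ x) (hε : 0 ≤ ε) (hεδ : ε ≤ x - y + 2)
    (hkl : k ≤ l - 3) (h1 : j ≤ l + 2) (h2 : l ≤ j + 2) :
    j * (y - y) + k * (2 * x - y) + -(k * (x - 2)) + -(l * x) ≤
      2 * x + 2 * (x - y + 2) + -(j * (y - 2)) + -(ε * |k - j|) + -(ε * |l - j|) := by
  rw [abs_of_nonpos (show k - j ≤ 0 by linarith)]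
  have h3 : |l - j| ≤ 2 := abs_le.2 ⟨by linarith, by linarith⟩
  nlinarith [mul_nonneg (sub_nonneg.2 hεδ) (show 0 ≤ j - k by linarith),
    mul_le_mul_of_nonneg_left h3 hε, mul_nonneg hx (show 0 ≤ l - j + 2 by linarith)]

theorem exponent_high_high {x y z ε j k l : ℝ} (hε : 0 ≤ ε) (hεδ : ε ≤ (z - 2) / 2)
    (hkl : k ≤ l) (hlk : l - 2 ≤ k) (h1 : j ≤ l + 2) :
    j * (z - y) + k * (2 * x - z) + -(k * (x - 2)) + -(l * x) ≤
      5 * (z - 2) + 2 * |x - z + 2| + -(j * (y - 2)) + -(ε * |k - j|) + -(ε * |l - j|) := by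
  have h2 : |l - j| ≤ l - j + 4 := abs_le.2 ⟨by linarith, by linarith⟩
  have h3 : |k - j| ≤ l - j + 6 := abs_le.2 ⟨by linarith, by linarith⟩
  have h4 : (k - l) * (x - z + 2) ≤ 2 * |x - z + 2| := by
    refine (le_abs_self _).trans ?_
    rw [abs_mul]
    exact mul_le_mul_of_nonneg_right (abs_le.2 ⟨by linarith, by linarith⟩) (abs_nonneg _)
  nlinarith [mul_nonneg (sub_nonneg.2 hεδ) (show 0 ≤ 2 * (l - j) + 10 by linarith),
    mul_le_mul_of_nonneg_left h2 hε, mul_le_mul_of_nonneg_left h3 hε]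

/-- Collecting powers of two in a product estimate. -/
theorem le_of_exponent_le {C : ℝ≥0} {X P Q α β : ℝ≥0∞} {a b e f c g h i : ℝ}
    (hX : X ≤ C * ENNReal.ofReal ((2 : ℝ) ^ a) * ENNReal.ofReal ((2 : ℝ) ^ b) * (P * Q))
    (hP : P ≤ ENNReal.ofReal ((2 : ℝ) ^ e) * α) (hQ : Q ≤ ENNReal.ofReal ((2 : ℝ) ^ f) * β)
    (hexp : a + b + e + f ≤ c + g + h + i) :
    X ≤ (C * ((2 : ℝ) ^ c).toNNReal : ℝ≥0) * ENNReal.ofReal ((2 : ℝ) ^ g) *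
      (ENNReal.ofReal ((2 : ℝ) ^ h) * ENNReal.ofReal ((2 : ℝ) ^ i)) * (α * β) := by
  have h2 : (0 : ℝ) < 2 := by norm_num
  have hadd (s t : ℝ) : ENNReal.ofReal ((2 : ℝ) ^ (s + t)) =
      ENNReal.ofReal ((2 : ℝ) ^ s) * ENNReal.ofReal ((2 : ℝ) ^ t) := by
    rw [Real.rpow_add h2, ENNReal.ofReal_mul (by positivity)]
  have hle : ENNReal.ofReal ((2 : ℝ) ^ (a + b + e + f)) ≤ ENNReal.ofReal ((2 : ℝ) ^ (c + g + h + i)) :=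
    ENNReal.ofReal_le_ofReal (Real.rpow_le_rpow_of_exponent_le (by norm_num) hexp)
  simp only [hadd] at hle
  calc X ≤ C * ENNReal.ofReal ((2 : ℝ) ^ a) * ENNReal.ofReal ((2 : ℝ) ^ b) *
        ((ENNReal.ofReal ((2 : ℝ) ^ e) * α) * (ENNReal.ofReal ((2 : ℝ) ^ f) * β)) :=
        hX.trans (mul_le_mul_right (mul_le_mul' hP hQ) _)
    _ = C * (ENNReal.ofReal ((2 : ℝ) ^ a) * ENNReal.ofReal ((2 : ℝ) ^ b) *
        ENNReal.ofReal ((2 : ℝ) ^ e) * ENNReal.ofReal ((2 : ℝ) ^ f)) * (α * β) := by ring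
    _ ≤ C * (ENNReal.ofReal ((2 : ℝ) ^ c) * ENNReal.ofReal ((2 : ℝ) ^ g) *
        ENNReal.ofReal ((2 : ℝ) ^ h) * ENNReal.ofReal ((2 : ℝ) ^ i)) * (α * β) := by gcongr
    _ = _ := by
      rw [ENNReal.coe_mul, ← ENNReal.ofReal]
      ring

theorem exists_eLpNorm_freqBlock_bilin_freqBlock_le {d : ℕ} (hd : 3 ≤ d) {φ : Rd d → ℝ}
    (hφ1 : ContDiff ℝ (⊤ : ℕ∞) φ) (hφ3 : ∀ x : Rd d, φ x ≠ 0 → 3/4 ≤ ‖x‖ ∧ ‖x‖ ≤ 8/3)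
    {p q : ℝ} (hq1 : 1 < q) (hqp : q ≤ p) (hp2q : p ≤ 2 * q)
    (hpd : p < d) (hpq : 1/q < 1/p + 2/(d : ℝ)) :
    ∃ C : ℝ≥0, ∃ ε : ℝ, 0 < ε ∧ ∀ τ : ℝ, 0 ≤ τ → ∀ (j k l : ℤ) (u v : Rd d → ℂ) (α β : ℝ≥0∞),
      k ≤ l → Integrable u → Integrable v → (∃ M, ∀ t, ‖v t‖ ≤ M) →
      eLpNorm (𝓕⁻ (freqBlock φ k u)) (ENNReal.ofReal p) ≤
        ENNReal.ofReal ((2 : ℝ) ^ (-((k : ℝ) * (d / p - 2)))) * α →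
      eLpNorm (𝓕⁻ (freqBlock φ l v)) (ENNReal.ofReal p) ≤
        ENNReal.ofReal ((2 : ℝ) ^ (-((l : ℝ) * (d / p)))) * β →
      eLpNorm (𝓕⁻ (freqBlock φ j (bilin τ (freqBlock φ k u) (freqBlock φ l v)))) (ENNReal.ofReal q) ≤
        C * ENNReal.ofReal ((2 : ℝ) ^ (-((j : ℝ) * (d / q - 2)))) *
          (ENNReal.ofReal ((2 : ℝ) ^ (-(ε * |(k : ℝ) - j|))) *
            ENNReal.ofReal ((2 : ℝ) ^ (-(ε * |(l : ℝ) - j|)))) * (α * β) := by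
  have hp1 : 1 < p := by linarith
  have hd3 : (3 : ℝ) ≤ d := by exact_mod_cast hd
  have hρ0 : 0 < max 1 (p / 2) := lt_max_of_lt_left one_pos
  obtain ⟨C₁, hC₁⟩ := exists_eLpNorm_freqBlock_bilin_le hφ1 hφ3 hp1 hq1 hq1.le le_rfl hqp hp2q
  obtain ⟨C₂, hC₂⟩ := exists_eLpNorm_freqBlock_bilin_le hφ1 hφ3 (ρ := max 1 (p / 2)) hp1 hq1
    (le_max_left _ _) (max_le hq1.le (by linarith)) (max_le hp1.le (by linarith))
    (by linarith [le_max_right 1 (p / 2)])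
  set x := (d : ℝ) / p with hx
  set y := (d : ℝ) / q with hy
  set z := (d : ℝ) / max 1 (p / 2) with hz
  have hδ : 0 < x - y + 2 := by
    have h1 := mul_lt_mul_of_pos_left hpq (show (0 : ℝ) < d by linarith)
    have h2 : (d : ℝ) * (1 / p + 2 / d) = x + 2 := by
      rw [hx]
      field_simp
    have h3 : (d : ℝ) * (1 / q) = y := by rw [hy]; ring
    linarith
  have hδ' : 0 < z - 2 := by
    rw [sub_pos, hz, lt_div_iff₀ hρ0]
    rcases max_cases 1 (p / 2) with ⟨h, _⟩ | ⟨h, _⟩ <;> rw [h] <;> linarith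
  have hx0 : 0 ≤ x := by positivity
  refine ⟨C₁ * ((2 : ℝ) ^ (2 * x + 2 * (x - y + 2))).toNNReal +
    C₂ * ((2 : ℝ) ^ (5 * (z - 2) + 2 * |x - z + 2|)).toNNReal,
    min (x - y + 2) ((z - 2) / 2), lt_min hδ (by linarith), ?_⟩
  intro τ hτ j k l u v α β hkl hu hv hb hα hβ
  have hε := (lt_min hδ (show 0 < (z - 2) / 2 by linarith)).le
  set ε := min (x - y + 2) ((z - 2) / 2)
  have hvl := integrable_freqBlock hφ1 hφ3 l hv
  have hbl := exists_freqBlock_le hφ1 hφ3 l hb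
  by_cases h : j ≤ l + 2 ∧ (l - 2 ≤ k ∨ l ≤ j + 2)
  swap
  · rw [freqBlock_bilin_eq_zero hφ3 hkl u v h]
    have h0 : (𝓕⁻ (0 : Rd d → ℂ) : Rd d → ℂ) = 0 := by
      ext x
      simp [Real.fourierInv_eq]
    rw [h0, eLpNorm_zero]
    exact bot_le
  have hjl : (j : ℝ) ≤ l + 2 := by exact_mod_cast h.1
  by_cases hc : l - 2 ≤ k
  · refine (le_of_exponent_le (hC₂ τ hτ j k u _ hu hvl hbl) hα hβ
      (exponent_high_high hε (min_le_right _ _) (by exact_mod_cast hkl) (by exact_mod_cast hc)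
        hjl)).trans ?_
    gcongr
    exact le_add_self
  · refine (le_of_exponent_le (hC₁ τ hτ j k u _ hu hvl hbl) hα hβ
      (exponent_low_high hx0 hε (min_le_left _ _)
        (by exact_mod_cast (show k ≤ l - 3 by omega)) hjl
        (by exact_mod_cast (show l ≤ j + 2 by omega)))).trans ?_
    gcongr
    exact le_self_add

theorem tsum_two_rpow_neg_abs_ne_top {ε : ℝ} (hε : 0 < ε) :
    ∑' n : ℤ, ENNReal.ofReal ((2 : ℝ) ^ (-(ε * |(n : ℝ)|))) ≠ ∞ := by
  have hg : Summable fun n : ℕ => ((2 : ℝ) ^ (-ε)) ^ n :=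
    summable_geometric_of_lt_one (by positivity) (Real.rpow_lt_one_of_one_lt_of_neg (by norm_num)
      (by linarith))
  have he (n : ℕ) : ((2 : ℝ) ^ (-ε)) ^ n = (2 : ℝ) ^ (-(ε * (n : ℝ))) := by
    rw [← Real.rpow_natCast, ← Real.rpow_mul (by norm_num), neg_mul]
  simp only [he] at hg
  have hs : Summable fun n : ℤ => (2 : ℝ) ^ (-(ε * |(n : ℝ)|)) :=
    Summable.of_nat_of_neg (by simpa using hg) (by simpa using hg)
  exact hs.tsum_ofReal_ne_top

theorem tsum_two_rpow_neg_abs_sub (ε : ℝ) (j : ℤ) :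
    ∑' n : ℤ, ENNReal.ofReal ((2 : ℝ) ^ (-(ε * |(n : ℝ) - j|))) =
      ∑' n : ℤ, ENNReal.ofReal ((2 : ℝ) ^ (-(ε * |(n : ℝ)|))) := by
  rw [← (Equiv.subRight j).tsum_eq fun n : ℤ => ENNReal.ofReal ((2 : ℝ) ^ (-(ε * |(n : ℝ)|)))]
  simp

theorem exists_eLpNorm_bilin_le {d : ℕ} (hd : 3 ≤ d) {φ : Rd d → ℝ}
    (hφ1 : ContDiff ℝ (⊤ : ℕ∞) φ) (hφ3 : ∀ x : Rd d, φ x ≠ 0 → 3/4 ≤ ‖x‖ ∧ ‖x‖ ≤ 8/3)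
    (hφ4 : ∀ ξ : Rd d, ξ ≠ 0 → ∑' j : ℤ, φ (((2 : ℝ) ^ (-j)) • ξ) = 1)
    {p q : ℝ} (hq1 : 1 < q) (hqp : q ≤ p) (hp2q : p ≤ 2 * q)
    (hpd : p < d) (hpq : 1/q < 1/p + 2/(d : ℝ)) :
    ∃ C : ℝ≥0, ∀ τ : ℝ, 0 ≤ τ → ∀ (j : ℤ) (u v : Rd d → ℂ) (α β α' β' : ℝ≥0∞),
      Integrable u → Integrable v → (∃ M, ∀ t, ‖u t‖ ≤ M) → (∃ M, ∀ t, ‖v t‖ ≤ M) →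
      (∀ k : ℤ, eLpNorm (𝓕⁻ (freqBlock φ k u)) (ENNReal.ofReal p) ≤
        ENNReal.ofReal ((2 : ℝ) ^ (-((k : ℝ) * (d / p - 2)))) * α) →
      (∀ k : ℤ, eLpNorm (𝓕⁻ (freqBlock φ k v)) (ENNReal.ofReal p) ≤
        ENNReal.ofReal ((2 : ℝ) ^ (-((k : ℝ) * (d / p)))) * β) →
      (∀ k : ℤ, eLpNorm (𝓕⁻ (freqBlock φ k v)) (ENNReal.ofReal p) ≤
        ENNReal.ofReal ((2 : ℝ) ^ (-((k : ℝ) * (d / p - 2)))) * α') →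
      (∀ k : ℤ, eLpNorm (𝓕⁻ (freqBlock φ k u)) (ENNReal.ofReal p) ≤
        ENNReal.ofReal ((2 : ℝ) ^ (-((k : ℝ) * (d / p)))) * β') →
      eLpNorm (𝓕⁻ (freqBlock φ j (bilin τ u v))) (ENNReal.ofReal q) ≤
        ENNReal.ofReal ((2 : ℝ) ^ (-((j : ℝ) * (d / q - 2)))) * (C * (α * β + α' * β')) := by
  obtain ⟨C, ε, hε, hC⟩ := exists_eLpNorm_freqBlock_bilin_freqBlock_le hd hφ1 hφ3 hq1 hqp hp2q hpd hpq
  lift ∑' n : ℤ, ENNReal.ofReal ((2 : ℝ) ^ (-(ε * |(n : ℝ)|))) to ℝ≥0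
    using tsum_two_rpow_neg_abs_ne_top hε with S hS
  refine ⟨C * (S * S), fun τ hτ j u v α β α' β' hu hv hbu hbv hα hβ hα' hβ' => ?_⟩
  have hi k l := integrable_freqBlock hφ1 hφ3 j (integrable_bilin hτ (integrable_freqBlock hφ1 hφ3 k hu)
    (integrable_freqBlock hφ1 hφ3 l hv) (exists_freqBlock_le hφ1 hφ3 l hbv))
  have hm k l := (continuous_fourierInv (hi k l)).aestronglyMeasurable (μ := volume)
  have hblock (k l : ℤ) :
      eLpNorm (𝓕⁻ (freqBlock φ j (bilin τ (freqBlock φ k u) (freqBlock φ l v)))) (ENNReal.ofReal q) ≤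
        C * ENNReal.ofReal ((2 : ℝ) ^ (-((j : ℝ) * (d / q - 2)))) *
          (ENNReal.ofReal ((2 : ℝ) ^ (-(ε * |(k : ℝ) - j|))) *
            ENNReal.ofReal ((2 : ℝ) ^ (-(ε * |(l : ℝ) - j|)))) * (α * β + α' * β') := by
    rcases le_total k l with hkl | hkl
    · exact (hC τ hτ j k l u v α β hkl hu hv hbv (hα k) (hβ l)).trans
        (mul_le_mul_right le_self_add _)
    · rw [bilin_comm, mul_comm (ENNReal.ofReal ((2 : ℝ) ^ (-(ε * |(k : ℝ) - j|))))]
      exact (hC τ hτ j l k v u α' β' hkl hv hu hbu (hα' l) (hβ' k)).trans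
        (mul_le_mul_right le_add_self _)
  have hq : 1 ≤ ENNReal.ofReal q := ENNReal.one_le_ofReal.2 hq1.le
  refine eLpNorm_le_of_tendsto (F := fun n : ℕ => ∑ k ∈ Finset.Icc (-(n : ℤ)) n,
    ∑ l ∈ Finset.Icc (-(n : ℤ)) n, 𝓕⁻ (freqBlock φ j (bilin τ (freqBlock φ k u) (freqBlock φ l v))))
    (fun n => Finset.aestronglyMeasurable_sum _ fun k _ =>
      Finset.aestronglyMeasurable_sum _ fun l _ => hm k l) (fun x => ?_) fun n => ?_
  · simpa only [Finset.sum_apply] using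
      tendsto_fourierInv_freqBlock_bilin hφ1 hφ3 hφ4 (by omega) hτ hu hv hbv j x
  · refine (eLpNorm_sum_le (fun k _ => Finset.aestronglyMeasurable_sum _ fun l _ => hm k l) hq).trans ?_
    refine (Finset.sum_le_sum fun k _ => (eLpNorm_sum_le (fun l _ => hm k l) hq).trans
      (Finset.sum_le_sum fun l _ => hblock k l)).trans ?_
    simp only [← Finset.sum_mul, ← Finset.mul_sum]
    have hsum : ∑ k ∈ Finset.Icc (-(n : ℤ)) n, ENNReal.ofReal ((2 : ℝ) ^ (-(ε * |(k : ℝ) - j|))) ≤ S := by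
      rw [hS, ← tsum_two_rpow_neg_abs_sub ε j]
      exact ENNReal.sum_le_tsum _
    refine (mul_le_mul_left (mul_le_mul_right (mul_le_mul' hsum hsum) _) _).trans_eq ?_
    push_cast
    ring

theorem fourier_eq_zero_of_not_integrable {d : ℕ} {f : Rd d → ℂ} (hf : ¬Integrable f) : 𝓕 f = 0 := by
  ext ξ
  rw [Real.fourier_eq]
  exact integral_undef fun h => hf ((Real.fourierIntegral_convergent_iff ξ).1 h)

/-- Fourier inversion with the convention that the transform of a non-integrable function is zero. -/
theorem fourier_fourierInv_eq_zero_or {d : ℕ} {c : Rd d → ℂ} (hc : Continuous c) (hi : Integrable c) :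
    𝓕 (𝓕⁻ c : Rd d → ℂ) = 0 ∨ 𝓕 (𝓕⁻ c : Rd d → ℂ) = c := by
  by_cases h : Integrable (𝓕⁻ c : Rd d → ℂ)
  · refine Or.inr (hc.fourier_fourierInv_eq hi (h.comp_neg.congr (.of_forall fun x => ?_)))
    simp only [Real.fourierInv_eq_fourier_neg, neg_neg]
  · exact Or.inl (fourier_eq_zero_of_not_integrable h)

theorem fourier_expL1_mul_expL1 {d : ℕ} {τ : ℝ} (hτ : 0 ≤ τ) {A B : Rd d → ℂ} (hA : Integrable (𝓕 A))
    (hB : Integrable (𝓕 B)) (hBc : Continuous (𝓕 B)) (hBb : ∃ M, ∀ t, ‖𝓕 B t‖ ≤ M) :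
    𝓕 (expL1 d τ fun x => expL1 d (-τ) A x * expL1 d (-τ) B x) = 0 ∨
      𝓕 (expL1 d τ fun x => expL1 d (-τ) A x * expL1 d (-τ) B x) = bilin τ (𝓕 A) (𝓕 B) := by
  let e : ℝ → Rd d → ℂ := fun s ξ => (Real.exp (s * ∑ i, |ξ i|) : ℂ)
  have hec (s : ℝ) : Continuous (e s) := by fun_prop
  have he1 (ξ : Rd d) : ‖e (-τ) ξ‖ ≤ 1 := by
    rw [Complex.norm_real, Real.norm_of_nonneg (Real.exp_pos _).le, Real.exp_le_one_iff, neg_mul,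
      neg_nonpos]
    exact mul_nonneg hτ (Finset.sum_nonneg fun i _ => abs_nonneg _)
  let u : Rd d → ℂ := fun ξ => e (-τ) ξ * 𝓕 A ξ
  let v : Rd d → ℂ := fun ξ => e (-τ) ξ * 𝓕 B ξ
  have hu : Integrable u := integrable_mul_of_norm_le (hec _).measurable he1 hA
  have hv : Integrable v := integrable_mul_of_norm_le (hec _).measurable he1 hB
  have hvb : BddAbove (Set.range fun ξ => ‖v ξ‖) := by
    obtain ⟨M, hM⟩ := hBb
    refine ⟨M, ?_⟩
    rintro _ ⟨ξ, rfl⟩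
    simp only [v, norm_mul]
    exact (mul_le_of_le_one_left (norm_nonneg _) (he1 ξ)).trans (hM ξ)
  let c : Rd d → ℂ := fun ξ => ∫ t, u t * v (ξ - t)
  have hcc : Continuous c :=
    hvb.continuous_convolution_right_of_integrable (ContinuousLinearMap.mul ℂ ℂ) hu ((hec _).mul hBc)
  have hci : Integrable c := integrable_integral_mul_comp_sub hu hv
  have hprod : (fun x => expL1 d (-τ) A x * expL1 d (-τ) B x) = 𝓕⁻ c :=
    funext fun x => (fourierInv_integral_mul_comp_sub hu hv x).symm
  have hbil : (fun ξ => e τ ξ * c ξ) = bilin τ (𝓕 A) (𝓕 B) := by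
    ext ξ
    simp only [c, bilin, ← integral_const_mul]
    refine integral_congr_ae (.of_forall fun t => ?_)
    have h : (gevreySymbol τ t (ξ - t) : ℂ) = e τ ξ * (e (-τ) t * e (-τ) (ξ - t)) := by
      simp only [e, gevreySymbol, ← Complex.ofReal_mul, ← Real.exp_add, PiLp.sub_apply, add_sub_cancel]
      ring_nf
    simp only [u, v, h]
    ring
  rw [hprod]
  rcases fourier_fourierInv_eq_zero_or hcc hci with h | h
  · left
    have h0 : expL1 d τ (𝓕⁻ c : Rd d → ℂ) = 0 := by
      ext x
      simp [expL1, h, Real.fourierInv_eq]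
    rw [h0]
    ext ξ
    simp [Real.fourier_eq]
  · have h1 : expL1 d τ (𝓕⁻ c : Rd d → ℂ) = 𝓕⁻ (bilin τ (𝓕 A) (𝓕 B)) := by
      rw [← hbil, expL1, h]
    rw [h1]
    refine fourier_fourierInv_eq_zero_or ?_ (integrable_bilin hτ hA hB hBb)
    rw [← hbil]
    exact (hec τ).mul hcc

theorem ofReal_two_rpow_mul_neg (s : ℝ) :
    ENNReal.ofReal ((2 : ℝ) ^ s) * ENNReal.ofReal ((2 : ℝ) ^ (-s)) = 1 := by
  rw [← ENNReal.ofReal_mul (by positivity), ← Real.rpow_add (by norm_num), add_neg_cancel,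
    Real.rpow_zero, ENNReal.ofReal_one]

theorem eLpNorm_freqBlock_le_besovNorm {d : ℕ} (φ : Rd d → ℝ) (s : ℝ) (p : ℝ≥0∞) (f : Rd d → ℂ)
    (k : ℤ) : eLpNorm (𝓕⁻ (freqBlock φ k (𝓕 f))) p ≤
      ENNReal.ofReal ((2 : ℝ) ^ (-((k : ℝ) * s))) * besovNorm d φ s p ∞ f := by
  have h : ENNReal.ofReal ((2 : ℝ) ^ ((k : ℝ) * s)) * eLpNorm (𝓕⁻ (freqBlock φ k (𝓕 f))) p ≤
      besovNorm d φ s p ∞ f := by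
    rw [besovNorm, seqNorm, if_pos rfl]
    exact le_iSup (fun j : ℤ => ENNReal.ofReal ((2 : ℝ) ^ ((j : ℝ) * s)) *
      eLpNorm (LPblock d φ j f) p volume) k
  refine le_trans (le_of_eq ?_) (mul_le_mul_right h _)
  rw [← mul_assoc, mul_comm (ENNReal.ofReal _) (ENNReal.ofReal _), ofReal_two_rpow_mul_neg, one_mul]

/-- Gevrey product estimate: for d ≥ 3, 1 < q ≤ p ≤ 2q with p < d and 1/q < 1/p + 2/d,
uniformly in τ ≥ 0, ‖e^{τΛ₁}(ab)‖_{Ḃ^{d/q−2}_{q,∞}} ≲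
‖A‖_{Ḃ^{d/p−2}_{p,∞}}‖B‖_{Ḃ^{d/p}_{p,∞}} + ‖B‖_{Ḃ^{d/p−2}_{p,∞}}‖A‖_{Ḃ^{d/p}_{p,∞}}
where a = e^{−τΛ₁}A, b = e^{−τΛ₁}B. -/
theorem gevrey_product_estimate
    (d : ℕ) (hd : 3 ≤ d) (φ : Rd d → ℝ)
    (hφ1 : ContDiff ℝ (⊤ : ℕ∞) φ)
    (hφ2 : ∀ x y : Rd d, ‖x‖ = ‖y‖ → φ x = φ y)
    (hφ3 : ∀ x : Rd d, φ x ≠ 0 → 3/4 ≤ ‖x‖ ∧ ‖x‖ ≤ 8/3)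
    (hφ4 : ∀ ξ : Rd d, ξ ≠ 0 → ∑' j : ℤ, φ (((2:ℝ) ^ (-j)) • ξ) = 1)
    (p q : ℝ) (hq1 : 1 < q) (hqp : q ≤ p) (hp2q : p ≤ 2 * q)
    (hpd : p < d) (hpq : 1/q < 1/p + 2/(d : ℝ)) :
    ∃ C : ℝ, 0 < C ∧ ∀ τ : ℝ, 0 ≤ τ → ∀ A B : 𝓢(Rd d, ℂ),
      besovNorm d φ ((d : ℝ)/q - 2) (ENNReal.ofReal q) ∞
          (expL1 d τ (fun x => expL1 d (-τ) A x * expL1 d (-τ) B x))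
        ≤ ENNReal.ofReal C *
            (besovNorm d φ ((d : ℝ)/p - 2) (ENNReal.ofReal p) ∞ A
                * besovNorm d φ ((d : ℝ)/p) (ENNReal.ofReal p) ∞ B
              + besovNorm d φ ((d : ℝ)/p - 2) (ENNReal.ofReal p) ∞ B
                * besovNorm d φ ((d : ℝ)/p) (ENNReal.ofReal p) ∞ A) := by
  obtain ⟨C, hC⟩ := exists_eLpNorm_bilin_le hd hφ1 hφ3 hφ4 hq1 hqp hp2q hpd hpq
  refine ⟨C + 1, by positivity, fun τ hτ A B => ?_⟩
  have hint (F : 𝓢(Rd d, ℂ)) : Integrable (𝓕 (F : Rd d → ℂ)) := by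
    rw [← SchwartzMap.fourier_coe]
    exact (𝓕 F).integrable
  have hcont (F : 𝓢(Rd d, ℂ)) : Continuous (𝓕 (F : Rd d → ℂ)) := by
    rw [← SchwartzMap.fourier_coe]
    exact (𝓕 F).continuous
  have hbdd (F : 𝓢(Rd d, ℂ)) : ∃ M, ∀ t, ‖𝓕 (F : Rd d → ℂ) t‖ ≤ M := by
    refine ⟨∫ x, ‖F x‖, fun t => ?_⟩
    have h := norm_fourierInv_le (F : Rd d → ℂ) (-t)
    rwa [Real.fourierInv_eq_fourier_neg, neg_neg] at h
  rw [besovNorm, seqNorm, if_pos rfl]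
  refine iSup_le fun j => ?_
  have h1 : eLpNorm (LPblock d φ j (expL1 d τ fun x => expL1 d (-τ) A x * expL1 d (-τ) B x))
      (ENNReal.ofReal q) volume ≤
      eLpNorm (𝓕⁻ (freqBlock φ j (bilin τ (𝓕 (A : Rd d → ℂ)) (𝓕 (B : Rd d → ℂ))))) (ENNReal.ofReal q) := by
    rcases fourier_expL1_mul_expL1 hτ (hint A) (hint B) (hcont B) (hbdd B) with h | h
    · have h0 : LPblock d φ j (expL1 d τ fun x => expL1 d (-τ) A x * expL1 d (-τ) B x) = 0 := by
        ext x
        simp [LPblock, h, Real.fourierInv_eq]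
      rw [h0, eLpNorm_zero]
      exact bot_le
    · rw [LPblock, h]
      rfl
  have h2 := hC τ hτ j _ _ _ _ _ _ (hint A) (hint B) (hbdd A) (hbdd B)
    (eLpNorm_freqBlock_le_besovNorm φ (d / p - 2) (ENNReal.ofReal p) A)
    (eLpNorm_freqBlock_le_besovNorm φ (d / p) (ENNReal.ofReal p) B)
    (eLpNorm_freqBlock_le_besovNorm φ (d / p - 2) (ENNReal.ofReal p) B)
    (eLpNorm_freqBlock_le_besovNorm φ (d / p) (ENNReal.ofReal p) A)
  refine (mul_le_mul_right (h1.trans h2) _).trans ?_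
  rw [← mul_assoc, ofReal_two_rpow_mul_neg, one_mul]
  refine mul_le_mul_left ?_ _
  rw [← ENNReal.ofReal_coe_nnreal]
  exact ENNReal.ofReal_le_ofReal (by linarith)
end
end

section
/- Let d ≥ 1 and 1 < p < ∞. Then there exists a constant C > 0 such that for every a ≥ 0 and every Schwartz function f on ℝ^d, ‖F^{−1}( e^{−a|ξ|²/2 + √a·|ξ|₁} · Ff )‖_{L^p(ℝ^d)} ≤ C·‖f‖_{L^p(ℝ^d)}; that is, the Fourier multiplier operator e^{(1/2)aΔ + √a·Λ₁} maps L^p boundedly into L^p with operator norm uniformly bounded in a ≥ 0. -/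
open MeasureTheory SchwartzMap Real
open scoped FourierTransform ENNReal NNReal

noncomputable section

/-- The Fourier multiplier e^{(1/2)aΔ + √a·Λ₁} with symbol e^{−a|ξ|²/2 + √a|ξ|₁},
where |ξ| is the Euclidean norm and |ξ|₁ = ∑ᵢ|ξᵢ|. -/
def heatGevrey (d : ℕ) (a : ℝ) (f : Rd d → ℂ) : Rd d → ℂ :=
  𝓕⁻ fun ξ => (Real.exp (-a * ‖ξ‖ ^ 2 / 2 + Real.sqrt a * ∑ i, |ξ i|) : ℂ) * 𝓕 f ξ

/-- Young's inequality `‖K ∗ f‖_p ≤ ‖K‖₁ ‖f‖_p`. -/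
theorem eLpNorm_integral_sub_mul_le {E : Type*} [NormedAddCommGroup E] [MeasurableSpace E]
    [BorelSpace E] [SecondCountableTopology E] (μ : Measure E) [SFinite μ] [μ.IsAddHaarMeasure]
    [μ.IsNegInvariant]
    {K f : E → ℂ} (hK : Measurable K) (hf : Measurable f) {p : ℝ} (hp : 1 < p) :
    eLpNorm (fun x => ∫ y, K (x - y) * f y ∂μ) (ENNReal.ofReal p) μ
      ≤ eLpNorm K 1 μ * eLpNorm f (ENNReal.ofReal p) μ := by
  have hp0 : 0 < p := by linarith
  have hp0' : ENNReal.ofReal p ≠ 0 := by simpa using hp0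
  set N : ℝ≥0∞ := ∫⁻ y, ‖K y‖ₑ ∂μ with hN
  have hpt (x : E) : ‖∫ y, K (x - y) * f y ∂μ‖ₑ ^ p
      ≤ N ^ (p - 1) * ∫⁻ y, ‖K (x - y)‖ₑ * ‖f y‖ₑ ^ p ∂μ := by
    have hKx : AEMeasurable (fun y => ‖K (x - y)‖ₑ) μ := by fun_prop
    have hKf : AEMeasurable (fun y => ‖K (x - y)‖ₑ * ‖f y‖ₑ ^ p) μ := by fun_prop
    have hpinv : p⁻¹ ≤ 1 := inv_le_one_of_one_le₀ hp.le
    have holder := ENNReal.lintegral_mul_norm_pow_le hKx hKf (p := 1 - p⁻¹) (q := p⁻¹)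
      (by linarith) (by positivity) (by ring)
    have hsplit (y : E) : ‖K (x - y)‖ₑ ^ (1 - p⁻¹) * (‖K (x - y)‖ₑ * ‖f y‖ₑ ^ p) ^ p⁻¹
        = ‖K (x - y) * f y‖ₑ := by
      rw [ENNReal.mul_rpow_of_nonneg _ _ (by positivity), ← ENNReal.rpow_mul,
        mul_inv_cancel₀ hp0.ne', ENNReal.rpow_one, ← mul_assoc,
        ← ENNReal.rpow_add_of_nonneg _ _ (by linarith) (by positivity), sub_add_cancel,
        ENNReal.rpow_one, enorm_mul]
    simp_rw [hsplit] at holder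
    rw [lintegral_sub_left_eq_self (fun y => ‖K y‖ₑ) x] at holder
    calc ‖∫ y, K (x - y) * f y ∂μ‖ₑ ^ p
        ≤ (N ^ (1 - p⁻¹) * (∫⁻ y, ‖K (x - y)‖ₑ * ‖f y‖ₑ ^ p ∂μ) ^ p⁻¹) ^ p := by
          gcongr
          exact (enorm_integral_le_lintegral_enorm _).trans holder
      _ = N ^ (p - 1) * ∫⁻ y, ‖K (x - y)‖ₑ * ‖f y‖ₑ ^ p ∂μ := by
          rw [ENNReal.mul_rpow_of_nonneg _ _ hp0.le, ← ENNReal.rpow_mul, ← ENNReal.rpow_mul,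
            inv_mul_cancel₀ hp0.ne', ENNReal.rpow_one, sub_mul, inv_mul_cancel₀ hp0.ne', one_mul]
  have hswap : ∫⁻ x, ∫⁻ y, ‖K (x - y)‖ₑ * ‖f y‖ₑ ^ p ∂μ ∂μ = N * ∫⁻ y, ‖f y‖ₑ ^ p ∂μ := by
    rw [lintegral_lintegral_swap (by fun_prop), ← lintegral_const_mul _ (by fun_prop)]
    congr with y
    rw [lintegral_mul_const _ (by fun_prop), lintegral_sub_right_eq_self (fun x => ‖K x‖ₑ) y]
  have hmeas : Measurable fun x => ∫⁻ y, ‖K (x - y)‖ₑ * ‖f y‖ₑ ^ p ∂μ :=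
    Measurable.lintegral_prod_right' (f := fun z : E × E => ‖K (z.1 - z.2)‖ₑ * ‖f z.2‖ₑ ^ p)
      (by fun_prop)
  rw [eLpNorm_one_eq_lintegral_enorm, eLpNorm_eq_lintegral_rpow_enorm_toReal hp0' (by simp),
    eLpNorm_eq_lintegral_rpow_enorm_toReal hp0' (by simp), ENNReal.toReal_ofReal hp0.le, ← hN]
  calc (∫⁻ x, ‖∫ y, K (x - y) * f y ∂μ‖ₑ ^ p ∂μ) ^ (1 / p)
      ≤ (∫⁻ x, N ^ (p - 1) * ∫⁻ y, ‖K (x - y)‖ₑ * ‖f y‖ₑ ^ p ∂μ ∂μ) ^ (1 / p) := by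
        gcongr with x
        exact hpt x
    _ = (N ^ p * ∫⁻ y, ‖f y‖ₑ ^ p ∂μ) ^ (1 / p) := by
        rw [lintegral_const_mul _ hmeas, hswap,
          ← mul_assoc]
        congr 2
        nth_rewrite 2 [← ENNReal.rpow_one N]
        rw [← ENNReal.rpow_add_of_nonneg _ _ (by linarith) zero_le_one, sub_add_cancel]
    _ = N * (∫⁻ y, ‖f y‖ₑ ^ p ∂μ) ^ (1 / p) := by
        rw [ENNReal.mul_rpow_of_nonneg _ _ (by positivity), ← ENNReal.rpow_mul,
          mul_one_div_cancel hp0.ne', ENNReal.rpow_one]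

section FourierInv

variable {V : Type*} [NormedAddCommGroup V] [InnerProductSpace ℝ V] [FiniteDimensional ℝ V]
  [MeasurableSpace V] [BorelSpace V]

theorem continuous_fourierInv_of_integrable {m : V → ℂ} (hm : Integrable m) :
    Continuous (𝓕⁻ m) :=
  VectorFourier.fourierIntegral_continuous Real.continuous_fourierChar
    (L := -innerₗ V) (continuous_inner (𝕜 := ℝ)).neg hm

/-- The multiplier operator with integrable symbol `m` is convolution with `𝓕⁻ m`. -/
theorem fourierInv_mul_fourier {m f : V → ℂ} (hm : Integrable m) (hf : Integrable f) (x : V) :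
    𝓕⁻ (fun ξ => m ξ * 𝓕 f ξ) x = ∫ y, 𝓕⁻ m (x - y) * f y := by
  have hg : Integrable fun ξ => 𝐞 (inner ℝ ξ x) • m ξ := by
    refine hm.norm.mono' ?_ (by simp)
    exact (Continuous.aestronglyMeasurable (by fun_prop)).smul hm.1
  have h := VectorFourier.integral_fourierIntegral_smul_eq_flip (L := innerₗ V)
    Real.continuous_fourierChar continuous_inner hf hg
  rw [Real.fourierInv_eq]
  convert h using 1
  · congr with ξ
    change _ = 𝓕 f ξ • _
    simp only [Circle.smul_def, smul_eq_mul]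
    ring
  · congr with y
    rw [Real.fourierInv_eq, mul_comm, smul_eq_mul, VectorFourier.fourierIntegral]
    congr 2 with ξ
    simp only [Circle.smul_def, smul_eq_mul, LinearMap.flip_apply, innerₗ_apply_apply]
    rw [← mul_assoc, ← Circle.coe_mul, ← AddChar.map_add_eq_mul, inner_sub_right,
      real_inner_comm y ξ]
    congr 3
    ring

end FourierInv

theorem integrable_prod_coord {d : ℕ} {φ : ℝ → ℂ} (hφ : Integrable φ) :
    Integrable fun ξ : Rd d => ∏ i, φ (ξ i) := by
  rw [← (PiLp.volume_preserving_toLp (Fin d)).integrable_comp_emb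
    (MeasurableEquiv.toLp 2 _).measurableEmbedding]
  exact Integrable.fintype_prod (f := fun _ => φ) fun _ => hφ

theorem integral_prod_coord {𝕜 : Type*} [RCLike 𝕜] {d : ℕ} (φ : Fin d → ℝ → 𝕜) :
    ∫ ξ : Rd d, ∏ i, φ i (ξ i) = ∏ i, ∫ t, φ i t := by
  rw [← (PiLp.volume_preserving_toLp (Fin d)).integral_comp
    (MeasurableEquiv.toLp 2 _).measurableEmbedding]
  exact integral_fintype_prod_volume_eq_prod φ

theorem fourierInv_prod_coord {d : ℕ} (φ : ℝ → ℂ) (x : Rd d) :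
    𝓕⁻ (fun ξ : Rd d => ∏ i, φ (ξ i)) x = ∏ i, 𝓕⁻ φ (x i) := by
  simp_rw [Real.fourierInv_eq' φ, ← integral_prod_coord, Real.fourierInv_eq',
    smul_eq_mul, Finset.prod_mul_distrib, ← Complex.exp_sum, PiLp.inner_apply]
  congr with ξ
  congr 2
  push_cast
  rw [Finset.mul_sum, Finset.sum_mul]

theorem fourierInv_comp_mul (φ : ℝ → ℂ) {s : ℝ} (hs : 0 < s) (x : ℝ) :
    𝓕⁻ (fun t => φ (s * t)) x = (s⁻¹ : ℝ) • 𝓕⁻ φ (s⁻¹ * x) := by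
  rw [Real.fourierInv_eq', Real.fourierInv_eq']
  have h := Measure.integral_comp_mul_left
    (fun t : ℝ => Complex.exp (↑(2 * π * inner ℝ t (s⁻¹ * x)) * Complex.I) • φ t) s
  rw [abs_of_pos (inv_pos.2 hs)] at h
  rw [← h]
  congr with t
  congr 4
  simp only [RCLike.inner_apply, conj_trivial]
  field_simp

theorem integral_norm_fourierInv_comp_mul (φ : ℝ → ℂ) {s : ℝ} (hs : 0 < s) :
    ∫ x, ‖𝓕⁻ (fun t => φ (s * t)) x‖ = ∫ x, ‖𝓕⁻ φ x‖ := by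
  simp_rw [fourierInv_comp_mul φ hs, norm_smul, integral_const_mul]
  rw [Measure.integral_comp_inv_mul_left (fun x => ‖𝓕⁻ φ x‖) s, Real.norm_of_nonneg (by positivity),
    abs_of_pos hs, smul_eq_mul, inv_mul_cancel_left₀ hs.ne']

theorem integrable_fourierInv_comp_mul {φ : ℝ → ℂ} (hφ : Integrable (𝓕⁻ φ)) {s : ℝ} (hs : 0 < s) :
    Integrable (𝓕⁻ (fun t => φ (s * t))) := by
  rw [funext (fourierInv_comp_mul φ hs)]
  exact (hφ.comp_mul_left' (inv_ne_zero hs.ne')).smul (s⁻¹ : ℝ)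

/-- The one-dimensional profile `e^{|t| - t²/2}` of the symbol. -/
def gevreyProfile (t : ℝ) : ℝ := Real.exp (|t| - t ^ 2 / 2)

theorem gevreyProfile_bound (t : ℝ) :
    (2 + 2 * |t| + t ^ 2) * gevreyProfile t ≤ 48 * Real.exp (-(1 / 8) * t ^ 2) := by
  have hexp : Real.exp 1 ≤ 3 := Real.exp_one_lt_three.le
  have hm : gevreyProfile t
      ≤ Real.exp 1 * (Real.exp (-(1 / 8) * t ^ 2) * Real.exp (-(1 / 8) * t ^ 2)) := by
    rw [gevreyProfile, ← Real.exp_add, ← Real.exp_add, Real.exp_le_exp, ← sq_abs]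
    nlinarith [sq_nonneg (|t| - 2)]
  have hpoly : 2 + 2 * |t| + t ^ 2 ≤ 16 * Real.exp (1 / 8 * t ^ 2) := by
    have := Real.add_one_le_exp (1 / 8 * t ^ 2)
    rw [← sq_abs] at this ⊢
    nlinarith [sq_nonneg (|t| - 1)]
  calc (2 + 2 * |t| + t ^ 2) * gevreyProfile t
      ≤ (16 * Real.exp (1 / 8 * t ^ 2)) *
        (3 * (Real.exp (-(1 / 8) * t ^ 2) * Real.exp (-(1 / 8) * t ^ 2))) := by
        refine mul_le_mul hpoly (hm.trans ?_) (Real.exp_pos _).le (by positivity)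
        gcongr
    _ = 48 * Real.exp (-(1 / 8) * t ^ 2) := by
        have : Real.exp (1 / 8 * t ^ 2) * Real.exp (-(1 / 8) * t ^ 2) = 1 := by
          rw [← Real.exp_add]; simp
        linear_combination 48 * Real.exp (-(1 / 8) * t ^ 2) * this

theorem continuous_gevreyProfile : Continuous gevreyProfile := by
  unfold gevreyProfile; fun_prop

theorem gevreyProfile_pos (t : ℝ) : 0 < gevreyProfile t := Real.exp_pos _

theorem integrable_gaussian_majorant :
    Integrable fun t : ℝ => 48 * Real.exp (-(1 / 8) * t ^ 2) :=
  (integrable_exp_neg_mul_sq (by norm_num)).const_mul _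

theorem integrable_mul_gevreyProfile {q : ℝ → ℂ} (hq : Continuous q)
    (hqb : ∀ t, ‖q t‖ ≤ 2 + 2 * |t| + t ^ 2) :
    Integrable fun t => q t * (gevreyProfile t : ℂ) := by
  refine integrable_gaussian_majorant.mono' ?_ (.of_forall fun t => ?_)
  · have := continuous_gevreyProfile
    exact Continuous.aestronglyMeasurable (by fun_prop)
  · rw [norm_mul, Complex.norm_real, Real.norm_of_nonneg (gevreyProfile_pos t).le]
    exact (mul_le_mul_of_nonneg_right (hqb t) (gevreyProfile_pos t).le).trans
      (gevreyProfile_bound t)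

theorem integral_Ioi_cexp_mul_gevreyProfile {c : ℂ} (hc : c ≠ 0) (hre : c.re = 0) :
    ∫ t in Set.Ioi (0 : ℝ), Complex.exp (c * t) * gevreyProfile t
      = -1 / c + 1 / c ^ 2 + 1 / c ^ 2 *
        ∫ t in Set.Ioi (0 : ℝ), Complex.exp (c * t) * (t ^ 2 - 2 * t) * gevreyProfile t := by
  have hnorm (t : ℝ) : ‖Complex.exp (c * t)‖ = 1 := by simp [Complex.norm_exp, hre]
  have hI₀ : Integrable fun t : ℝ => Complex.exp (c * t) * (gevreyProfile t : ℂ) := by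
    refine integrable_mul_gevreyProfile (by fun_prop) fun t => ?_
    rw [hnorm]; nlinarith [abs_nonneg t]
  have hI₂ : Integrable fun t : ℝ =>
      Complex.exp (c * t) * ((t : ℂ) ^ 2 - 2 * t) * (gevreyProfile t : ℂ) := by
    refine integrable_mul_gevreyProfile (by fun_prop) fun t => ?_
    rw [norm_mul, hnorm, one_mul]
    refine (norm_sub_le _ _).trans ?_
    simp only [norm_pow, norm_mul, Complex.norm_real, Complex.norm_ofNat, Real.norm_eq_abs, sq_abs]
    linarith
  set F : ℝ → ℂ := fun t =>
    Complex.exp (c * t) * (1 / c - (1 - t) / c ^ 2) * Complex.exp (t - t ^ 2 / 2) with hF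
  have hprofile {t : ℝ} (ht : 0 ≤ t) :
      (gevreyProfile t : ℂ) = Complex.exp (t - t ^ 2 / 2) := by
    simp [gevreyProfile, abs_of_nonneg ht]
  have hderiv (t : ℝ) (ht : t ∈ Set.Ici (0 : ℝ)) :
      HasDerivAt F (Complex.exp (c * t) * gevreyProfile t -
        1 / c ^ 2 * (Complex.exp (c * t) * ((t : ℂ) ^ 2 - 2 * t) * gevreyProfile t)) t := by
    have hid : HasDerivAt (fun s : ℝ => (s : ℂ)) 1 t := Complex.ofRealCLM.hasDerivAt
    have h1 := (hid.const_mul c).cexp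
    have h2 := ((hid.const_sub 1).div_const (c ^ 2)).const_sub (1 / c)
    have h3 := (hid.sub ((hid.pow 2).div_const 2)).cexp
    rw [hprofile ht]
    refine ((h1.mul h2).mul h3).congr_deriv ?_
    simp only [Pi.mul_apply, Pi.sub_apply, Pi.pow_apply]
    field_simp
    push_cast
    ring
  have hlim : Filter.Tendsto F Filter.atTop (nhds 0) := by
    have hgauss : Filter.Tendsto (fun t : ℝ => (‖1 / c‖ + ‖1 / c ^ 2‖) *
        (48 * Real.exp (-(1 / 8) * t ^ 2))) Filter.atTop (nhds 0) := by
      have : Filter.Tendsto (fun t : ℝ => -(1 / 8) * t ^ 2) Filter.atTop Filter.atBot :=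
        (Filter.tendsto_pow_atTop two_ne_zero).const_mul_atTop_of_neg (by norm_num)
      have h := ((Real.tendsto_exp_atBot.comp this).const_mul 48).const_mul
        (‖1 / c‖ + ‖1 / c ^ 2‖)
      rwa [mul_zero, mul_zero] at h
    refine squeeze_zero_norm' ?_ hgauss
    filter_upwards [Filter.eventually_ge_atTop 0] with t ht
    rw [hF]
    simp only
    rw [← hprofile ht, norm_mul, norm_mul, hnorm, one_mul, Complex.norm_real,
      Real.norm_of_nonneg (gevreyProfile_pos t).le]
    have hq : ‖1 / c - (1 - t) / c ^ 2‖
        ≤ (‖1 / c‖ + ‖1 / c ^ 2‖) * (2 + 2 * |t| + t ^ 2) := by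
      have h1t : ‖(1 - t : ℂ)‖ ≤ 1 + |t| := (norm_sub_le _ _).trans (by simp)
      have hsplit : (1 - t : ℂ) / c ^ 2 = 1 / c ^ 2 * (1 - t) := by ring
      calc ‖1 / c - (1 - t) / c ^ 2‖ ≤ ‖1 / c‖ + ‖1 / c ^ 2‖ * (1 + |t|) := by
            refine (norm_sub_le _ _).trans ?_
            rw [hsplit, norm_mul (1 / c ^ 2)]
            gcongr
        _ ≤ _ := by
            have := norm_nonneg (1 / c)
            have := norm_nonneg (1 / c ^ 2)
            rw [add_mul]
            refine add_le_add (le_mul_of_one_le_right ‹_› ?_) ?_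
            · nlinarith [abs_nonneg t]
            · exact mul_le_mul_of_nonneg_left (by nlinarith [abs_nonneg t]) ‹_›
    refine (mul_le_mul_of_nonneg_right hq (gevreyProfile_pos t).le).trans ?_
    rw [mul_assoc]
    exact mul_le_mul_of_nonneg_left (gevreyProfile_bound t) (by positivity)
  have h := integral_Ioi_of_hasDerivAt_of_tendsto' hderiv
    (hI₀.sub (hI₂.const_mul _)).integrableOn hlim
  rw [integral_sub hI₀.integrableOn (hI₂.const_mul _).integrableOn, integral_const_mul] at h
  have hF0 : F 0 = 1 / c - 1 / c ^ 2 := by simp [hF]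
  rw [hF0] at h
  linear_combination h

theorem integrable_gevreyProfile : Integrable fun t => (gevreyProfile t : ℂ) := by
  simpa using integrable_mul_gevreyProfile (q := fun _ => 1) continuous_const
    (fun t => by rw [norm_one]; nlinarith [abs_nonneg t])

theorem norm_integral_Ioi_cexp_le {c : ℂ} (hre : c.re = 0) :
    ‖∫ t in Set.Ioi (0 : ℝ), Complex.exp (c * t) * (t ^ 2 - 2 * t) * gevreyProfile t‖
      ≤ ∫ t : ℝ, 48 * Real.exp (-(1 / 8) * t ^ 2) := by
  refine (norm_integral_le_of_norm_le integrable_gaussian_majorant.integrableOn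
    (.of_forall fun t => ?_)).trans
    (setIntegral_le_integral integrable_gaussian_majorant (.of_forall fun t => by positivity))
  have hnorm : ‖Complex.exp (c * t)‖ = 1 := by simp [Complex.norm_exp, hre]
  rw [norm_mul, norm_mul, hnorm, one_mul, Complex.norm_real,
    Real.norm_of_nonneg (gevreyProfile_pos t).le]
  refine (mul_le_mul_of_nonneg_right ?_ (gevreyProfile_pos t).le).trans (gevreyProfile_bound t)
  refine (norm_sub_le _ _).trans ?_
  simp only [norm_pow, norm_mul, Complex.norm_real, Complex.norm_ofNat, Real.norm_eq_abs, sq_abs]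
  linarith

theorem fourierInv_gevreyProfile_eq (x : ℝ) :
    𝓕⁻ (fun t => (gevreyProfile t : ℂ)) x
      = (∫ t in Set.Ioi (0 : ℝ), Complex.exp (2 * π * x * Complex.I * t) * gevreyProfile t) +
        ∫ t in Set.Ioi (0 : ℝ), Complex.exp (-(2 * π * x * Complex.I) * t) * gevreyProfile t := by
  set c : ℂ := 2 * π * x * Complex.I with hc
  have hre : c.re = 0 := by simp [hc]
  have hI : Integrable fun t : ℝ => Complex.exp (c * t) * (gevreyProfile t : ℂ) := by
    refine integrable_mul_gevreyProfile (by fun_prop) fun t => ?_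
    have hnorm : ‖Complex.exp (c * t)‖ = 1 := by simp [Complex.norm_exp, hre]
    rw [hnorm]; nlinarith [abs_nonneg t]
  have hint : 𝓕⁻ (fun t => (gevreyProfile t : ℂ)) x
      = ∫ t : ℝ, Complex.exp (c * t) * gevreyProfile t := by
    rw [Real.fourierInv_eq']
    congr with t
    rw [smul_eq_mul, hc]
    congr 2
    simp only [RCLike.inner_apply, conj_trivial]
    push_cast
    ring
  rw [hint, ← integral_add_compl measurableSet_Ioi hI, Set.compl_Ioi]
  congr 1
  have := integral_comp_neg_Ioi 0 fun t : ℝ => Complex.exp (c * t) * (gevreyProfile t : ℂ)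
  rw [neg_zero] at this
  rw [← this]
  congr with t
  simp [gevreyProfile]

theorem integrable_fourierInv_gevreyProfile :
    Integrable (𝓕⁻ fun t => (gevreyProfile t : ℂ)) := by
  set M : ℝ := ∫ t : ℝ, 48 * Real.exp (-(1 / 8) * t ^ 2)
  set B : ℝ := ∫ t : ℝ, ‖(gevreyProfile t : ℂ)‖
  have hcont := continuous_fourierInv_of_integrable integrable_gevreyProfile
  have hM : 0 ≤ M := integral_nonneg fun t => by positivity
  have hbdd (x : ℝ) : ‖𝓕⁻ (fun t => (gevreyProfile t : ℂ)) x‖ ≤ B := by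
    rw [Real.fourierInv_eq]
    exact (norm_integral_le_integral_norm _).trans_eq (by simp [B])
  have hdecay (x : ℝ) : x ^ 2 * ‖𝓕⁻ (fun t => (gevreyProfile t : ℂ)) x‖ ≤ 2 + 2 * M := by
    rcases eq_or_ne x 0 with rfl | hx
    · simp; linarith
    have hc : (2 * π * x * Complex.I : ℂ) ≠ 0 := by simp [hx, Real.pi_ne_zero]
    rw [fourierInv_gevreyProfile_eq]
    set c : ℂ := 2 * π * x * Complex.I with hcdef
    have hre : c.re = 0 := by simp [hcdef]
    have hre' : (-c).re = 0 := by simp [hre]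
    rw [integral_Ioi_cexp_mul_gevreyProfile hc hre,
      integral_Ioi_cexp_mul_gevreyProfile (neg_ne_zero.2 hc) hre']
    have hJ := norm_integral_Ioi_cexp_le hre
    have hJ' := norm_integral_Ioi_cexp_le hre'
    set J := ∫ t in Set.Ioi (0 : ℝ), Complex.exp (c * t) * (t ^ 2 - 2 * t) * gevreyProfile t
    set J' := ∫ t in Set.Ioi (0 : ℝ), Complex.exp (-c * t) * (t ^ 2 - 2 * t) * gevreyProfile t
    have hsum : -1 / c + 1 / c ^ 2 + 1 / c ^ 2 * J + (-1 / -c + 1 / (-c) ^ 2 + 1 / (-c) ^ 2 * J')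
        = 1 / c ^ 2 * (2 + J + J') := by
      rw [neg_sq, neg_div_neg_eq, neg_div]
      ring
    have hcx : x ^ 2 ≤ ‖c ^ 2‖ := by
      have : ‖c ^ 2‖ = (2 * π) ^ 2 * x ^ 2 := by
        simp [hcdef, mul_pow]
      rw [this]
      refine le_mul_of_one_le_left (sq_nonneg x) ?_
      nlinarith [Real.pi_gt_three]
    have hJs : ‖2 + J + J'‖ ≤ 2 + 2 * M := by
      refine (norm_add₃_le).trans ?_
      rw [Complex.norm_ofNat]
      linarith
    have hcpos : 0 < ‖c ^ 2‖ := norm_pos_iff.2 (pow_ne_zero 2 hc)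
    rw [hsum, norm_mul, norm_div, norm_one, ← mul_assoc, mul_one_div]
    exact (mul_le_of_le_one_left (norm_nonneg _) ((div_le_one hcpos).2 hcx)).trans hJs
  refine (integrable_inv_one_add_sq.const_mul (B + (2 + 2 * M))).mono'
    hcont.aestronglyMeasurable (.of_forall fun x => ?_)
  rw [← div_eq_mul_inv, le_div_iff₀ (by positivity)]
  linarith [hbdd x, hdecay x]

theorem heatGevrey_symbol_eq_prod {d : ℕ} {a : ℝ} (ha : 0 ≤ a) (ξ : Rd d) :
    (Real.exp (-a * ‖ξ‖ ^ 2 / 2 + √a * ∑ i, |ξ i|) : ℂ)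
      = ∏ i, (gevreyProfile (√a * ξ i) : ℂ) := by
  rw [← Complex.ofReal_prod]
  congr 1
  simp_rw [gevreyProfile, ← Real.exp_sum]
  congr 1
  simp_rw [EuclideanSpace.real_norm_sq_eq, Finset.mul_sum, Finset.sum_div,
    ← Finset.sum_add_distrib]
  refine Finset.sum_congr rfl fun i _ => ?_
  rw [abs_mul, abs_of_nonneg (Real.sqrt_nonneg a), mul_pow, Real.sq_sqrt ha]
  ring

/-- For 1 < p < ∞ the operator e^{(1/2)aΔ + √aΛ₁} is bounded on L^p(ℝ^d) with
operator norm uniformly bounded in a ≥ 0. -/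
theorem heatGevrey_Lp_bound (d : ℕ) (hd : 1 ≤ d) (p : ℝ) (hp : 1 < p) :
    ∃ C : ℝ, 0 < C ∧ ∀ a : ℝ, 0 ≤ a → ∀ f : 𝓢(Rd d, ℂ),
      eLpNorm (heatGevrey d a (⇑f)) (ENNReal.ofReal p) volume
        ≤ ENNReal.ofReal C * eLpNorm (⇑f) (ENNReal.ofReal p) volume := by
  set A : ℝ := ∫ x, ‖𝓕⁻ (fun t => (gevreyProfile t : ℂ)) x‖
  have hA : 0 ≤ A ^ d := pow_nonneg (integral_nonneg fun _ => norm_nonneg _) d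
  refine ⟨A ^ d + 1, by positivity, fun a ha f => ?_⟩
  rcases ha.eq_or_lt with rfl | ha'
  · have hid : heatGevrey d 0 f = f := by
      have hF : Integrable (𝓕 (⇑f)) := by
        rw [← SchwartzMap.fourier_coe]; exact (𝓕 f).integrable
      unfold heatGevrey
      simpa using f.continuous.fourierInv_fourier_eq f.integrable hF
    rw [hid]
    refine le_mul_of_one_le_left zero_le ?_
    rw [ENNReal.one_le_ofReal]
    linarith
  have hs : 0 < √a := Real.sqrt_pos.2 ha'
  set φ : ℝ → ℂ := fun t => gevreyProfile (√a * t)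
  have hφ : Integrable φ := integrable_gevreyProfile.comp_mul_left' hs.ne'
  have hm : Integrable fun ξ : Rd d => ∏ i, φ (ξ i) := integrable_prod_coord hφ
  have hkey : heatGevrey d a f
      = fun x => ∫ y, 𝓕⁻ (fun ξ : Rd d => ∏ i, φ (ξ i)) (x - y) * f y := by
    ext x
    rw [← fourierInv_mul_fourier hm f.integrable]
    unfold heatGevrey
    simp_rw [heatGevrey_symbol_eq_prod ha]
    rfl
  have hnorm : eLpNorm (𝓕⁻ (fun ξ : Rd d => ∏ i, φ (ξ i))) 1 volume = ENNReal.ofReal (A ^ d) := by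
    have hK : Integrable fun x : Rd d => ∏ i, 𝓕⁻ φ (x i) :=
      integrable_prod_coord (integrable_fourierInv_comp_mul integrable_fourierInv_gevreyProfile hs)
    rw [funext (fourierInv_prod_coord φ), eLpNorm_one_eq_lintegral_enorm,
      ← ofReal_integral_norm_eq_lintegral_enorm hK]
    simp_rw [norm_prod]
    rw [integral_prod_coord (fun _ t => ‖𝓕⁻ φ t‖),
      integral_norm_fourierInv_comp_mul (fun t => (gevreyProfile t : ℂ)) hs]
    simp [A]
  rw [hkey]
  refine (eLpNorm_integral_sub_mul_le volume (continuous_fourierInv_of_integrable hm).measurable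
    f.continuous.measurable hp).trans ?_
  rw [hnorm]
  gcongr
  linarith
end
end
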